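/- Suppose r divides N = d(n−d). Then the number of standard Young tableaux of rectangular shape Rect = (n−d)^d fixed by 𝑗^{N/r}, the (N/r)-th power of jeu de taquin promotion, equals the number of standard r-ribbon tableaux of shape Rect. -/

import Mathlib

open Polynomial

noncomputable section

/-! ### The Grassmannian `X = Gr(d, ℂ_{n-1}[z])` and the Wronski map -/

/-- The Wronskian determinant of a `d`-tuple of polynomials. -/
def wronskDet (d : ℕ) (f : Fin d → Polynomial ℂ) : Polynomial ℂ :=
  Matrix.det (Matrix.of fun i j : Fin d =>
    (fun p : Polynomial ℂ => Polynomial.derivative p)^[(j : ℕ)] (f i))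

/-- `x` is a point of the Grassmannian `Gr(d, ℂ_{n-1}[z])`. -/
def IsGrPoint (n d : ℕ) (x : Submodule ℂ (Polynomial ℂ)) : Prop :=
  x ≤ Polynomial.degreeLT ℂ n ∧ Module.finrank ℂ x = d

/-- `x` lies in the fibre of the Wronski map over `h` (an element of the
projective space `ℙ(ℂ_N[z])`, i.e. the Wronskian of a basis of `x` is a nonzero
scalar multiple of `h`). -/
def InFibre (d : ℕ) (x : Submodule ℂ (Polynomial ℂ)) (h : Polynomial ℂ) : Prop :=
  ∃ (f : Fin d → Polynomial ℂ) (c : ℂ), c ≠ 0 ∧ LinearIndependent ℂ f ∧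
    Submodule.span ℂ (Set.range f) = x ∧ wronskDet d f = c • h

/-- The linear substitution `f(z) ↦ f(c·z)` on polynomials. -/
def rotMap (c : ℂ) : Polynomial ℂ →ₗ[ℂ] Polynomial ℂ :=
  (Polynomial.aeval (Polynomial.C c * Polynomial.X) :
    Polynomial ℂ →ₐ[ℂ] Polynomial ℂ).toLinearMap

/-- `x` is fixed by the cyclic group `C_r ⊂ PGL₂(ℂ)` of classes of
`diag(e^{πij/r}, e^{-πij/r})`, `j = 0, …, r-1`; the induced (projective) action on
`Gr(d, ℂ_{n-1}[z])` is via the substitutions `z ↦ e^{-2πij/r} z`. -/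
def CrFixed (r : ℕ) (x : Submodule ℂ (Polynomial ℂ)) : Prop :=
  ∀ j : Fin r,
    Submodule.map
      (rotMap (Complex.exp (-(2 * (Real.pi : ℂ) * Complex.I * ((j : ℕ) : ℂ)) / (r : ℂ)))) x = x

/-- The linear map `f(z) ↦ z^{n-1} f(1/z)` on `ℂ_{n-1}[z]`,
realizing the reflection `(0 1; 1 0) ∈ PGL₂(ℂ)`. -/
def reflectMap (n : ℕ) : Polynomial ℂ →ₗ[ℂ] Polynomial ℂ :=
  ∑ k ∈ Finset.range n,
    (Polynomial.lcoeff ℂ k).smulRight ((Polynomial.X : Polynomial ℂ) ^ (n - 1 - k))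

/-- `x` is fixed by the dihedral group `D_r ⊂ PGL₂(ℂ)` generated by `C_r` and the
reflection `z ↦ 1/z`. -/
def DrFixed (n r : ℕ) (x : Submodule ℂ (Polynomial ℂ)) : Prop :=
  CrFixed r x ∧ Submodule.map (reflectMap n) x = x

/-! ### Partitions, Richardson varieties, compatibility -/

/-- A partition with at most `d` parts, each of size at most `w`
(recorded as a function `ℕ → ℕ` vanishing from index `d` on; part `i` (0-based)
is the `(i+1)`-st part). -/
structure PartitionIn (d w : ℕ) where
  part : ℕ → ℕ
  antitone : ∀ ⦃i j : ℕ⦄, i ≤ j → part j ≤ part i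
  le_w : ∀ i, part i ≤ w
  eq_zero : ∀ i, d ≤ i → part i = 0

/-- The size `|λ|` of a partition. -/
def PartitionIn.size {d w : ℕ} (lam : PartitionIn d w) : ℕ :=
  ∑ i ∈ Finset.range d, lam.part i

/-- Containment `μ ⊆ λ` of partitions. -/
def SubPartition {d w : ℕ} (mu lam : PartitionIn d w) : Prop :=
  ∀ i, mu.part i ≤ lam.part i

/-- The full rectangular partition `(w)^d`. -/
def rectPart (d w : ℕ) : PartitionIn d w :=
  { part := fun i => if i < d then w else 0
    antitone := by
      intro i j hij
      by_cases hj : j < d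
      · have hi : i < d := lt_of_le_of_lt hij hj
        simp [hi, hj]
      · simp [hj]
    le_w := by intro i; by_cases hi : i < d <;> simp [hi]
    eq_zero := by intro i hi; simp [Nat.not_lt.mpr hi] }

/-- The empty partition. -/
def zeroPart (d w : ℕ) : PartitionIn d w :=
  { part := fun _ => 0
    antitone := by intro i j _; exact le_rfl
    le_w := fun _ => Nat.zero_le _
    eq_zero := fun _ _ => rfl }

/-- The flag `F_i = z^{n-i} ℂ_{i-1}[z]` inside `ℂ_{n-1}[z]`. -/
def Fflag (n i : ℕ) : Submodule ℂ (Polynomial ℂ) :=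
  Polynomial.degreeLT ℂ n ⊓
    Submodule.restrictScalars ℂ (Ideal.span {(Polynomial.X : Polynomial ℂ) ^ (n - i)})

/-- The flag `F̃_i = ℂ_{i-1}[z]`. -/
def Ftilde (i : ℕ) : Submodule ℂ (Polynomial ℂ) := Polynomial.degreeLT ℂ i

/-- Membership in the Richardson variety `X_{λ/μ}`. -/
def InRichardson (n d : ℕ) (lam mu : PartitionIn d (n - d))
    (x : Submodule ℂ (Polynomial ℂ)) : Prop :=
  ∀ i : ℕ, i < d →
    i + 1 ≤ Module.finrank ℂ ↥(x ⊓ Fflag n (n - d - mu.part i + (i + 1))) ∧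
    i + 1 ≤ Module.finrank ℂ ↥(x ⊓ Ftilde (lam.part (d - 1 - i) + (i + 1)))

/-- The Richardson variety `X_{λ/μ}` is compatible with the polynomial `h`:
`μ ⊆ λ`, `|λ| = deg h` and `|μ| = mindeg h`. -/
def Compatible (n d : ℕ) (lam mu : PartitionIn d (n - d)) (h : Polynomial ℂ) : Prop :=
  SubPartition mu lam ∧ lam.size = h.natDegree ∧ mu.size = h.rootMultiplicity 0

/-! ### Ribbons and tableaux -/

/-- Two boxes (row, column) are adjacent. -/
def BoxAdj (p q : ℕ × ℕ) : Prop :=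
  (p.1 = q.1 ∧ (p.2 + 1 = q.2 ∨ q.2 + 1 = p.2)) ∨
  (p.2 = q.2 ∧ (p.1 + 1 = q.1 ∨ q.1 + 1 = p.1))

/-- A set of boxes is an `r`-ribbon: it has `r` boxes, is connected,
and contains no 2×2 square. -/
def IsRibbon (r : ℕ) (S : Set (ℕ × ℕ)) : Prop :=
  S.ncard = r ∧
  (∀ p ∈ S, ∀ q ∈ S, Relation.ReflTransGen (fun u v => u ∈ S ∧ v ∈ S ∧ BoxAdj u v) p q) ∧
  ¬ ∃ i j : ℕ, (i, j) ∈ S ∧ (i + 1, j) ∈ S ∧ (i, j + 1) ∈ S ∧ (i + 1, j + 1) ∈ S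

/-- The box `(i,j)` (0-based row and column) lies in the skew diagram `λ/μ`. -/
def InShape {d w : ℕ} (lam mu : PartitionIn d w) (i j : ℕ) : Prop :=
  i < d ∧ mu.part i ≤ j ∧ j < lam.part i

/-- `E` is a standard `r`-ribbon tableau of skew shape `λ/μ` with entries `1, …, ℓ`
(recorded as a function on boxes, normalized to `0` off the shape). -/
def IsSRT {d w : ℕ} (r ℓ : ℕ) (lam mu : PartitionIn d w) (E : ℕ → ℕ → ℕ) : Prop :=
  (∀ i j, ¬ InShape lam mu i j → E i j = 0) ∧
  (∀ i j, InShape lam mu i j → 1 ≤ E i j ∧ E i j ≤ ℓ) ∧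
  (∀ i j j', InShape lam mu i j → InShape lam mu i j' → j ≤ j' → E i j ≤ E i j') ∧
  (∀ i i' j, InShape lam mu i j → InShape lam mu i' j → i ≤ i' → E i j ≤ E i' j) ∧
  (∀ k, 1 ≤ k → k ≤ ℓ → IsRibbon r {p : ℕ × ℕ | InShape lam mu p.1 p.2 ∧ E p.1 p.2 = k})

/-- A tableau (with boxes inside the `d × w` rectangle and largest entry `m`) is
rotationally invariant: it is fixed by rotating `180°` inside the rectangle and
replacing each entry `k` by `m + 1 - k`. -/
def RotInvariant {d w : ℕ} (m : ℕ) (lam mu : PartitionIn d w) (E : ℕ → ℕ → ℕ) : Prop :=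
  ∀ i j, InShape lam mu i j →
    InShape lam mu (d - 1 - i) (w - 1 - j) ∧
    E (d - 1 - i) (w - 1 - j) = m + 1 - E i j

/-- For `ℓ` even: a tableau of shape `λ/μ` with entries `1, …, ℓ-1`, in which the
boxes with entry `k ≠ ℓ/2` form `r`-ribbons and the boxes with entry `ℓ/2`
form a `2r`-ribbon. -/
def IsHatSRT {d w : ℕ} (r ℓ : ℕ) (lam mu : PartitionIn d w) (E : ℕ → ℕ → ℕ) : Prop :=
  (∀ i j, ¬ InShape lam mu i j → E i j = 0) ∧
  (∀ i j, InShape lam mu i j → 1 ≤ E i j ∧ E i j ≤ ℓ - 1) ∧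
  (∀ i j j', InShape lam mu i j → InShape lam mu i j' → j ≤ j' → E i j ≤ E i j') ∧
  (∀ i i' j, InShape lam mu i j → InShape lam mu i' j → i ≤ i' → E i j ≤ E i' j) ∧
  (∀ k, 1 ≤ k → k ≤ ℓ - 1 → k ≠ ℓ / 2 →
    IsRibbon r {p : ℕ × ℕ | InShape lam mu p.1 p.2 ∧ E p.1 p.2 = k}) ∧
  IsRibbon (2 * r) {p : ℕ × ℕ | InShape lam mu p.1 p.2 ∧ E p.1 p.2 = ℓ / 2}

/-! ### Rectangular standard Young tableaux, promotion and evacuation -/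

/-- `E` is a standard Young tableau of rectangular shape `d × w`
(normalized to `0` outside the rectangle). -/
def IsSYT (d w : ℕ) (E : ℕ → ℕ → ℕ) : Prop :=
  (∀ i j, d ≤ i ∨ w ≤ j → E i j = 0) ∧
  (∀ i j, i < d → j < w → 1 ≤ E i j ∧ E i j ≤ d * w) ∧
  (∀ i j, i < d → j + 1 < w → E i j < E i (j + 1)) ∧
  (∀ i j, i + 1 < d → j < w → E i j < E (i + 1) j) ∧
  (∀ m, 1 ≤ m → m ≤ d * w → ∃ i j, i < d ∧ j < w ∧ E i j = m)

/-- One step of the jeu de taquin slide of the empty box, restricted to the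
subtableau of entries `≤ i₀`: the empty box swaps with the smaller of its east
and south neighbours (among entries `≤ i₀`), if any. -/
def slideStep (d w i₀ : ℕ) (E : ℕ → ℕ → ℕ) (p : ℕ × ℕ) : ℕ × ℕ :=
  if (p.1 + 1 < d ∧ E (p.1 + 1) p.2 ≤ i₀) ∧ (p.2 + 1 < w ∧ E p.1 (p.2 + 1) ≤ i₀) then
    (if E (p.1 + 1) p.2 < E p.1 (p.2 + 1) then (p.1 + 1, p.2) else (p.1, p.2 + 1))
  else if p.1 + 1 < d ∧ E (p.1 + 1) p.2 ≤ i₀ then (p.1 + 1, p.2)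
  else if p.2 + 1 < w ∧ E p.1 (p.2 + 1) ≤ i₀ then (p.1, p.2 + 1)
  else p

/-- The path of the empty box in the jeu de taquin slide, starting in the
northwest corner. -/
def slidePath (d w i₀ : ℕ) (E : ℕ → ℕ → ℕ) : ℕ → ℕ × ℕ
  | 0 => (0, 0)
  | k + 1 => slideStep d w i₀ E (slidePath d w i₀ E k)

/-- Promotion restricted to the entries `1, …, i₀` (the operator `𝑗_{i₀}`):
delete the entry `1`, slide the empty box through the entries `≤ i₀`, decrement
those entries by one and place `i₀` in the final empty box. -/
def partialPromo (d w i₀ : ℕ) (E : ℕ → ℕ → ℕ) : ℕ → ℕ → ℕ := fun i j =>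
  if d ≤ i ∨ w ≤ j then 0
  else if (i, j) = slidePath d w i₀ E i₀ then i₀
  else if slidePath d w i₀ E (i + j) = (i, j) then
    E (slidePath d w i₀ E (i + j + 1)).1 (slidePath d w i₀ E (i + j + 1)).2 - 1
  else if E i j ≤ i₀ then E i j - 1
  else E i j

/-- Jeu de taquin promotion `𝑗` on fillings of the `d × w` rectangle. -/
def promo (d w : ℕ) (E : ℕ → ℕ → ℕ) : ℕ → ℕ → ℕ := partialPromo d w (d * w) E

/-- `evacAux d w i = 𝑗_1 ∘ 𝑗_2 ∘ ⋯ ∘ 𝑗_i`. -/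
def evacAux (d w : ℕ) : ℕ → (ℕ → ℕ → ℕ) → (ℕ → ℕ → ℕ)
  | 0, E => E
  | i + 1, E => evacAux d w i (partialPromo d w (i + 1) E)

/-- Evacuation `𝑒 = 𝑗_1 ∘ 𝑗_2 ∘ ⋯ ∘ 𝑗_N` on fillings of the `d × w` rectangle. -/
def evac (d w : ℕ) (E : ℕ → ℕ → ℕ) : ℕ → ℕ → ℕ := evacAux d w (d * w) E

/-- The `C_r`-fixed polynomial `z^m (z^r + h_1) ⋯ (z^r + h_ℓ)`. -/
def crPoly (r m ℓ : ℕ) (hs : Fin ℓ → ℂ) : Polynomial ℂ :=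
  Polynomial.X ^ m * ∏ i : Fin ℓ, (Polynomial.X ^ r + Polynomial.C (hs i))

/-- The product `∏ (z^r + a_i)(z^r + a_i⁻¹)` of generic inverse pairs. -/
def pairsPoly (r t : ℕ) (a : Fin t → ℂ) : Polynomial ℂ :=
  ∏ i : Fin t,
    ((Polynomial.X ^ r + Polynomial.C (a i)) * (Polynomial.X ^ r + Polynomial.C (a i)⁻¹))

/-- A `D_r`-fixed polynomial of type (1). -/
def type1poly (r m t : ℕ) (ε : ℂ) (a : Fin t → ℂ) : Polynomial ℂ :=
  Polynomial.X ^ m * (Polynomial.X ^ r + Polynomial.C ε) * pairsPoly r t a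

/-- A `D_r`-fixed polynomial of type (2). -/
def type2poly (r m t : ℕ) (a : Fin t → ℂ) : Polynomial ℂ :=
  Polynomial.X ^ m * pairsPoly r t a

/-- A `D_r`-fixed polynomial of type (3). -/
def type3poly (r m t : ℕ) (a : Fin t → ℂ) : Polynomial ℂ :=
  Polynomial.X ^ m * (Polynomial.X ^ r + 1) * (Polynomial.X ^ r - 1) * pairsPoly r t a

/-- `x` is an even-odd point: it has a basis each of whose members is an even or
an odd polynomial. -/
def IsEvenOddPoint (d : ℕ) (x : Submodule ℂ (Polynomial ℂ)) : Prop :=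
  ∃ f : Fin d → Polynomial ℂ, LinearIndependent ℂ f ∧
    Submodule.span ℂ (Set.range f) = x ∧
    ∀ i, (f i).comp (-Polynomial.X) = f i ∨ (f i).comp (-Polynomial.X) = -(f i)

/-- `x` is a real point: it has a basis of polynomials with real coefficients. -/
def IsRealPoint (d : ℕ) (x : Submodule ℂ (Polynomial ℂ)) : Prop :=
  ∃ f : Fin d → Polynomial ℂ, LinearIndependent ℂ f ∧
    Submodule.span ℂ (Set.range f) = x ∧
    ∀ i k, ((f i).coeff k).im = 0

/-- The Möbius action of a matrix on `ℂℙ¹ = ℂ ∪ {∞}` (modelled by `Option ℂ`,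
with `none` playing the role of `∞`). -/
def mobP1 (M : Matrix (Fin 2) (Fin 2) ℂ) : Option ℂ → Option ℂ := fun p =>
  match p with
  | none => if M 1 0 = 0 then none else some (M 0 0 / M 1 0)
  | some a =>
      if M 1 0 * a + M 1 1 = 0 then none
      else some ((M 0 0 * a + M 0 1) / (M 1 0 * a + M 1 1))

/-- The action of a matrix `φ` on `ℂ_{n-1}[z] `:
`(φf)(z) = (φ₂₁ z + φ₁₁)^{n-1} f((φ₂₂ z + φ₁₂)/(φ₂₁ z + φ₁₁))`. -/
def mobiusMap (n : ℕ) (M : Matrix (Fin 2) (Fin 2) ℂ) : Polynomial ℂ →ₗ[ℂ] Polynomial ℂ :=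
  ∑ k ∈ Finset.range n, (Polynomial.lcoeff ℂ k).smulRight
    ((Polynomial.C (M 1 1) * Polynomial.X + Polynomial.C (M 0 1)) ^ k *
     (Polynomial.C (M 1 0) * Polynomial.X + Polynomial.C (M 0 0)) ^ (n - 1 - k))

/-- The polynomial `∏_{a_i ≠ ∞} (z + a_i)` attached to a tuple of points of `ℂℙ¹`. -/
def rootsPoly (N : ℕ) (a : Fin N → Option ℂ) : Polynomial ℂ :=
  ∏ i : Fin N, (a i).elim 1 (fun c => Polynomial.X + Polynomial.C c)

/-- The eigenspace `M_k`: the span of the monomials `z^j`, `j < n`, `j ≡ k (mod r)`. -/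
def eigSpace (n r : ℕ) (k : Fin r) : Submodule ℂ (Polynomial ℂ) :=
  Submodule.span ℂ {p : Polynomial ℂ | ∃ j : ℕ, j < n ∧ j % r = (k : ℕ) ∧ p = Polynomial.X ^ j}

/-- The operator `c` on `ℂ_{n-1}[z]` with `c · z^k = ζ^{n-1-2k} z^k`, `ζ = e^{πi/r}`. -/
def cMap (n r : ℕ) : Polynomial ℂ →ₗ[ℂ] Polynomial ℂ :=
  (Complex.exp ((Real.pi : ℂ) * Complex.I / (r : ℂ))) ^ (n - 1) •
    (Polynomial.aeval
        (Polynomial.C (((Complex.exp ((Real.pi : ℂ) * Complex.I / (r : ℂ))) ^ 2)⁻¹) *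
          Polynomial.X) :
      Polynomial ℂ →ₐ[ℂ] Polynomial ℂ).toLinearMap

/-- `μ` is obtained from `λ` by removing a single `r`-ribbon. -/
def RibbonStep {d w : ℕ} (r : ℕ) (lam mu : PartitionIn d w) : Prop :=
  SubPartition mu lam ∧ IsRibbon r {p : ℕ × ℕ | InShape lam mu p.1 p.2}

/-- `λ` and `μ` have the same `r`-core: they are related by the equivalence
relation generated by removal of a single `r`-ribbon. -/
def RibbonEquiv {d w : ℕ} (r : ℕ) (lam mu : PartitionIn d w) : Prop :=
  Relation.EqvGen (fun a b => RibbonStep r a b) lam mu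

/-- `κ` is an `r`-core: no `r`-ribbon can be removed from it. -/
def IsRCore {d w : ℕ} (r : ℕ) (kappa : PartitionIn d w) : Prop :=
  ¬ ∃ mu : PartitionIn d w, RibbonStep r kappa mu

/-- The column set `J(λ) = {i - 1 + λ^{d+1-i} : 1 ≤ i ≤ d}` of the Plücker
coordinate `p_λ`, as a function of `i`. -/
def pluckerIndex {d w : ℕ} (lam : PartitionIn d w) (i : Fin d) : ℕ :=
  (i : ℕ) + lam.part (d - 1 - (i : ℕ))

/-- The Plücker coordinate `p_λ(x)` of `x` is nonzero (this does not depend on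
the choice of basis of `x`). -/
def PluckerNonzero (d : ℕ) {w : ℕ} (lam : PartitionIn d w)
    (x : Submodule ℂ (Polynomial ℂ)) : Prop :=
  ∃ f : Fin d → Polynomial ℂ, LinearIndependent ℂ f ∧
    Submodule.span ℂ (Set.range f) = x ∧
    Matrix.det (Matrix.of fun i i' : Fin d => (f i).coeff (pluckerIndex lam i')) ≠ 0

end

namespace RP

section Monoid
variable {M : Type*} [Monoid M]

structure Braid (s : ℕ → M) (n : ℕ) : Prop where
  br : ∀ i, i + 1 < n → s i * s (i+1) * s i = s (i+1) * s i * s (i+1)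
  cm : ∀ i j, i + 2 ≤ j → j < n → s i * s j = s j * s i

def cyc (s : ℕ → M) : ℕ → M
  | 0 => 1
  | k+1 => cyc s k * s k

@[simp] theorem cyc_zero (s : ℕ → M) : cyc s 0 = 1 := rfl
theorem cyc_succ (s : ℕ → M) (k : ℕ) : cyc s (k+1) = cyc s k * s k := rfl

theorem cyc_comm {s : ℕ → M} {n : ℕ} (h : Braid s n) (i j : ℕ) (hij : i + 1 ≤ j) (hj : j < n) :
    cyc s i * s j = s j * cyc s i := by
  induction i with
  | zero => simp
  | succ i ih =>
    rw [cyc_succ, mul_assoc, h.cm i j (by omega) hj, ← mul_assoc, ih (by omega), mul_assoc]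

theorem cyc_shift {s : ℕ → M} {n : ℕ} (h : Braid s n) (i k : ℕ) (hik : i + 1 < k) (hk : k ≤ n) :
    cyc s k * s i = s (i+1) * cyc s k := by
  induction k with
  | zero => omega
  | succ k ih =>
    rcases Nat.lt_or_ge (i+1) k with h1 | h1
    · rw [cyc_succ, mul_assoc, ← h.cm i k (by omega) (by omega), ← mul_assoc,
        ih h1 (by omega), mul_assoc]
    · obtain rfl : k = i + 1 := by omega
      rw [cyc_succ, cyc_succ, mul_assoc, mul_assoc, ← mul_assoc (s i), h.br i (by omega)]
      simp only [← mul_assoc]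
      rw [cyc_comm h i (i+1) le_rfl (by omega)]

def dn (s : ℕ → M) (k : ℕ) : ℕ → M
  | 0 => 1
  | j+1 => dn s k j * s (k - j)


theorem dn_shift {s : ℕ → M} {n : ℕ} (h : Braid s n) (k j : ℕ) (hk : k < n) (hj : j ≤ k) :
    dn s k j * cyc s (k+1) = cyc s k * dn s k (j+1) := by
  induction j with
  | zero => simp [dn, cyc_succ]
  | succ j ih =>
    have e : k - j = (k - (j+1)) + 1 := by omega
    have := cyc_shift h (k - (j+1)) (k+1) (by omega) (by omega)
    rw [dn, mul_assoc, e, ← this, ← mul_assoc, ih (by omega)]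
    simp [dn, mul_assoc]

theorem cyc_pow {s : ℕ → M} {n : ℕ} (h : Braid s n) (k j : ℕ) (hk : k < n) (hj : j ≤ k+1) :
    cyc s (k+1) ^ j = cyc s k ^ j * dn s k j := by
  induction j with
  | zero => simp [dn]
  | succ j ih =>
    rw [pow_succ, ih (by omega), mul_assoc, dn_shift h k j hk (by omega), ← mul_assoc, pow_succ]

theorem dn_succ (s : ℕ → M) (k j : ℕ) : dn s (k+1) (j+1) = s (k+1) * dn s k j := by
  induction j with
  | zero => simp [dn]
  | succ j ih => rw [dn, ih, dn, mul_assoc]; congr 3; omega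

theorem dn_cyc_eq {s Q : ℕ → M} {n : ℕ} (h0 : Q 0 = 1) (hQ : ∀ k < n, Q (k+1) = s k * Q k * s k)
    (k : ℕ) (hk : k < n) : dn s k (k+1) * cyc s (k+1) = Q (k+1) := by
  induction k with
  | zero => simp [dn, cyc, hQ 0 hk, h0]
  | succ k ih =>
    rw [dn_succ, cyc_succ, hQ (k+1) hk, ← ih (by omega)]
    simp [mul_assoc]

theorem full_twist {s Q : ℕ → M} {n : ℕ} (h : Braid s n) (h0 : Q 0 = 1)
    (hQ : ∀ k < n, Q (k+1) = s k * Q k * s k) (k : ℕ) (hk : k ≤ n) :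
    cyc s k ^ (k+1) = ((List.range (k+1)).map Q).prod := by
  induction k with
  | zero => simp [h0]
  | succ k ih =>
    rw [pow_succ, cyc_pow h k (k+1) (by omega) le_rfl, mul_assoc,
      dn_cyc_eq h0 hQ k (by omega), ih (by omega), List.range_succ (n := k+1)]
    simp

end Monoid
end RP

namespace RP
open Finset

structure Sys (X L : Type*) (n : ℕ) where
  e : X → ℕ → L
  ct : L → ℤ
  inj : Function.Injective e
  ne1 : ∀ x i, i < n → ct (e x i) ≠ ct (e x (i+1))
  ne2 : ∀ x i, i + 1 < n → ct (e x i) ≠ ct (e x (i+2))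
  cl : ∀ x i, i < n → ct (e x (i+1)) - ct (e x i) ≠ 1 → ct (e x (i+1)) - ct (e x i) ≠ -1 →
    ∃ x', e x' = e x ∘ Equiv.swap i (i+1)

def sg {L : Type*} (i : ℕ) (z : ℕ → L) : ℕ → L := z ∘ Equiv.swap i (i+1)

theorem sg_apply {L : Type*} (i : ℕ) (z : ℕ → L) (j : ℕ) :
    sg i z j = if j = i then z (i+1) else if j = i+1 then z i else z j := by
  simp only [sg, Function.comp, Equiv.swap_apply_def]
  split_ifs <;> rfl

theorem sg_sg {L : Type*} (i : ℕ) (z : ℕ → L) : sg i (sg i z) = z := by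
  funext j; simp only [sg_apply]; split_ifs <;> first | rfl | omega | (subst_vars; rfl)

theorem sg_br {L : Type*} (i : ℕ) (z : ℕ → L) :
    sg i (sg (i+1) (sg i z)) = sg (i+1) (sg i (sg (i+1) z)) := by
  funext j; simp only [sg_apply]; split_ifs <;> first | rfl | omega | (subst_vars; rfl)

theorem sg_cm {L : Type*} (i j : ℕ) (h : i + 2 ≤ j) (z : ℕ → L) :
    sg i (sg j z) = sg j (sg i z) := by
  funext k; simp only [sg_apply]; split_ifs <;> first | rfl | omega | (subst_vars; rfl)

structure Par (h : ℝ) (D f : ℤ → ℝ) : Prop where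
  fe : ∀ ρ, f (-ρ) = f ρ
  f1 : f 1 = 0
  fsq : ∀ ρ, ρ ≠ 0 → f ρ ^ 2 = 1 + D ρ * D (-ρ)
  dadd : ∀ ρ, ρ ≠ 0 → D ρ + D (-ρ) = h
  dmul : ∀ a b, a ≠ 0 → b ≠ 0 → a + b ≠ 0 → D a * D b = D (a+b) * (D a + D b - h)

namespace Sys
variable {X L : Type*} {n : ℕ} (S : Sys X L n)

def rho (i : ℕ) (z : ℕ → L) : ℤ := S.ct (z (i+1)) - S.ct (z i)

theorem rho_sg (i : ℕ) (z : ℕ → L) : S.rho i (sg i z) = - S.rho i z := by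
  simp [rho, sg_apply]
theorem rho_sg1 (i : ℕ) (z : ℕ → L) : S.rho (i+1) (sg i z) = S.rho i z + S.rho (i+1) z := by
  simp [rho, sg_apply, show i + 1 + 1 ≠ i by omega]
theorem rho_sg2 (i : ℕ) (z : ℕ → L) : S.rho i (sg (i+1) z) = S.rho i z + S.rho (i+1) z := by
  simp [rho, sg_apply, show i ≠ i + 1 + 1 by omega]
theorem rho_sg3 (i j : ℕ) (h : i + 2 ≤ j) (z : ℕ → L) : S.rho i (sg j z) = S.rho i z := by
  simp only [rho, sg_apply]
  rw [if_neg (by omega), if_neg (by omega), if_neg (by omega), if_neg (by omega)]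
theorem rho_sg4 (i j : ℕ) (h : i + 2 ≤ j) (z : ℕ → L) : S.rho j (sg i z) = S.rho j z := by
  simp only [rho, sg_apply]
  rw [if_neg (by omega), if_neg (by omega), if_neg (by omega), if_neg (by omega)]

theorem rho_ne (x : X) (i : ℕ) (hi : i < n) : S.rho i (S.e x) ≠ 0 := by
  have := S.ne1 x i hi; unfold rho; omega
theorem rho_ne2 (x : X) (i : ℕ) (hi : i + 1 < n) : S.rho i (S.e x) + S.rho (i+1) (S.e x) ≠ 0 := by
  have := S.ne2 x i hi; unfold rho; 
  have : S.ct (S.e x (i+1+1)) = S.ct (S.e x (i+2)) := rfl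
  omega

variable [Fintype X]

open Classical in
noncomputable def ext (v : X → ℝ) (z : ℕ → L) : ℝ := ∑ y, if S.e y = z then v y else 0

theorem ext_e (v : X → ℝ) (x : X) : S.ext v (S.e x) = v x := by
  classical
  unfold ext
  rw [Finset.sum_eq_single x]
  · simp
  · intro y _ hy; rw [if_neg]; intro h; exact hy (S.inj h)
  · simp

theorem ext_of_not (v : X → ℝ) (z : ℕ → L) (h : ∀ x, S.e x ≠ z) : S.ext v z = 0 := by
  classical
  unfold ext
  apply Finset.sum_eq_zero
  intro y _; rw [if_neg (h y)]

theorem ext_add (v w : X → ℝ) (z : ℕ → L) : S.ext (v + w) z = S.ext v z + S.ext w z := by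
  by_cases h : ∃ x, S.e x = z
  · obtain ⟨x, rfl⟩ := h; simp [ext_e]
  · push Not at h; simp [ext_of_not _ _ _ h]
theorem ext_smul (c : ℝ) (w : X → ℝ) (z : ℕ → L) : S.ext (c • w) z = c * S.ext w z := by
  by_cases h : ∃ x, S.e x = z
  · obtain ⟨x, rfl⟩ := h; simp [ext_e]
  · push Not at h; simp [ext_of_not _ _ _ h]

noncomputable def op (D f : ℤ → ℝ) (i : ℕ) : Module.End ℝ (X → ℝ) where
  toFun v x := D (S.rho i (S.e x)) * v x + f (S.rho i (S.e x)) * S.ext v (sg i (S.e x))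
  map_add' v w := by funext x; simp [ext_add]; ring
  map_smul' c v := by funext x; simp [ext_smul]; ring

theorem op_apply (D f : ℤ → ℝ) (i : ℕ) (v : X → ℝ) (x : X) : S.op D f i v x =
    D (S.rho i (S.e x)) * v x + f (S.rho i (S.e x)) * S.ext v (sg i (S.e x)) := rfl

theorem ext_op {D f : ℤ → ℝ} (fe : ∀ ρ, f (-ρ) = f ρ) (f1 : f 1 = 0) {i : ℕ} (hi : i < n)
    (v : X → ℝ) (z : ℕ → L) : S.ext (S.op D f i v) z =
    D (S.rho i z) * S.ext v z + f (S.rho i z) * S.ext v (sg i z) := by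
  by_cases h : ∃ x, S.e x = z
  · obtain ⟨x, rfl⟩ := h; simp only [ext_e, op_apply]
  · push Not at h
    rw [ext_of_not _ _ _ h, ext_of_not _ _ _ h]
    by_cases h' : ∃ x, S.e x = sg i z
    · obtain ⟨x, hx⟩ := h'
      have hf : f (S.rho i z) = 0 := by
        by_contra hne
        have e1 : S.rho i z = - S.rho i (S.e x) := by rw [hx, rho_sg]; ring
        rw [e1, fe] at hne
        obtain ⟨x', hx'⟩ := S.cl x i hi (by
          intro h; apply hne; show f _ = 0; rw [show S.rho i (S.e x) = 1 from h, f1]) (by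
          intro h; apply hne; rw [show S.rho i (S.e x) = -1 from h, fe, f1])
        apply h x'
        rw [hx', hx]; exact sg_sg i z
      rw [hf]; simp
    · push Not at h'
      rw [ext_of_not _ _ _ h']; simp

variable {h : ℝ} {D f : ℤ → ℝ} 

theorem op_quad' (fe : ∀ ρ, f (-ρ) = f ρ) (f1 : f 1 = 0)
    (fsq : ∀ ρ, ρ ≠ 0 → f ρ ^ 2 = 1 + D ρ * D (-ρ)) (dadd : ∀ ρ, ρ ≠ 0 → D ρ + D (-ρ) = h)
    {i : ℕ} (hi : i < n) :
    S.op D f i * S.op D f i = h • S.op D f i + 1 := by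
  apply LinearMap.ext; intro v; funext x
  have hr := S.rho_ne x i hi
  simp only [Module.End.mul_apply, LinearMap.add_apply, LinearMap.smul_apply, Pi.add_apply,
    Pi.smul_apply, Module.End.one_apply, smul_eq_mul]
  rw [← S.ext_e (S.op D f i (S.op D f i v)), ← S.ext_e (S.op D f i v), ← S.ext_e v]
  simp only [S.ext_op fe f1 hi, rho_sg, sg_sg, fe]
  set ρ := S.rho i (S.e x)
  linear_combination (S.ext v (S.e x)) * fsq ρ hr + (D ρ * S.ext v (S.e x) + f ρ * S.ext v (sg i (S.e x))) * dadd ρ hr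

theorem op_quad (P : Par h D f) {i : ℕ} (hi : i < n) :
    S.op D f i * S.op D f i = h • S.op D f i + 1 := S.op_quad' P.fe P.f1 P.fsq P.dadd hi

theorem op_comm (P : Par h D f) {i j : ℕ} (hij : i + 2 ≤ j) (hj : j < n) :
    S.op D f i * S.op D f j = S.op D f j * S.op D f i := by
  apply LinearMap.ext; intro v; funext x
  simp only [Module.End.mul_apply]
  rw [← S.ext_e (S.op D f i (S.op D f j v)), ← S.ext_e (S.op D f j (S.op D f i v))]
  have hi : i < n := by omega
  simp only [S.ext_op P.fe P.f1 hi, S.ext_op P.fe P.f1 hj, S.rho_sg3 i j hij, S.rho_sg4 i j hij,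
    sg_cm i j hij]
  ring

theorem op_braid (P : Par h D f) {i : ℕ} (hi1 : i + 1 < n) :
    S.op D f i * S.op D f (i+1) * S.op D f i = S.op D f (i+1) * S.op D f i * S.op D f (i+1) := by
  apply LinearMap.ext; intro v; funext x
  simp only [Module.End.mul_apply]
  have hi : i < n := by omega
  rw [← S.ext_e (S.op D f i (S.op D f (i+1) (S.op D f i v))), ← S.ext_e (S.op D f (i+1) (S.op D f i (S.op D f (i+1) v)))]
  have ha := S.rho_ne x i hi
  have hb := S.rho_ne x (i+1) hi1
  have hab := S.rho_ne2 x i hi1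
  simp only [S.ext_op P.fe P.f1 hi, S.ext_op P.fe P.f1 hi1, rho_sg, rho_sg1, rho_sg2, sg_sg, P.fe]
  rw [sg_br]
  set a := S.rho i (S.e x)
  set b := S.rho (i+1) (S.e x)
  simp only [neg_add_cancel_left, add_neg_cancel_right]
  have h1 := P.dmul a b ha hb hab
  have q1 := P.dadd a ha
  have q2 := P.dadd b hb
  have s1 := P.fsq a ha
  have s2 := P.fsq b hb
  have e1 : D (-a) = h - D a := by linarith
  have e2 : D (-b) = h - D b := by linarith
  rw [e1] at s1 ⊢
  rw [e2] at s2 ⊢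
  set z := S.e x
  set c := D (a+b)
  linear_combination (S.ext v z * (D a - D b) + S.ext v (sg i z) * f a
    - S.ext v (sg (i+1) z) * f b) * h1 + S.ext v z * c * s1 - S.ext v z * c * s2

theorem op_Braid (P : Par h D f) : Braid (S.op D f) n :=
  ⟨fun _ hi => S.op_braid P hi, fun _ _ hij hj => S.op_comm P hij hj⟩


/-! trace of increasing products -/
noncomputable def lp (D f : ℤ → ℝ) (l : List ℕ) : Module.End ℝ (X → ℝ) := (l.map (S.op D f)).prod

def dg (g : X → ℝ) : Module.End ℝ (X → ℝ) where
  toFun v x := g x * v x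
  map_add' v w := by funext x; simp; ring
  map_smul' c v := by funext x; simp; ring

theorem dg_apply (g v : X → ℝ) (x : X) : dg g v x = g x * v x := rfl

theorem lp_zero (fe : ∀ ρ, f (-ρ) = f ρ) (f1 : f 1 = 0) (j : ℕ) (c : L) (l : List ℕ)
    (hl : ∀ i ∈ l, j < i ∧ i < n) (v : X → ℝ) (hv : ∀ z, z j ≠ c → S.ext v z = 0) :
    ∀ z, z j ≠ c → S.ext (S.lp D f l v) z = 0 := by
  induction l with
  | nil => simpa [lp] using hv
  | cons i l ih =>
    intro z hz
    have hi := hl i (by simp)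
    have ih := ih (fun k hk => hl k (by simp [hk]))
    have : S.lp D f (i :: l) v = S.op D f i (S.lp D f l v) := by simp [lp]
    rw [this, S.ext_op fe f1 hi.2, ih z hz, ih (sg i z) (by
      rw [sg_apply, if_neg (by omega), if_neg (by omega)]; exact hz)]
    simp

theorem lp_diag [DecidableEq X] (fe : ∀ ρ, f (-ρ) = f ρ) (f1 : f 1 = 0) (l : List ℕ)
    (hs : l.Pairwise (· < ·)) (hl : ∀ i ∈ l, i < n) (x : X) :
    S.lp D f l (Pi.single x 1) x = (l.map (fun i => D (S.rho i (S.e x)))).prod := by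
  induction l with
  | nil => simp [lp]
  | cons i l ih =>
    have hs' := List.pairwise_cons.1 hs
    have : S.lp D f (i :: l) (Pi.single x 1) = S.op D f i (S.lp D f l (Pi.single x 1)) := by simp [lp]
    rw [this, op_apply, ih hs'.2 (fun k hk => hl k (by simp [hk])),
      S.lp_zero fe f1 i (S.e x i) l (fun k hk => ⟨hs'.1 k hk, hl k (by simp [hk])⟩)]
    · simp
    · intro z hz
      by_cases hh : ∃ y, S.e y = z
      · obtain ⟨y, rfl⟩ := hh
        rw [ext_e, Pi.single_apply, if_neg]
        rintro rfl; exact hz rfl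
      · push Not at hh; exact S.ext_of_not _ _ hh
    · rw [sg_apply, if_pos rfl]
      intro hh
      have := S.ne1 x i (hl i (by simp))
      rw [hh] at this; exact this rfl

theorem trace_eq [DecidableEq X] (F : Module.End ℝ (X → ℝ)) :
    LinearMap.trace ℝ (X → ℝ) F = ∑ x, F (Pi.single x 1) x := by
  rw [LinearMap.trace_eq_matrix_trace ℝ (Pi.basisFun ℝ X)]
  simp [Matrix.trace, LinearMap.toMatrix_apply]

theorem trace_lp (fe : ∀ ρ, f (-ρ) = f ρ) (f1 : f 1 = 0) (l : List ℕ)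
    (hs : l.Pairwise (· < ·)) (hl : ∀ i ∈ l, i < n) (g g' : X → ℝ) :
    LinearMap.trace ℝ (X → ℝ) (dg g * S.lp D f l * dg g') =
      ∑ x, g x * (l.map (fun i => D (S.rho i (S.e x)))).prod * g' x := by
  classical
  rw [trace_eq]
  refine Finset.sum_congr rfl fun x _ => ?_
  have : dg g' (Pi.single x 1) = g' x • (Pi.single x 1 : X → ℝ) := by
    funext y; rw [dg_apply]
    by_cases hy : y = x
    · subst hy; simp
    · simp [hy]
  simp only [Module.End.mul_apply, this, map_smul, dg_apply, Pi.smul_apply, smul_eq_mul,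
    S.lp_diag fe f1 l hs hl]
  ring

end Sys
end RP

namespace RP
section WP
variable {G : Type*} [Monoid G]

def cl (g : ℕ → G) (a n : ℕ) : Submonoid G := Submonoid.closure {x | ∃ i, a ≤ i ∧ i < n ∧ x = g i}

def ds (g : ℕ → G) (a : ℕ) : ℕ → G
  | 0 => 1
  | k+1 => g (a+k) * ds g a k

theorem ds_comm {g : ℕ → G} {n : ℕ} (h : Braid g n) (a k i : ℕ) (hi : a + k < i) (hn : i < n) :
    g i * ds g a k = ds g a k * g i := by
  induction k with
  | zero => simp [ds]
  | succ k ih =>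
    rw [ds, ← mul_assoc, ← h.cm (a+k) i (by omega) hn, mul_assoc, ih (by omega), mul_assoc]

theorem ds_shift {g : ℕ → G} {n : ℕ} (h : Braid g n) (a k i : ℕ) (ha : a ≤ i) (hi : i + 1 < a + k)
    (hn : a + k ≤ n) : g i * ds g a k = ds g a k * g (i+1) := by
  induction k with
  | zero => omega
  | succ k ih =>
    rcases Nat.lt_or_ge (i+1) (a+k) with h1 | h1
    · rw [ds, ← mul_assoc, h.cm i (a+k) (by omega) (by omega), mul_assoc, ih h1 (by omega), mul_assoc]
    · obtain ⟨k, rfl⟩ : ∃ k', k = k' + 1 := ⟨k-1, by omega⟩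
      obtain rfl : i = a + k := by omega
      rw [ds, ds, ← mul_assoc, ← mul_assoc]
      rw [show a + (k+1) = a + k + 1 by ring, h.br (a+k) (by omega), mul_assoc,
        ds_comm h a k (a+k+1) (by omega) (by omega)]
      simp only [mul_assoc]

theorem nf {g : ℕ → G} {n : ℕ} (h : Braid g n) (h2 : ∀ i < n, g i * g i = 1) (a : ℕ) (ha : a ≤ n)
    (x : G) (hx : x ∈ cl g a n) : ∃ k y, a + k ≤ n ∧ y ∈ cl g (a+1) n ∧ x = ds g a k * y := by
  induction hx using Submonoid.closure_induction_left with
  | one => exact ⟨0, 1, by omega, Submonoid.one_mem _, by simp [ds]⟩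
  | mul_left x hx y hy ih =>
    obtain ⟨i, hai, hin, rfl⟩ := hx
    obtain ⟨k, z, hk, hz, rfl⟩ := ih
    rcases lt_trichotomy i (a+k) with h1 | h1 | h1
    · rcases Nat.lt_or_ge (i+1) (a+k) with h3 | h3
      · refine ⟨k, g (i+1) * z, hk, Submonoid.mul_mem _ (Submonoid.subset_closure ⟨i+1, by omega, by omega, rfl⟩) hz, ?_⟩
        rw [← mul_assoc, ds_shift h a k i hai h3 hk, mul_assoc]
      · obtain ⟨k, rfl⟩ : ∃ k', k = k' + 1 := ⟨k-1, by omega⟩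
        obtain rfl : i = a + k := by omega
        refine ⟨k, z, by omega, hz, ?_⟩
        rw [ds, ← mul_assoc, ← mul_assoc, h2 _ hin, one_mul]
    · subst h1
      exact ⟨k+1, z, by omega, hz, by rw [ds, mul_assoc]⟩
    · refine ⟨k, g i * z, hk, Submonoid.mul_mem _ (Submonoid.subset_closure ⟨i, by omega, by omega, rfl⟩) hz, ?_⟩
      rw [← mul_assoc, ds_comm h a k i h1 hin, mul_assoc]
end WP

def swg (i : ℕ) : Equiv.Perm ℕ := Equiv.swap i (i+1)

theorem swg_apply (i x : ℕ) : swg i x = if x = i then i+1 else if x = i+1 then i else x := by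
  simp [swg, Equiv.swap_apply_def]

theorem swg_braid (n : ℕ) : Braid swg n := by
  constructor
  · intro i _
    ext x; simp only [Equiv.Perm.mul_apply, swg_apply]; split_ifs <;> omega
  · intro i j _ _
    ext x; simp only [Equiv.Perm.mul_apply, swg_apply]; split_ifs <;> omega

theorem swg_sq (i : ℕ) : swg i * swg i = 1 := by simp [swg]

section
variable {M : Type*} [Monoid M] {s : ℕ → M} {n : ℕ}

def pg (s : ℕ → M) (i : ℕ) : Equiv.Perm ℕ × M := (swg i, s i)

theorem pg_braid (h : Braid s n) : Braid (pg s) n := by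
  constructor
  · intro i hi
    exact Prod.ext ((swg_braid n).br i hi) (h.br i hi)
  · intro i j hi hj
    exact Prod.ext ((swg_braid n).cm i j hi hj) (h.cm i j hi hj)

theorem pg_fix (a : ℕ) (x : Equiv.Perm ℕ × M) (hx : x ∈ cl (pg s) (a+1) n) : x.1 a = a := by
  induction hx using Submonoid.closure_induction_left with
  | one => simp
  | mul_left x hx y hy ih =>
    obtain ⟨i, hai, hin, rfl⟩ := hx
    simp only [Prod.fst_mul, Equiv.Perm.mul_apply, ih]
    simp only [pg, swg_apply]; split_ifs <;> omega

theorem ds_perm (a k : ℕ) : (ds (pg s) a k).1 a = a + k := by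
  induction k with
  | zero => simp [ds]
  | succ k ih =>
    rw [ds, Prod.fst_mul, Equiv.Perm.mul_apply, ih]; simp [pg, swg_apply]; omega

theorem word (h : Braid s n) (h2 : ∀ i < n, s i * s i = 1) (x : Equiv.Perm ℕ × M) 
    (j : ℕ) : ∀ a, a + j = n → x ∈ cl (pg s) a n → x.1 = 1 → x.2 = 1 := by
  induction j with
  | zero =>
    intro a ha hx h1
    have : cl (pg s) a n = ⊥ := by
      unfold cl
      rw [eq_bot_iff, Submonoid.closure_le]
      rintro y ⟨i, h1, h2, _⟩; omega
    rw [this, Submonoid.mem_bot] at hx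
    rw [hx]; rfl
  | succ j ih =>
    intro a ha hx h1
    obtain ⟨k, y, hk, hy, rfl⟩ := nf (pg_braid h)
      (fun i hi => Prod.ext (swg_sq i) (h2 i hi)) a (by omega) x hx
    have hk0 : k = 0 := by
      have := congrArg (fun p : Equiv.Perm ℕ => p a) h1
      simp only [Prod.fst_mul, Equiv.Perm.mul_apply, pg_fix a y hy, ds_perm] at this
      simpa using this
    subst hk0
    rw [ds, one_mul] at *
    exact ih (a+1) (by omega) hy h1

theorem cl_mono {G : Type*} [Monoid G] (g : ℕ → G) (n m : ℕ) (h : n ≤ m) : cl g 0 n ≤ cl g 0 m := by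
  apply Submonoid.closure_mono
  rintro x ⟨i, hi, hn, rfl⟩; exact ⟨i, hi, by omega, rfl⟩

theorem exists_down (s : ℕ → M) (m : ℕ) (k : ℕ) (hk : k ≤ m) :
    ∃ c ∈ cl (pg s) 0 m, c.1 m = m - k := by
  induction k with
  | zero => exact ⟨1, Submonoid.one_mem _, by simp⟩
  | succ k ih =>
    obtain ⟨c, hc, h⟩ := ih (by omega)
    refine ⟨pg s (m-(k+1)) * c, Submonoid.mul_mem _ (Submonoid.subset_closure ⟨_, by omega, by omega, rfl⟩) hc, ?_⟩
    simp only [Prod.fst_mul, Equiv.Perm.mul_apply, h, pg, swg_apply]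
    split_ifs <;> omega

theorem exists_lift (s : ℕ → M) (m : ℕ) : ∀ τ : Equiv.Perm ℕ, (∀ x > m, τ x = x) →
    ∃ c ∈ cl (pg s) 0 m, c.1 = τ := by
  induction m with
  | zero =>
    intro τ h
    refine ⟨1, Submonoid.one_mem _, ?_⟩
    ext x
    rcases Nat.eq_zero_or_pos x with rfl | hx
    · by_contra hne
      have h1 : τ 0 > 0 := by simp at hne; omega
      have := h _ h1
      have := τ.injective this; omega
    · simp [h x hx]
  | succ m ih =>
    intro τ h
    have hy : τ (m+1) ≤ m+1 := by
      by_contra hne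
      have := h _ (not_le.1 hne)
      have := τ.injective this; omega
    obtain ⟨c, hc, hcy⟩ := exists_down s (m+1) (m+1 - τ (m+1)) (by omega)
    have hcx : ∀ x ∈ cl (pg s) 0 (m+1), ∀ z > m+1, x.1 z = z := by
      intro x hx
      induction hx using Submonoid.closure_induction_left with
      | one => simp
      | mul_left x hx y hy ih =>
        obtain ⟨i, hai, hin, rfl⟩ := hx
        intro z hz
        simp only [Prod.fst_mul, Equiv.Perm.mul_apply, ih z hz]
        simp only [pg, swg_apply]; split_ifs <;> omega
    obtain ⟨c', hc', h'⟩ := ih (c.1⁻¹ * τ) (by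
      intro x hx
      rw [Equiv.Perm.mul_apply, Equiv.Perm.inv_eq_iff_eq]
      rcases Nat.lt_or_ge (m+1) x with h1 | h1
      · rw [h x h1, hcx c hc x h1]
      · obtain rfl : x = m+1 := by omega
        rw [hcy]; omega)
    refine ⟨c * c', Submonoid.mul_mem _ hc (cl_mono _ _ _ (by omega) hc'), ?_⟩
    rw [Prod.fst_mul, h']; simp

theorem exists_inv (h2 : ∀ i < n, s i * s i = 1) (x : Equiv.Perm ℕ × M) (hx : x ∈ cl (pg s) 0 n) :
    ∃ y ∈ cl (pg s) 0 n, x * y = 1 ∧ y * x = 1 := by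
  induction hx using Submonoid.closure_induction_left with
  | one => exact ⟨1, Submonoid.one_mem _, by simp⟩
  | mul_left x hx y hy ih =>
    obtain ⟨i, hai, hin, rfl⟩ := hx
    obtain ⟨z, hz, h3, h4⟩ := ih
    have hg : pg s i * pg s i = 1 := Prod.ext (swg_sq i) (h2 i hin)
    refine ⟨z * pg s i, Submonoid.mul_mem _ hz (Submonoid.subset_closure ⟨i, hai, hin, rfl⟩), ?_, ?_⟩
    · rw [mul_assoc, ← mul_assoc y, h3, one_mul, hg]
    · rw [mul_assoc, ← mul_assoc (pg s i), hg, one_mul, h4]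

theorem conj_lift (h : Braid s n) (h2 : ∀ i < n, s i * s i = 1) (x y : Equiv.Perm ℕ × M)
    (hx : x ∈ cl (pg s) 0 n) (hy : y ∈ cl (pg s) 0 n) (τ : Equiv.Perm ℕ) (hτ : ∀ z > n, τ z = z)
    (hc : τ * x.1 = y.1 * τ) : ∃ t t' : M, t * t' = 1 ∧ t' * t = 1 ∧ x.2 = t' * y.2 * t := by
  obtain ⟨c, hcm, rfl⟩ := exists_lift s n τ hτ
  obtain ⟨c', hcm', e1, e2⟩ := exists_inv h2 c hcm
  obtain ⟨y', hym', e3, e4⟩ := exists_inv h2 y hy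
  refine ⟨c.2, c'.2, congrArg Prod.snd e1, congrArg Prod.snd e2, ?_⟩
  have e5 : (c' * y' * c * x).1 = 1 := by
    have : (c' * y' * (y * c)).1 = 1 := by
      rw [show c' * y' * (y * c) = c' * (y' * y) * c by simp [mul_assoc], e4]; simp [e2]
    rw [← this]
    simp only [Prod.fst_mul, mul_assoc, hc]
  have e6 := word h h2 (c' * y' * c * x) n 0 (by omega) (Submonoid.mul_mem _ (Submonoid.mul_mem _ (Submonoid.mul_mem _ hcm' hym') hcm) hx) e5
  have e7 : c' * y' * c * x = 1 := Prod.ext e5 e6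
  have : x = c' * y * c := by
    calc x = (c' * (y * (c * c') * y') * c) * x := by
            rw [e1, mul_one, e3, mul_one, e2, one_mul]
      _ = c' * y * c * (c' * y' * c * x) := by simp only [mul_assoc]
      _ = _ := by rw [e7, mul_one]
  rw [this]; rfl

theorem cyc_mem {G : Type*} [Monoid G] (g : ℕ → G) (n k : ℕ) (hk : k ≤ n) : cyc g k ∈ cl g 0 n := by
  induction k with
  | zero => exact Submonoid.one_mem _
  | succ k ih => exact Submonoid.mul_mem _ (ih (by omega)) (Submonoid.subset_closure ⟨k, by omega, by omega, rfl⟩)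

theorem cyc_snd (k : ℕ) : (cyc (pg s) k).2 = cyc s k := by
  induction k with
  | zero => rfl
  | succ k ih => rw [cyc_succ, cyc_succ, Prod.snd_mul, ih]; rfl

theorem cyc_fst (k x : ℕ) : (cyc (pg s) k).1 x = if x < k then x + 1 else if x = k then 0 else x := by
  induction k generalizing x with
  | zero => simp
  | succ k ih =>
    rw [cyc_succ, Prod.fst_mul, Equiv.Perm.mul_apply, ih]
    simp only [pg, swg_apply]; split_ifs <;> omega

def blk (r : ℕ) (k : ℕ) : List ℕ := (List.range k).filter (fun i => (i+1) % r ≠ 0)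

theorem blk_succ (r k : ℕ) : blk r (k+1) = if (k+1) % r ≠ 0 then blk r k ++ [k] else blk r k := by
  unfold blk
  rw [List.range_succ, List.filter_append]
  split_ifs with h <;> simp [h]

theorem blk_mem (r k : ℕ) (hk : k ≤ n) : ((blk r k).map (pg s)).prod ∈ cl (pg s) 0 n := by
  apply Submonoid.list_prod_mem
  intro x hx
  obtain ⟨i, hi, rfl⟩ := List.mem_map.1 hx
  simp [blk] at hi
  exact Submonoid.subset_closure ⟨i, by omega, by omega, rfl⟩

theorem blk_snd (l : List ℕ) : ((l.map (pg s)).prod).2 = (l.map s).prod := by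
  induction l with
  | nil => rfl
  | cons i l ih => simp [ih]; rfl

theorem blk_fst (r : ℕ) (hr : 1 ≤ r) (k x : ℕ) : ((blk r k).map (pg s)).prod.1 x =
    if x < k then (if (x+1) % r = 0 then x + 1 - r else x + 1) else if x = k then k - k % r else x := by
  induction k generalizing x with
  | zero => simp [blk]
  | succ k ih =>
    rw [blk_succ]
    have hm : (k+1) % r = 0 → k % r = r - 1 := by
      intro h
      have h3 := Nat.add_mod k 1 r
      rcases Nat.lt_or_ge 1 r with h1 | h1
      · have := Nat.mod_lt k hr
        rw [Nat.mod_eq_of_lt h1] at h3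
        rcases Nat.lt_or_ge (k % r + 1) r with h4 | h4
        · rw [Nat.mod_eq_of_lt h4] at h3; omega
        · omega
      · obtain rfl : r = 1 := by omega
        simp [Nat.mod_one]
    have hm2 : (k+1) % r ≠ 0 → (k+1) % r = k % r + 1 := by
      intro h
      have h3 := Nat.add_mod k 1 r
      rcases Nat.lt_or_ge 1 r with h1 | h1
      · have := Nat.mod_lt k hr
        rw [Nat.mod_eq_of_lt h1] at h3
        rcases Nat.lt_or_ge (k % r + 1) r with h4 | h4
        · rw [Nat.mod_eq_of_lt h4] at h3; omega
        · rw [show k % r + 1 = r by omega, Nat.mod_self] at h3; omega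
      · obtain rfl : r = 1 := by omega
        simp [Nat.mod_one] at h
    by_cases h : (k+1) % r ≠ 0
    · rw [if_pos h, List.map_append, List.prod_append, Prod.fst_mul, Equiv.Perm.mul_apply, ih]
      have := hm2 h
      simp only [List.map_cons, List.map_nil, List.prod_singleton, pg, swg_apply]
      have hk := Nat.mod_le k r
      by_cases h1 : x = k
      · subst h1; simp; intro h'; exact absurd h' h
      · by_cases h2 : x = k + 1
        · subst h2; simp; omega
        · simp only [h1, h2, if_false]
          split_ifs <;> omega
    · rw [if_neg h, ih]
      push Not at h
      have := hm h
      by_cases h1 : x = k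
      · subst h1; simp [h]; omega
      · by_cases h2 : x = k + 1
        · subst h2; simp [h]
        · simp only [h1, h2, if_false]
          split_ifs <;> omega

theorem cyc_pow_fst (N ℓ : ℕ) (hN : 1 ≤ N) (x : ℕ) :
    ((cyc (pg s) (N-1)) ^ ℓ).1 x = if x < N then (x + ℓ) % N else x := by
  induction ℓ with
  | zero =>
    by_cases h : x < N
    · simp [h, Nat.mod_eq_of_lt h]
    · simp [h]
  | succ ℓ ih =>
    rw [pow_succ', Prod.fst_mul, Equiv.Perm.mul_apply, ih, cyc_fst]
    by_cases h : x < N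
    · simp only [h, if_true]
      have h1 := Nat.mod_lt (x+ℓ) hN
      rw [← add_assoc x ℓ 1, Nat.add_mod (x+ℓ) 1 N]
      generalize (x+ℓ) % N = y at *
      rcases Nat.lt_or_ge 1 N with h2 | h2
      · rw [Nat.mod_eq_of_lt h2]
        split_ifs with h3 h4
        · exact (Nat.mod_eq_of_lt (by omega)).symm
        · rw [h4, show N - 1 + 1 = N by omega, Nat.mod_self]
        · omega
      · obtain rfl : N = 1 := by omega
        simp [Nat.mod_one]; omega
    · simp only [h, if_false]; split_ifs <;> omega

def tau (r ℓ : ℕ) (hr : 1 ≤ r) (hl : 1 ≤ ℓ) : Equiv.Perm ℕ where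
  toFun x := if x < r * ℓ then r * (x % ℓ) + x / ℓ else x
  invFun y := if y < r * ℓ then ℓ * (y % r) + y / r else y
  left_inv x := by
    by_cases h : x < r * ℓ
    · have h1 := Nat.mod_lt x hl
      have h2 : x / ℓ < r := Nat.div_lt_of_lt_mul (by rwa [mul_comm])
      have h3 : r * (x % ℓ) + x / ℓ < r * ℓ := by nlinarith
      simp only [h, if_true, h3]
      rw [Nat.mul_add_mod, Nat.mod_eq_of_lt h2, Nat.mul_add_div hr, Nat.div_eq_of_lt h2, add_zero]
      exact Nat.div_add_mod x ℓ
    · simp only [h, if_false]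
  right_inv x := by
    by_cases h : x < r * ℓ
    · have h1 := Nat.mod_lt x hr
      have h2 : x / r < ℓ := Nat.div_lt_of_lt_mul h
      have h3 : ℓ * (x % r) + x / r < r * ℓ := by nlinarith
      simp only [h, if_true, h3]
      rw [Nat.mul_add_mod, Nat.mod_eq_of_lt h2, Nat.mul_add_div hl, Nat.div_eq_of_lt h2, add_zero]
      exact Nat.div_add_mod x r
    · simp only [h, if_false]

theorem tau_conj (r ℓ N : ℕ) (hr : 1 ≤ r) (hl : 1 ≤ ℓ) (hN : N = r * ℓ) :
    tau r ℓ hr hl * ((cyc (pg s) (N-1)) ^ ℓ).1 = ((blk r (N-1)).map (pg s)).prod.1 * tau r ℓ hr hl := by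
  have hN1 : 1 ≤ N := by rw [hN]; exact Nat.mul_pos hr hl
  ext x
  rw [Equiv.Perm.mul_apply, Equiv.Perm.mul_apply, cyc_pow_fst N ℓ hN1, blk_fst r hr]
  simp only [tau, Equiv.coe_fn_mk, ← hN]
  by_cases h : x < N
  · have h1 := Nat.mod_lt x hl
    have h2 : x / ℓ < r := Nat.div_lt_of_lt_mul (by rw [hN, mul_comm] at h; exact h)
    have h3 : r * (x % ℓ) + x / ℓ < N := by rw [hN]; nlinarith
    have h4 := Nat.mod_lt (x+ℓ) hN1
    have hx := Nat.div_add_mod x ℓ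
    simp only [h, if_true, h4]
    obtain ⟨j, hj⟩ : ∃ j, j = x / ℓ := ⟨_, rfl⟩
    obtain ⟨i, hi⟩ : ∃ j, j = x % ℓ := ⟨_, rfl⟩
    rw [← hj] at h2 h3 hx ⊢
    rw [← hi] at h1 h3 hx ⊢
    have hNr : N % r = 0 := by rw [hN, Nat.mul_mod_right]
    have key : (r * i + j + 1) % r = (j+1) % r := by rw [add_assoc, Nat.mul_add_mod]
    rcases Nat.lt_or_ge (j+1) r with h5 | h5
    · have h6 : x + ℓ < N := by rw [hN]; nlinarith
      rw [Nat.mod_eq_of_lt h6, Nat.add_mod_right, Nat.add_div_right _ hl, ← hj, ← hi]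
      have e1 : (j+1) % r = j + 1 := Nat.mod_eq_of_lt h5
      have h7 : r * i + j ≠ N - 1 := by
        intro h8
        have : r * i + j + 1 = N := by omega
        rw [this, hNr] at key; omega
      rw [if_pos (by omega), key, e1, if_neg (by omega)]
      ring
    · have h5' : j + 1 = r := by omega
      have h6 : x + ℓ = N + i := by rw [hN, ← h5', ← hx]; ring
      have hiN : i < N := by omega
      rw [h6, Nat.add_mod_left, Nat.mod_eq_of_lt hiN, Nat.mod_eq_of_lt h1, Nat.div_eq_of_lt h1]
      rw [key, h5', Nat.mod_self, if_pos rfl]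
      have : (N - 1) % r = r - 1 := by
        have e : N - 1 = r * (ℓ - 1) + (r - 1) := by
          obtain ⟨l, rfl⟩ : ∃ l, ℓ = l + 1 := ⟨ℓ-1, by omega⟩
          rw [hN, Nat.mul_add]; simp; omega
        rw [e, Nat.mul_add_mod, Nat.mod_eq_of_lt (by omega)]
      rw [this]
      split_ifs <;> omega
  · simp only [h, if_false]
    split_ifs <;> omega

theorem conj_blk (r ℓ N : ℕ) (hr : 1 ≤ r) (hl : 1 ≤ ℓ) (hN : N = r * ℓ) (h : Braid s (N-1))
    (h2 : ∀ i < N-1, s i * s i = 1) : ∃ t t' : M, t * t' = 1 ∧ t' * t = 1 ∧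
      cyc s (N-1) ^ ℓ = t' * ((blk r (N-1)).map s).prod * t := by
  have := conj_lift h h2 ((cyc (pg s) (N-1)) ^ ℓ) (((blk r (N-1)).map (pg s)).prod)
    (Submonoid.pow_mem _ (cyc_mem _ _ _ le_rfl) _) (blk_mem _ _ le_rfl) (tau r ℓ hr hl) (by
      intro z hz; simp only [tau, Equiv.coe_fn_mk]; rw [if_neg (by omega)]) (tau_conj r ℓ N hr hl hN)
  rwa [Prod.pow_snd, cyc_snd, blk_snd] at this

end
end RP

namespace RP
open Finset

noncomputable def qs (q : ℝ) (m : ℕ) : ℝ := ∑ j ∈ range m, q^(2*j)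

theorem qs_ge (q : ℝ) (m : ℕ) (hm : 1 ≤ m) : 1 ≤ qs q m := by
  obtain ⟨k, rfl⟩ : ∃ k, m = k + 1 := ⟨m-1, by omega⟩
  unfold qs
  rw [Finset.sum_range_succ']
  have : 0 ≤ ∑ j ∈ range k, q^(2*(j+1)) := Finset.sum_nonneg fun j _ => by
    rw [pow_mul]; positivity
  simp; exact this

noncomputable def aq (q : ℝ) (ρ : ℤ) : ℝ := (ρ.sign : ℝ) * (q^(ρ.natAbs - 1) / qs q ρ.natAbs)
noncomputable def fq (q : ℝ) (ρ : ℤ) : ℝ := Real.sqrt (1 - aq q ρ ^ 2)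
noncomputable def Dq (q : ℝ) (ρ : ℤ) : ℝ := q ^ ρ * aq q ρ

theorem aq_neg (q : ℝ) (ρ : ℤ) : aq q (-ρ) = - aq q ρ := by simp [aq]
theorem fq_neg (q : ℝ) (ρ : ℤ) : fq q (-ρ) = fq q ρ := by simp [fq, aq_neg]
theorem aq_one (q : ℝ) : aq q 1 = 1 := by simp [aq, qs]
theorem fq_one (q : ℝ) : fq q 1 = 0 := by simp [fq, aq_one]

theorem aq_cont (ρ : ℤ) : Continuous (fun q => aq q ρ) := by
  by_cases h : ρ = 0
  · subst h; simp [aq]; exact continuous_const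
  · unfold aq
    have hc : Continuous (fun q => qs q ρ.natAbs) := by unfold qs; fun_prop
    refine continuous_const.mul (Continuous.div (by fun_prop) hc ?_)
    intro q
    have := qs_ge q ρ.natAbs (by omega)
    linarith

theorem fq_cont (ρ : ℤ) : Continuous (fun q => fq q ρ) := by
  unfold fq
  have := aq_cont ρ
  fun_prop

theorem aq_sq_le (q : ℝ) (h0 : 0 ≤ q) (h1 : q ≤ 1) (ρ : ℤ) : aq q ρ ^ 2 ≤ 1 := by
  by_cases h : ρ = 0
  · subst h; simp [aq]
  · have h2 := qs_ge q ρ.natAbs (by omega)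
    have h3 : q^(ρ.natAbs - 1) ≤ 1 := pow_le_one₀ h0 h1
    have h4 : 0 ≤ q^(ρ.natAbs - 1) := by positivity
    have h5 : q^(ρ.natAbs - 1) / qs q ρ.natAbs ≤ 1 := by
      rw [div_le_one (by linarith)]; linarith
    have h6 : 0 ≤ q^(ρ.natAbs - 1) / qs q ρ.natAbs := by positivity
    have h7 : ((ρ.sign : ℝ))^2 ≤ 1 := by
      rcases lt_trichotomy ρ 0 with h8 | h8 | h8
      · rw [Int.sign_eq_neg_one_of_neg h8]; norm_num
      · exact absurd h8 h
      · rw [Int.sign_eq_one_of_pos h8]; norm_num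
    unfold aq
    rw [mul_pow]
    nlinarith [sq_nonneg (ρ.sign : ℝ)]

theorem fq_sq (q : ℝ) (h0 : 0 ≤ q) (h1 : q ≤ 1) (ρ : ℤ) : fq q ρ ^ 2 = 1 - aq q ρ ^ 2 :=
  Real.sq_sqrt (by have := aq_sq_le q h0 h1 ρ; linarith)

/-- closed formula -/
theorem aq_pos (q : ℝ) (h0 : 0 < q) (m : ℕ) : aq q (m+1 : ℕ) * (q^((m+1:ℕ):ℤ) - q^(-((m+1:ℕ):ℤ))) = q - q⁻¹ := by
  have hs : ((((m+1:ℕ):ℤ).sign : ℤ) : ℝ) = 1 := by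
    rw [Int.sign_eq_one_of_pos (by positivity)]; simp
  have hq := qs_ge q (m+1) (by omega)
  have hg : qs q (m+1) * (q^2 - 1) = q^(2*(m+1)) - 1 := by
    unfold qs
    simp only [pow_mul]
    exact geom_sum_mul _ _
  unfold aq
  rw [hs, Int.natAbs_natCast, zpow_neg, zpow_natCast]
  simp only [Nat.add_sub_cancel, one_mul]
  have : qs q (m+1) ≠ 0 := by linarith
  field_simp
  have e : (q^(m+1))^2 = q^(2*(m+1)) := by ring
  rw [e, ← hg]; ring

theorem aq_form (q : ℝ) (h0 : 0 < q) (ρ : ℤ) (hρ : ρ ≠ 0) : aq q ρ * (q^ρ - q^(-ρ)) = q - q⁻¹ := by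
  obtain ⟨m, hm | hm⟩ := ρ.eq_nat_or_neg
  · obtain ⟨k, rfl⟩ : ∃ k, m = k + 1 := ⟨m-1, by omega⟩
    rw [hm]; exact aq_pos q h0 k
  · obtain ⟨k, rfl⟩ : ∃ k, m = k + 1 := ⟨m-1, by omega⟩
    rw [hm, aq_neg, neg_neg]; rw [← aq_pos q h0 k]; ring

theorem par_q (q : ℝ) (h0 : 0 < q) (h1 : q < 1) : Par (q - q⁻¹) (Dq q) (fq q) := by
  have hne : q ≠ 0 := h0.ne'
  have hh : q - q⁻¹ ≠ 0 := by
    have : 1 < q⁻¹ := (one_lt_inv₀ h0).2 h1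
    linarith
  have hD : ∀ ρ, ρ ≠ 0 → Dq q ρ * ((q^ρ)^2 - 1) = (q - q⁻¹) * (q^ρ)^2 := by
    intro ρ hρ
    have := aq_form q h0 ρ hρ
    rw [← this, zpow_neg, Dq]
    have : q^ρ ≠ 0 := zpow_ne_zero _ hne
    field_simp
  have hu : ∀ ρ : ℤ, ρ ≠ 0 → (q^ρ)^2 - 1 ≠ 0 := by
    intro ρ hρ h
    have h2 := hD ρ hρ
    rw [h, mul_zero] at h2
    have : (q^ρ) ≠ 0 := zpow_ne_zero _ hne
    exact (mul_ne_zero hh (pow_ne_zero 2 this)) h2.symm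
  refine ⟨fq_neg q, fq_one q, ?_, ?_, ?_⟩
  · intro ρ _
    rw [fq_sq q h0.le h1.le, Dq, Dq, aq_neg, zpow_neg]
    have : q^ρ ≠ 0 := zpow_ne_zero _ hne
    field_simp; ring
  · intro ρ hρ
    rw [← aq_form q h0 ρ hρ, Dq, Dq, aq_neg]; ring
  · intro a b ha hb hab
    have e : ∀ ρ : ℤ, ρ ≠ 0 → Dq q ρ = (q - q⁻¹) * (q^ρ)^2 / ((q^ρ)^2 - 1) := fun ρ hρ => by
      rw [eq_div_iff (hu ρ hρ), hD ρ hρ]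
    have h3 := hu _ ha
    have h4 := hu _ hb
    have h5 := hu _ hab
    rw [e a ha, e b hb, e _ hab]
    rw [zpow_add₀ hne] at h5 ⊢
    generalize q - q⁻¹ = k
    generalize q^a = u at *
    generalize q^b = v at *
    rw [mul_pow] at h5 ⊢
    field_simp
    ring

theorem aq_at_one (ρ : ℤ) : aq 1 ρ = 1 / (ρ : ℝ) := by
  have : (ρ : ℝ) = ρ.sign * ρ.natAbs := by
    rw [Nat.cast_natAbs]
    exact_mod_cast (Int.sign_mul_abs ρ).symm
  by_cases h : ρ = 0
  · subst h; simp [aq]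
  · rw [this]; simp only [aq, qs, one_pow]
    have h7 : ((ρ.sign : ℝ))^2 = 1 := by
      rcases lt_trichotomy ρ 0 with h8 | h8 | h8
      · rw [Int.sign_eq_neg_one_of_neg h8]; norm_num
      · exact absurd h8 h
      · rw [Int.sign_eq_one_of_pos h8]; norm_num
    have h8 : (ρ.sign : ℝ) ≠ 0 := by intro h; rw [h] at h7; norm_num at h7
    have h9 : (ρ.natAbs : ℝ) ≠ 0 := by simpa using h
    simp only [sum_const, card_range, nsmul_eq_mul, mul_one]
    field_simp
    exact h7

theorem par_one : Par 0 (aq 1) (fq 1) := by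
  refine ⟨fq_neg 1, fq_one 1, ?_, ?_, ?_⟩
  · intro ρ _; rw [fq_sq 1 (by norm_num) le_rfl, aq_neg]; ring
  · intro ρ _; rw [aq_neg]; ring
  · intro a b ha hb hab
    simp only [aq_at_one]
    have h1 : (a:ℝ) ≠ 0 := by exact_mod_cast ha
    have h2 : (b:ℝ) ≠ 0 := by exact_mod_cast hb
    have h3 : (a:ℝ) + b ≠ 0 := by exact_mod_cast hab
    push_cast
    field_simp
    ring

theorem aq_zero (ρ : ℤ) (h1 : ρ ≠ 1) (h2 : ρ ≠ -1) : aq 0 ρ = 0 := by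
  by_cases h : ρ = 0
  · subst h; simp [aq]
  · unfold aq; rw [zero_pow (by omega)]; simp

theorem fq_zero (ρ : ℤ) (h1 : ρ ≠ 1) (h2 : ρ ≠ -1) : fq 0 ρ = 1 := by simp [fq, aq_zero ρ h1 h2]

/-- finite-order matrices have finitely many traces -/
theorem trace_fin (X : Type*) [Fintype X] [DecidableEq X] (N : ℕ) (hN : 1 ≤ N) :
    Set.Finite {t : ℝ | ∃ A : Matrix X X ℝ, A ^ N = 1 ∧ A.trace = t} := by
  let F : Set ℂ := Set.range (fun g : Fin (Fintype.card X) → (Polynomial.nthRootsFinset N (1:ℂ)) => ∑ i, (g i : ℂ))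
  have hF : F.Finite := Set.finite_range _
  refine (hF.preimage (f := fun t : ℝ => (t : ℂ)) (Complex.ofReal_injective.injOn)).subset ?_
  rintro t ⟨A, hA, rfl⟩
  let B : Matrix X X ℂ := A.map Complex.ofRealHom
  have hB : B ^ N = 1 := by
    show (Complex.ofRealHom.mapMatrix A) ^ N = 1
    rw [← map_pow, hA, map_one]
  have htr : ((A.trace : ℝ) : ℂ) = B.trace := by simp [Matrix.trace, B]
  have hroots := Matrix.trace_eq_sum_roots_charpoly B
  have hcard : Multiset.card B.charpoly.roots = Fintype.card X := by
    rw [Polynomial.splits_iff_card_roots.1 (IsAlgClosed.splits _), Matrix.charpoly_natDegree_eq_dim]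
  have hmem : ∀ μ ∈ B.charpoly.roots, μ ∈ Polynomial.nthRootsFinset N (1:ℂ) := by
    intro μ hμ
    rw [Polynomial.mem_nthRootsFinset hN]
    have h1 : μ ∈ spectrum ℂ B := Matrix.mem_spectrum_of_isRoot_charpoly (Polynomial.isRoot_of_mem_roots hμ)
    have h2 := spectrum.pow_mem_pow B N h1
    rw [hB] at h2
    by_contra hne
    apply h2
    have : algebraMap ℂ (Matrix X X ℂ) (μ^N) - 1 = algebraMap ℂ (Matrix X X ℂ) (μ^N - 1) := by simp
    show IsUnit (algebraMap ℂ (Matrix X X ℂ) (μ^N) - 1)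
    rw [this]
    exact (IsUnit.mk0 _ (sub_ne_zero.2 hne)).map _
  show ((A.trace : ℝ) : ℂ) ∈ F
  rw [htr, hroots]
  obtain ⟨l, hl⟩ := Quot.exists_rep B.charpoly.roots
  have hl : (l : Multiset ℂ) = B.charpoly.roots := hl
  rw [← hl] at hmem hcard ⊢
  rw [Multiset.coe_card] at hcard
  refine ⟨fun i => ⟨l.get (i.cast hcard.symm), hmem _ (by simp)⟩, ?_⟩
  simp only [Multiset.sum_coe]
  rw [← List.sum_ofFn]
  congr 1
  apply List.ext_get
  · simp [hcard]
  · intro n h1 h2; simp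

theorem const_of_finite (g : ℝ → ℝ) (hg : Continuous g) (F : Set ℝ) (hF : F.Finite)
    (h : ∀ q, 0 < q → q < 1 → g q ∈ F) : g 0 = g 1 := by
  have h1 : ∀ q ∈ Set.Icc (0:ℝ) 1, g q ∈ F := by
    intro q hq
    rw [← closure_Ioo (by norm_num : (0:ℝ) ≠ 1)] at hq
    have := hF.isClosed.closure_subset_iff.2 (Set.image_subset_iff.2 (fun x (hx : x ∈ Set.Ioo (0:ℝ) 1) => h x hx.1 hx.2))
    exact this (image_closure_subset_closure_image hg (Set.mem_image_of_mem g hq))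
  have h2 : IsPreconnected (g '' Set.Icc 0 1) := isPreconnected_Icc.image g hg.continuousOn
  have h3 : (g '' Set.Icc (0:ℝ) 1).Finite := hF.subset (Set.image_subset_iff.2 h1)
  have h4 := h3.countable.isTotallyDisconnected
  exact h4 _ le_rfl h2 (Set.mem_image_of_mem g (by simp)) (Set.mem_image_of_mem g (by simp))
end RP

namespace RP
open Finset
namespace Sys
variable {X L : Type*} {n : ℕ} (S : Sys X L n) [Fintype X]

noncomputable def Rq (q : ℝ) (i : ℕ) : Module.End ℝ (X → ℝ) := S.op (aq q) (fq q) i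
noncomputable def Hq (q : ℝ) (i : ℕ) : Module.End ℝ (X → ℝ) := S.op (Dq q) (fq q) i
noncomputable def Kq (q : ℝ) (i : ℕ) : Module.End ℝ (X → ℝ) := dg (fun x => q ^ (S.ct (S.e x i)))

theorem Rq_sq (q : ℝ) (h0 : 0 ≤ q) (h1 : q ≤ 1) (i : ℕ) (hi : i < n) : S.Rq q i * S.Rq q i = 1 := by
  have := S.op_quad' (h := 0) (D := aq q) (fq_neg q) (fq_one q) (fun ρ _ => by rw [fq_sq q h0 h1, aq_neg]; ring)
    (fun ρ _ => by rw [aq_neg]; ring) hi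
  rw [zero_smul, zero_add] at this
  exact this

theorem ext_dg (g : ℕ → L → ℝ) (i : ℕ) (v : X → ℝ) (z : ℕ → L) :
    S.ext (dg (fun x => g i (S.e x i)) v) z = g i (z i) * S.ext v z := by
  by_cases h : ∃ x, S.e x = z
  · obtain ⟨x, rfl⟩ := h; simp [ext_e, dg_apply]
  · push Not at h; simp [ext_of_not _ _ _ h]

theorem KH (q : ℝ) (h0 : 0 < q) (i : ℕ) : S.Kq q i * S.Hq q i = S.Rq q i * S.Kq q (i+1) := by
  apply LinearMap.ext; intro v; funext x
  simp only [Module.End.mul_apply, Kq, Hq, Rq, op_apply, dg_apply]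
  rw [S.ext_dg (fun _ l => q ^ S.ct l) (i+1)]
  simp only [sg_apply, Dq, rho]
  rw [if_neg (by omega), if_pos trivial, zpow_sub₀ h0.ne']
  have : q ^ (S.ct (S.e x i)) ≠ 0 := zpow_ne_zero _ h0.ne'
  field_simp

theorem HK (q : ℝ) (h0 : 0 < q) (i : ℕ) : S.Hq q i * S.Kq q i = S.Kq q (i+1) * S.Rq q i := by
  apply LinearMap.ext; intro v; funext x
  simp only [Module.End.mul_apply, Kq, Hq, Rq, op_apply, dg_apply]
  rw [S.ext_dg (fun _ l => q ^ S.ct l) i]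
  simp only [sg_apply, Dq, rho]
  rw [if_pos trivial, zpow_sub₀ h0.ne']
  have : q ^ (S.ct (S.e x i)) ≠ 0 := zpow_ne_zero _ h0.ne'
  field_simp

theorem cycR (q : ℝ) (h0 : 0 < q) (k : ℕ) :
    cyc (S.Rq q) k * S.Kq q k = S.Kq q 0 * cyc (S.Hq q) k := by
  induction k with
  | zero => simp
  | succ k ih => rw [cyc_succ, mul_assoc, ← S.KH q h0, ← mul_assoc, ih, mul_assoc, cyc_succ]

theorem dg_list (g : ℕ → X → ℝ) (l : List ℕ) : (l.map (fun k => dg (g k) )).prod = dg (fun x => (l.map (fun k => g k x)).prod) := by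
  induction l with
  | nil => apply LinearMap.ext; intro v; funext x; simp [dg_apply]
  | cons a l ih => rw [List.map_cons, List.prod_cons, ih]
                   apply LinearMap.ext; intro v; funext x; simp [dg_apply]; ring

theorem Rpow (q : ℝ) (h0 : 0 < q) (h1 : q < 1) (cN : ℤ) (hc0 : ∀ x, S.ct (S.e x 0) = 0)
    (hcn : ∀ x, S.ct (S.e x n) = cN) 
    (hsum : ∀ x, 2 * ∑ k ∈ range (n+1), S.ct (S.e x k) = (n+1) * cN) :
    cyc (S.Rq q) n ^ (n+1) = 1 := by
  have K0 : S.Kq q 0 = 1 := by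
    apply LinearMap.ext; intro v; funext x; simp [Kq, dg_apply, hc0]
  have Kn : S.Kq q n = (q ^ cN) • 1 := by
    apply LinearMap.ext; intro v; funext x; simp [Kq, dg_apply, hcn]
  have e1 := S.cycR q h0 n
  rw [K0, Kn, one_mul, mul_smul_comm, mul_one] at e1
  have e2 := full_twist (s := S.Hq q) (Q := fun k => S.Kq q k * S.Kq q k) (n := n) (S.op_Braid (par_q q h0 h1))
    (by simp [K0]) (fun k hk => by
      calc S.Kq q (k+1) * S.Kq q (k+1) = S.Kq q (k+1) * (S.Rq q k * S.Rq q k) * S.Kq q (k+1) := by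
            rw [S.Rq_sq q h0.le h1.le k hk, mul_one]
        _ = (S.Kq q (k+1) * S.Rq q k) * (S.Rq q k * S.Kq q (k+1)) := by simp only [mul_assoc]
        _ = S.Hq q k * (S.Kq q k * S.Kq q k) * S.Hq q k := by
            rw [← S.HK q h0, ← S.KH q h0]; simp only [mul_assoc]) n le_rfl
  have e3 : ((List.range (n+1)).map (fun k => S.Kq q k * S.Kq q k)).prod = (q^cN)^(n+1) • (1 : Module.End ℝ (X → ℝ)) := by
    have : (fun k => S.Kq q k * S.Kq q k) = (fun k => dg (fun x => q ^ (2 * (S.ct (S.e x k))))) := by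
      funext k
      apply LinearMap.ext; intro v; funext x
      simp only [Kq, Module.End.mul_apply, dg_apply]
      rw [two_mul, zpow_add₀ h0.ne']; ring
    rw [this, dg_list]
    apply LinearMap.ext; intro v; funext x
    rw [dg_apply]
    have h2 : ((List.range (n+1)).map (fun k => q ^ (2 * (S.ct (S.e x k))))).prod = q ^ (2 * ∑ k ∈ range (n+1), S.ct (S.e x k)) := by
      generalize n+1 = m
      induction m with
      | zero => simp
      | succ m ih => rw [List.range_succ, List.map_append, List.prod_append, ih, Finset.sum_range_succ, mul_add, zpow_add₀ h0.ne']; simp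
    rw [h2, hsum, ← zpow_natCast, ← zpow_mul]
    simp [mul_comm]
  rw [e3, ← e1, _root_.smul_pow] at e2
  have hne : (q^cN)^(n+1) ≠ 0 := pow_ne_zero _ (zpow_ne_zero _ h0.ne')
  exact smul_right_injective _ hne e2

theorem trace_const (cN : ℤ) (hc0 : ∀ x, S.ct (S.e x 0) = 0)
    (hcn : ∀ x, S.ct (S.e x n) = cN) 
    (hsum : ∀ x, 2 * ∑ k ∈ range (n+1), S.ct (S.e x k) = (n+1) * cN) (ℓ : ℕ) :
    LinearMap.trace ℝ (X → ℝ) (cyc (S.Rq 0) n ^ ℓ) = LinearMap.trace ℝ (X → ℝ) (cyc (S.Rq 1) n ^ ℓ) := by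
  classical
  let Φ := LinearMap.toMatrixAlgEquiv' (R := ℝ) (n := X)
  have htr : ∀ F : Module.End ℝ (X → ℝ), LinearMap.trace ℝ (X → ℝ) F = (Φ F).trace := by
    intro F
    rw [LinearMap.trace_eq_matrix_trace ℝ (Pi.basisFun ℝ X)]
    rfl
  have hcyc : ∀ q k, Φ (cyc (S.Rq q) k) = cyc (fun i => Φ (S.Rq q i)) k := by
    intro q k
    induction k with
    | zero => simp
    | succ k ih => rw [cyc_succ, cyc_succ, map_mul, ih]
  have hRc : ∀ i, Continuous (fun q => Φ (S.Rq q i)) := by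
    intro i
    refine continuous_matrix fun x y => ?_
    have : (fun q => Φ (S.Rq q i) x y) = fun q => S.Rq q i (Pi.single y 1) x := by
      funext q
      simp only [Φ, LinearMap.toMatrixAlgEquiv'_apply]
    rw [this]
    simp only [Rq, op_apply]
    have := aq_cont (S.rho i (S.e x))
    have := fq_cont (S.rho i (S.e x))
    fun_prop
  have hCc : ∀ k, Continuous (fun q => cyc (fun i => Φ (S.Rq q i)) k) := by
    intro k
    induction k with
    | zero => exact continuous_const
    | succ k ih => simp only [cyc_succ]; exact ih.mul (hRc k)
  have := const_of_finite (fun q => LinearMap.trace ℝ (X → ℝ) (cyc (S.Rq q) n ^ ℓ)) (by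
      simp only [htr, map_pow, hcyc]
      exact ((hCc n).pow ℓ).matrix_trace) _ (trace_fin X (n+1) (by omega)) (by
      intro q h0 h1
      refine ⟨Φ (cyc (S.Rq q) n ^ ℓ), ?_, (htr _).symm⟩
      rw [← map_pow, ← pow_mul, mul_comm, pow_mul, S.Rpow q h0 h1 cN hc0 hcn hsum, one_pow, map_one])
  exact this

theorem trace_blk (r ℓ : ℕ) (hr : 1 ≤ r) (hl : 1 ≤ ℓ) (hN : n + 1 = r * ℓ) :
    LinearMap.trace ℝ (X → ℝ) (cyc (S.Rq 1) n ^ ℓ) = ∑ x, ((blk r n).map (fun i => 1 / ((S.rho i (S.e x) : ℤ) : ℝ))).prod := by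
  obtain ⟨t, t', h1, h2, h3⟩ := conj_blk (s := S.Rq 1) r ℓ (n+1) hr hl hN (S.op_Braid par_one)
    (fun i hi => S.Rq_sq 1 (by norm_num) le_rfl i hi)
  simp only [Nat.add_sub_cancel] at h3
  rw [h3, LinearMap.trace_mul_comm, ← mul_assoc, h1, one_mul]
  have := S.trace_lp (D := aq 1) (fq_neg 1) (fq_one 1) (blk r n) (List.Pairwise.filter _ List.pairwise_lt_range)
    (fun i hi => by simp [blk] at hi; exact hi.1) (fun _ => 1) (fun _ => 1)
  have e : dg (fun _ : X => (1:ℝ)) = 1 := by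
    apply LinearMap.ext; intro v; funext x; simp [dg_apply]
  rw [e, one_mul, mul_one] at this
  simp only [one_mul, mul_one, aq_at_one] at this
  exact this
end Sys
end RP

namespace RP
open Finset

section
variable {d m : ℕ}

def st (lam : Fin d → ℤ) (w : Fin m → Fin d) (k : ℕ) (i : Fin d) : ℤ :=
  lam i - ∑ j : Fin m, if k ≤ (j:ℕ) ∧ w j = i then 1 else 0

theorem st_ge (lam : Fin d → ℤ) (w : Fin m → Fin d) (k : ℕ) (hk : m ≤ k) : st lam w k = lam := by
  funext i
  unfold st
  rw [Finset.sum_eq_zero, sub_zero]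
  intro j _
  rw [if_neg]; have := j.2; omega

theorem st_succ (lam : Fin d → ℤ) (w : Fin m → Fin d) (k : ℕ) (hk : k < m) (i : Fin d) :
    st lam w (k+1) i = st lam w k i + if w ⟨k, hk⟩ = i then 1 else 0 := by
  unfold st
  have : (∑ j : Fin m, if k ≤ (j:ℕ) ∧ w j = i then (1:ℤ) else 0) =
      (∑ j : Fin m, if k+1 ≤ (j:ℕ) ∧ w j = i then (1:ℤ) else 0) + ∑ j : Fin m, if j = ⟨k,hk⟩ then (if w ⟨k,hk⟩ = i then (1:ℤ) else 0) else 0 := by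
    rw [← Finset.sum_add_distrib]
    refine Finset.sum_congr rfl fun j _ => ?_
    by_cases h : j = ⟨k, hk⟩
    · subst h; simp
    · have h' : (j:ℕ) ≠ k := fun h' => h (Fin.ext h')
      rw [if_neg h, add_zero]
      congr 1
      apply propext
      constructor <;> rintro ⟨h1, h2⟩ <;> exact ⟨by omega, h2⟩
  rw [this]
  simp
  ring

def Std (lam : Fin d → ℤ) (w : Fin m → Fin d) : Prop := ∀ k ≤ m, StrictAnti (st lam w k)

theorem Std.all {lam : Fin d → ℤ} {w : Fin m → Fin d} (h : Std lam w) (k : ℕ) : StrictAnti (st lam w k) := by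
  rcases Nat.lt_or_ge m k with h1 | h1
  · rw [st_ge lam w k h1.le, ← st_ge lam w m le_rfl]; exact h m le_rfl
  · exact h k h1

def rw' (w : Fin m → Fin d) (k : ℕ) : ℕ := if h : k < m then w ⟨k, h⟩ else 0
def cont (lam : Fin d → ℤ) (w : Fin m → Fin d) (k : ℕ) : ℤ := if h : k < m then st lam w k (w ⟨k, h⟩) else 0

def let' (lam : Fin d → ℤ) (w : Fin m → Fin d) (k : ℕ) : ℕ × ℤ := (rw' w k, cont lam w k)

theorem let_inj (lam : Fin d → ℤ) (w w' : Fin m → Fin d) (h : let' lam w = let' lam w') : w = w' := by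
  funext ⟨k, hk⟩
  have := congrArg Prod.fst (congrFun h k)
  simp only [let', rw', hk, dif_pos] at this
  exact Fin.ext this

/-- swapping two consecutive steps -/
def wsw (i : ℕ) (hi : i + 1 < m) (w : Fin m → Fin d) : Fin m → Fin d :=
  fun j => w (Equiv.swap ⟨i, by omega⟩ ⟨i+1, hi⟩ j)

theorem wsw_i (i : ℕ) (hi : i + 1 < m) (w : Fin m → Fin d) : wsw i hi w ⟨i, by omega⟩ = w ⟨i+1, hi⟩ := by
  simp [wsw]
theorem wsw_i1 (i : ℕ) (hi : i + 1 < m) (w : Fin m → Fin d) : wsw i hi w ⟨i+1, hi⟩ = w ⟨i, by omega⟩ := by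
  simp [wsw]
theorem wsw_ne (i : ℕ) (hi : i + 1 < m) (w : Fin m → Fin d) (j : ℕ) (hj : j < m) (h1 : j ≠ i) (h2 : j ≠ i + 1) :
    wsw i hi w ⟨j, hj⟩ = w ⟨j, hj⟩ := by
  unfold wsw
  rw [Equiv.swap_apply_of_ne_of_ne] <;> simp [h1, h2]

theorem st_wsw_gt (lam : Fin d → ℤ) (i : ℕ) (hi : i + 1 < m) (w : Fin m → Fin d) (k : ℕ) (hk : i + 2 ≤ k) :
    st lam (wsw i hi w) k = st lam w k := by
  rcases Nat.lt_or_ge k m with h | h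
  · obtain ⟨t, ht⟩ : ∃ t, k + t = m := ⟨m - k, by omega⟩
    clear h
    induction t generalizing k with
    | zero => rw [st_ge _ _ k (by omega), st_ge _ _ k (by omega)]
    | succ t ih =>
      have h1 := ih (k+1) (by omega) (by omega)
      funext r
      have e1 := st_succ lam (wsw i hi w) k (by omega) r
      have e2 := st_succ lam w k (by omega) r
      rw [h1, e2, wsw_ne i hi w k (by omega) (by omega) (by omega)] at e1
      linarith
  · rw [st_ge _ _ k h, st_ge _ _ k h]

theorem st_wsw_le (lam : Fin d → ℤ) (i : ℕ) (hi : i + 1 < m) (w : Fin m → Fin d) (k : ℕ) (hk : k ≤ i) :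
    st lam (wsw i hi w) k = st lam w k := by
  obtain ⟨t, ht⟩ : ∃ t, k + t = i := ⟨i - k, by omega⟩
  induction t generalizing k with
  | zero =>
    obtain rfl : k = i := by omega
    have h1 := st_wsw_gt lam k hi w (k+2) le_rfl
    funext r
    have e1 := st_succ lam (wsw k hi w) k (by omega) r
    have e2 := st_succ lam w k (by omega) r
    have e3 := st_succ lam (wsw k hi w) (k+1) (by omega) r
    have e4 := st_succ lam w (k+1) (by omega) r
    rw [wsw_i] at e1
    rw [wsw_i1] at e3
    have := congrFun h1 r
    simp only [add_assoc, one_add_one_eq_two] at *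
    linarith
  | succ t ih =>
    have h1 := ih (k+1) (by omega) (by omega)
    funext r
    have e1 := st_succ lam (wsw i hi w) k (by omega) r
    have e2 := st_succ lam w k (by omega) r
    rw [h1, e2, wsw_ne i hi w k (by omega) (by omega) (by omega)] at e1
    linarith

theorem st_wsw_mid (lam : Fin d → ℤ) (i : ℕ) (hi : i + 1 < m) (w : Fin m → Fin d) (r : Fin d) :
    st lam (wsw i hi w) (i+1) r = st lam w i r + if w ⟨i+1, hi⟩ = r then 1 else 0 := by
  rw [st_succ lam (wsw i hi w) i (by omega) r, st_wsw_le lam i hi w i le_rfl, wsw_i]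

/-- local analysis at a swap -/
theorem loc_eq (lam : Fin d → ℤ) (w : Fin m → Fin d) (i : ℕ) (hi : i + 1 < m)
    (h : w ⟨i, by omega⟩ = w ⟨i+1, hi⟩) : cont lam w (i+1) = cont lam w i + 1 := by
  simp only [cont, hi, show i < m by omega, dif_pos]
  rw [st_succ lam w i (by omega), if_pos h, h]

theorem loc_ne (lam : Fin d → ℤ) (w : Fin m → Fin d) (i : ℕ) (hi : i + 1 < m)
    (h : w ⟨i, by omega⟩ ≠ w ⟨i+1, hi⟩) : cont lam w (i+1) = st lam w i (w ⟨i+1, hi⟩) := by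
  simp only [cont, hi, dif_pos]
  rw [st_succ lam w i (by omega), if_neg h, add_zero]

theorem loc_one {lam : Fin d → ℤ} {w : Fin m → Fin d} (hw : Std lam w) (i : ℕ) (hi : i + 1 < m) :
    cont lam w (i+1) = cont lam w i + 1 ↔ w ⟨i, by omega⟩ = w ⟨i+1, hi⟩ := by
  refine ⟨fun h => ?_, loc_eq lam w i hi⟩
  by_contra hne
  rw [loc_ne lam w i hi hne] at h
  have h0 : cont lam w i = st lam w i (w ⟨i, by omega⟩) := by simp [cont, show i < m by omega]
  have e1 := st_succ lam w i (by omega) (w ⟨i, by omega⟩)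
  have e2 := st_succ lam w i (by omega) (w ⟨i+1, by omega⟩)
  rw [if_pos rfl] at e1
  rw [if_neg hne] at e2
  exact hne ((hw.all (i+1)).injective (by linarith))

theorem loc_ne1 {lam : Fin d → ℤ} {w : Fin m → Fin d} (hw : Std lam w) (i : ℕ) (hi : i + 1 < m) :
    cont lam w i ≠ cont lam w (i+1) := by
  by_cases h : w ⟨i, by omega⟩ = w ⟨i+1, hi⟩
  · rw [loc_eq lam w i hi h]; omega
  · rw [loc_ne lam w i hi h]
    simp only [cont, show i < m by omega, dif_pos]
    intro h'; exact h ((hw.all i).injective h')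

theorem loc_ne2 {lam : Fin d → ℤ} {w : Fin m → Fin d} (hw : Std lam w) (i : ℕ) (hi : i + 2 < m) :
    cont lam w i ≠ cont lam w (i+2) := by
  simp only [cont, hi, show i < m by omega, dif_pos]
  intro h
  have E1 := st_succ lam w i (by omega)
  have E2 := st_succ lam w (i+1) (by omega)
  have E3 := st_succ lam w (i+2) (by omega)
  simp only [add_assoc, one_add_one_eq_two, Nat.reduceAdd] at E2 E3
  generalize w ⟨i, by omega⟩ = a at *
  generalize w ⟨i+1, by omega⟩ = b at *
  generalize w ⟨i+2, by omega⟩ = c at *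
  by_cases hca : c = a
  · subst hca
    have e1 := E1 c
    have e2 := E2 c
    rw [if_pos rfl] at e1
    split_ifs at e2 <;> omega
  · by_cases hbc : b = c
    · subst hbc
      have e1 := E1 b
      have e2 := E2 b
      have e3 := E3 b
      have e1' := E1 a
      have e2' := E2 a
      have e3' := E3 a
      simp only [if_true, hca, Ne.symm hca, if_false] at e1 e2 e3 e1' e2' e3'
      exact hca ((hw.all (i+3)).injective (by omega))
    · have e1 := E1 c
      have e2 := E2 c
      rw [if_neg (fun h => hca h.symm)] at e1
      rw [if_neg hbc] at e2
      exact hca ((hw.all i).injective (by omega))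

theorem std_wsw {lam : Fin d → ℤ} {w : Fin m → Fin d} (hw : Std lam w) (i : ℕ) (hi : i + 1 < m)
    (h1 : cont lam w (i+1) ≠ cont lam w i + 1) (h2 : cont lam w (i+1) ≠ cont lam w i - 1) :
    Std lam (wsw i hi w) ∧ let' lam (wsw i hi w) = sg i (let' lam w) := by
  have hab : w ⟨i, by omega⟩ ≠ w ⟨i+1, hi⟩ := fun h => h1 ((loc_one hw i hi).2 h)
  constructor
  · intro k hk
    rcases lt_trichotomy k (i+1) with h | h | h
    · rw [st_wsw_le _ _ _ _ _ (by omega)]; exact hw.all k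
    · subst h
      intro p q hpq
      have s0 := hw.all i hpq
      have s2 := hw.all (i+1+1) hpq
      rw [st_wsw_mid, st_wsw_mid]
      have E1p := st_succ lam w i (by omega) p
      have E1q := st_succ lam w i (by omega) q
      have E2p := st_succ lam w (i+1) (by omega) p
      have E2q := st_succ lam w (i+1) (by omega) q
      rw [loc_ne lam w i hi hab] at h2
      simp only [cont, show i < m by omega, dif_pos] at h2
      generalize w ⟨i, by omega⟩ = a at *
      generalize w ⟨i+1, by omega⟩ = b at *
      by_cases hq : b = q
      · subst hq
        rw [if_neg hab] at E1q
        rw [if_pos rfl] at E2q ⊢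
        rw [if_neg (fun h => by subst h; exact lt_irrefl _ hpq)] at E2p ⊢
        by_cases hp : a = p
        · subst hp; omega
        · rw [if_neg hp] at E1p; omega
      · rw [if_neg hq]; split_ifs <;> omega
    · rw [st_wsw_gt _ _ _ _ _ (by omega)]; exact hw.all k
  · funext k
    rw [sg_apply]
    by_cases hk : k < m
    · by_cases hki : k = i
      · subst hki
        rw [if_pos rfl]
        have := loc_ne lam w k hi hab
        simp only [let']
        rw [this]
        simp only [rw', cont, hk, hi, dif_pos, wsw_i]
        rw [st_wsw_le _ _ _ _ _ le_rfl]
      · rw [if_neg hki]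
        by_cases hki : k = i+1
        · subst hki
          rw [if_pos rfl]
          simp only [let', rw', cont, hk, show i < m by omega, dif_pos, wsw_i1]
          rw [st_wsw_mid, if_neg (Ne.symm hab), add_zero]
        · rw [if_neg hki]
          simp only [let', rw', cont, hk, dif_pos]
          rw [wsw_ne i hi w k hk (by omega) (by omega)]
          rcases Nat.lt_or_ge k i with h | h
          · rw [st_wsw_le _ _ _ _ _ h.le]
          · rw [st_wsw_gt _ _ _ _ _ (by omega)]
    · rw [if_neg (by omega), if_neg (by omega)]
      simp only [let', rw', cont, hk, dif_neg, not_false_eq_true]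

def PX (m : ℕ) (lam : Fin d → ℤ) (P : (Fin d → ℤ) → Prop) : Type := {w : Fin m → Fin d // Std lam w ∧ P (st lam w 0)}

noncomputable instance (lam : Fin d → ℤ) (P : (Fin d → ℤ) → Prop) : Fintype (PX m lam P) := by
  classical
  unfold PX; infer_instance

def psys (n : ℕ) (lam : Fin d → ℤ) (P : (Fin d → ℤ) → Prop) (off : ℤ) : Sys (PX (n+1) lam P) (ℕ × ℤ) n where
  e x := let' lam x.1
  ct l := l.2 - off
  inj x y h := Subtype.ext (let_inj lam _ _ h)
  ne1 x i hi := by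
    have := loc_ne1 x.2.1 i (by omega)
    simp only [let']; omega
  ne2 x i hi := by
    have := loc_ne2 x.2.1 i (by omega)
    simp only [let']; omega
  cl x i hi h1 h2 := by
    simp only [let'] at h1 h2
    have := std_wsw x.2.1 i (by omega) (by omega) (by omega)
    exact ⟨⟨wsw i (by omega) x.1, this.1, by rw [st_wsw_le _ _ _ _ _ (by omega)]; exact x.2.2⟩, this.2⟩

end
end RP

namespace RP
open Finset

section
variable {d m : ℕ}

open Classical in
noncomputable def PS (m : ℕ) (lam : Fin d → ℤ) (F : (ℕ → ℤ) → (Fin d → ℤ) → ℝ) : ℝ :=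
  ∑ w : Fin m → Fin d, if Std lam w then F (cont lam w) (st lam w 0) else 0

theorem PS_congr (lam : Fin d → ℤ) (F F' : (ℕ → ℤ) → (Fin d → ℤ) → ℝ)
    (h : ∀ c ν, StrictAnti ν → F c ν = F' c ν) : PS m lam F = PS m lam F' := by
  classical
  unfold PS
  refine Finset.sum_congr rfl fun w _ => ?_
  by_cases hw : Std lam w
  · rw [if_pos hw, if_pos hw, h _ _ (hw.all 0)]
  · rw [if_neg hw, if_neg hw]

def glue (a : ℕ) (c1 c2 : ℕ → ℤ) (k : ℕ) : ℤ := if k < a then c1 k else c2 (k - a)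

theorem st_append_ge {a b : ℕ} (lam : Fin d → ℤ) (u : Fin a → Fin d) (v : Fin b → Fin d) (k : ℕ) (hk : a ≤ k) :
    st lam (Fin.append u v) k = st lam v (k - a) := by
  funext i
  unfold st
  rw [Fin.sum_univ_add]
  simp only [Fin.append_left, Fin.append_right, Fin.val_castAdd, Fin.val_natAdd]
  rw [Finset.sum_eq_zero, zero_add]
  · congr 1
    refine Finset.sum_congr rfl fun j _ => ?_
    congr 1
    apply propext
    constructor <;> rintro ⟨h1, h2⟩ <;> exact ⟨by omega, h2⟩
  · intro j _
    rw [if_neg]; have := j.2; omega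

theorem st_append_le {a b : ℕ} (lam : Fin d → ℤ) (u : Fin a → Fin d) (v : Fin b → Fin d) (k : ℕ) (hk : k ≤ a) :
    st lam (Fin.append u v) k = st (st lam v 0) u k := by
  funext i
  unfold st
  rw [Fin.sum_univ_add]
  simp only [Fin.append_left, Fin.append_right, Fin.val_castAdd, Fin.val_natAdd]
  have : ∀ j : Fin b, (k ≤ a + (j:ℕ) ∧ v j = i) = (0 ≤ (j:ℕ) ∧ v j = i) := by
    intro j
    apply propext
    constructor <;> rintro ⟨h1, h2⟩ <;> exact ⟨by omega, h2⟩
  simp only [this]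
  ring

theorem std_append {a b : ℕ} (lam : Fin d → ℤ) (u : Fin a → Fin d) (v : Fin b → Fin d) :
    Std lam (Fin.append u v) ↔ Std lam v ∧ Std (st lam v 0) u := by
  constructor
  · intro h
    constructor
    · intro k hk
      have := h.all (k + a)
      rwa [st_append_ge _ _ _ _ (by omega), Nat.add_sub_cancel] at this
    · intro k hk
      have := h.all k
      rwa [st_append_le _ _ _ _ hk] at this
  · rintro ⟨h1, h2⟩ k hk
    rcases Nat.le_total a k with h | h
    · rw [st_append_ge _ _ _ _ h]; exact h1.all _
    · rw [st_append_le _ _ _ _ h]; exact h2.all _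

theorem cont_append {a b : ℕ} (lam : Fin d → ℤ) (u : Fin a → Fin d) (v : Fin b → Fin d) :
    cont lam (Fin.append u v) = glue a (cont (st lam v 0) u) (cont lam v) := by
  funext k
  unfold glue
  by_cases hk : k < a
  · rw [if_pos hk]
    simp only [cont, hk, show k < a + b by omega, dif_pos]
    rw [st_append_le _ _ _ _ hk.le]
    congr 1
    exact Fin.append_left u v ⟨k, hk⟩
  · rw [if_neg hk]
    by_cases hk2 : k < a + b
    · simp only [cont, hk2, show k - a < b by omega, dif_pos]
      rw [st_append_ge _ _ _ _ (by omega)]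
      congr 1
      have := Fin.append_right u v ⟨k - a, by omega⟩
      rw [← this]
      congr 1
      apply Fin.ext; simp; omega
    · simp only [cont, hk2, show ¬ (k - a < b) by omega, dif_neg, not_false_eq_true]

theorem PS_split (a b : ℕ) (lam : Fin d → ℤ) (F : (ℕ → ℤ) → (Fin d → ℤ) → ℝ) :
    PS (a + b) lam F = PS b lam (fun c2 μ => PS a μ (fun c1 ν => F (glue a c1 c2) ν)) := by
  classical
  unfold PS
  rw [← (Fin.appendEquiv a b).sum_comp, Fintype.sum_prod_type_right]
  refine Finset.sum_congr rfl fun v _ => ?_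
  by_cases hv : Std lam v
  · rw [if_pos hv]
    refine Finset.sum_congr rfl fun u _ => ?_
    simp only [Fin.appendEquiv, Equiv.coe_fn_mk, std_append, hv, true_and, cont_append]
    rw [st_append_le _ _ _ _ (Nat.zero_le _)]
  · rw [if_neg hv]
    refine Finset.sum_eq_zero fun u _ => ?_
    simp only [Fin.appendEquiv, Equiv.coe_fn_mk, std_append, hv, false_and, if_false]

open Classical in
theorem PX_sum (lam : Fin d → ℤ) (P : (Fin d → ℤ) → Prop) (h : (Fin m → Fin d) → ℝ) :
    ∑ x : PX m lam P, h x.1 = ∑ w : Fin m → Fin d, if Std lam w ∧ P (st lam w 0) then h w else 0 := by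
  rw [← Finset.sum_filter, Finset.sum_subtype (p := fun w => Std lam w ∧ P (st lam w 0)) _ (by simp)]
  rfl

/-- antisymmetric functions -/
def Anti (Ψ : (Fin d → ℤ) → ℝ) : Prop := ∀ (γ : Fin d → ℤ) (i j : Fin d), i ≠ j → Ψ (γ ∘ Equiv.swap i j) = - Ψ γ

theorem Anti.zero {Ψ : (Fin d → ℤ) → ℝ} (h : Anti Ψ) (γ : Fin d → ℤ) (i j : Fin d) (hij : i ≠ j) (e : γ i = γ j) :
    Ψ γ = 0 := by
  have h1 := h γ i j hij
  have : γ ∘ Equiv.swap i j = γ := by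
    funext k
    simp only [Function.comp, Equiv.swap_apply_def]
    split_ifs with h1 h2
    · rw [h1, e]
    · rw [h2, e]
    · rfl
  rw [this] at h1; linarith

def sub1 (γ : Fin d → ℤ) (r : ℤ) (i : Fin d) : Fin d → ℤ := fun k => γ k - if i = k then r else 0

theorem st_one (lam : Fin d → ℤ) (w : Fin 1 → Fin d) : st lam w 0 = sub1 lam 1 (w 0) := by
  funext k
  simp only [st, sub1, Fin.sum_univ_one, Nat.zero_le, true_and]

theorem PS_one (lam : Fin d → ℤ) (hl : StrictAnti lam) (g : ℤ → ℝ) (Φ : (Fin d → ℤ) → ℝ) (hΦ : Anti Φ) :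
    PS 1 lam (fun c μ => g (c 0) * Φ μ) = ∑ i, g (lam i - 1) * Φ (sub1 lam 1 i) := by
  classical
  unfold PS
  rw [← (Equiv.funUnique (Fin 1) (Fin d)).symm.sum_comp]
  refine Finset.sum_congr rfl fun i _ => ?_
  have hw : ((Equiv.funUnique (Fin 1) (Fin d)).symm i) 0 = i := rfl
  generalize (Equiv.funUnique (Fin 1) (Fin d)).symm i = w at *
  have hc : cont lam w 0 = lam i - 1 := by
    simp only [cont, zero_lt_one, dif_pos, st_one, Fin.mk_zero, Fin.zero_eta, hw]
    simp [sub1]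
  simp only [hc, st_one, hw]
  split_ifs with h
  · rfl
  · have h2 : ∃ p q, p < q ∧ sub1 lam 1 i p = sub1 lam 1 i q := by
      by_contra hcon
      push Not at hcon
      apply h
      intro k hk
      rcases Nat.lt_or_ge k 1 with h1 | h1
      · obtain rfl : k = 0 := by omega
        rw [st_one, hw]
        intro p q hpq
        have := hcon p q hpq
        have := hl hpq
        simp only [sub1] at *
        split_ifs at * <;> omega
      · rw [st_ge _ _ _ h1]; exact hl
    obtain ⟨p, q, h3, h4⟩ := h2
    rw [hΦ.zero _ p q h3.ne h4, mul_zero]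

theorem sub1_swap (γ : Fin d → ℤ) (r : ℤ) (i j k : Fin d) :
    sub1 (γ ∘ Equiv.swap i j) r k = sub1 γ r (Equiv.swap i j k) ∘ Equiv.swap i j := by
  funext l
  simp [sub1]

theorem Anti.wsum {Ψ : (Fin d → ℤ) → ℝ} (h : Anti Ψ) (g : ℤ → ℝ) (r : ℤ) :
    Anti (fun γ => ∑ i, g (γ i) * Ψ (sub1 γ r i)) := by
  intro γ i j hij
  simp only [sub1_swap]
  rw [← Finset.sum_neg_distrib, ← Equiv.sum_comp (Equiv.swap i j)]
  refine Finset.sum_congr rfl fun k _ => ?_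
  simp only [Function.comp, Equiv.swap_apply_self]
  rw [h _ i j hij]; ring

end
end RP

namespace RP
open Finset

theorem ring_lemma {A : Type*} [Ring A] (s x : ℕ → A) (r : ℕ) (hB : Braid s r)
    (h2 : ∀ k < r, s k * s k = 1) (hx : ∀ k < r, s k * x (k+1) = x k * s k + 1)
    (τ : A →+ ℝ) (ht : ∀ k < r, ∀ a, τ (a * s k) = τ (s k * a)) (hr : 1 ≤ r) :
    τ (cyc s (r-1) * x r) = τ (s 0 * cyc s r * x 0) + r * τ (cyc s r) := by
  have main : ∀ i < r, τ (cyc s r * s i * x (i+1)) = τ (s 0 * cyc s r * x 0) + (i+1) * τ (cyc s r) := by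
    intro i
    induction i with
    | zero =>
      intro hi
      rw [mul_assoc, hx 0 hi, mul_add, map_add, mul_one, ← mul_assoc, ht 0 hi, ← mul_assoc]
      simp
    | succ i ih =>
      intro hi
      rw [mul_assoc, hx _ hi, mul_add, map_add, mul_one, ← mul_assoc, ht _ hi, ← mul_assoc,
        ← cyc_shift hB i r hi le_rfl, ih (by omega)]
      push_cast; ring
  obtain ⟨k, rfl⟩ : ∃ k, r = k + 1 := ⟨r - 1, by omega⟩
  have := main k (by omega)
  rw [Nat.add_sub_cancel]
  rw [cyc_succ, mul_assoc (cyc s k), h2 k (by omega), mul_one, ← cyc_succ] at this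
  rw [this]; push_cast; rfl

theorem cyc_list {A : Type*} [Monoid A] (s : ℕ → A) (r : ℕ) : cyc s r = ((List.range r).map s).prod := by
  induction r with
  | zero => simp
  | succ r ih => rw [cyc_succ, ih, List.range_succ]; simp

section
variable {d : ℕ}

noncomputable def wt (c : ℕ → ℤ) (i : ℕ) : ℝ := 1 / ((c (i+1) - c i : ℤ) : ℝ)

noncomputable def G (r : ℕ) (lam : Fin d → ℤ) (Ψ : (Fin d → ℤ) → ℝ) : ℝ :=
  PS (r+1) lam (fun c ν => (∏ i ∈ range r, wt c i) * Ψ ν)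

theorem list_prod_range {M : Type*} [CommMonoid M] (r : ℕ) (f : ℕ → M) : ((List.range r).map f).prod = ∏ i ∈ range r, f i := by
  induction r with
  | zero => simp
  | succ r ih => rw [List.range_succ, Finset.prod_range_succ, ← ih]; simp

theorem PX_True (m : ℕ) (lam : Fin d → ℤ) (F : (ℕ → ℤ) → (Fin d → ℤ) → ℝ) :
    ∑ x : PX m lam (fun _ => True), F (cont lam x.1) (st lam x.1 0) = PS m lam F := by
  classical
  rw [PX_sum lam (fun _ => True) (fun w => F (cont lam w) (st lam w 0))]
  unfold PS
  simp only [and_true]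

theorem G_rec (r : ℕ) (lam : Fin d → ℤ) (Ψ : (Fin d → ℤ) → ℝ) :
    PS (r+2) lam (fun c ν => (∏ i ∈ range r, wt c i) * (c (r+1) : ℝ) * Ψ ν) =
    PS (r+2) lam (fun c ν => (∏ i ∈ range r, wt c (i+1)) * (c 0 : ℝ) * Ψ ν) + (r+1) * G (r+1) lam Ψ := by
  let S := psys (r+1) lam (fun _ => True) 0
  let s := S.Rq 1
  let x : ℕ → Module.End ℝ (PX (r+1+1) lam (fun _ => True) → ℝ) := fun k => Sys.dg (fun y => ((cont lam y.1 k : ℤ) : ℝ))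
  let Z : Module.End ℝ (PX (r+1+1) lam (fun _ => True) → ℝ) := Sys.dg (fun y => Ψ (st lam y.1 0))
  let τ : Module.End ℝ (PX (r+1+1) lam (fun _ => True) → ℝ) →+ ℝ :=
    { toFun := fun a => LinearMap.trace ℝ _ (Z * a)
      map_zero' := by simp
      map_add' := by intro a b; rw [mul_add, map_add] }
  have hB : Braid s (r+1) := S.op_Braid par_one
  have h2 : ∀ k < r+1, s k * s k = 1 := fun k hk => S.Rq_sq 1 (by norm_num) le_rfl k hk
  have hrho : ∀ k (y : PX (r+1+1) lam (fun _ => True)), S.rho k (S.e y) = cont lam y.1 (k+1) - cont lam y.1 k := by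
    intro k y; simp [S, Sys.rho, psys, let']
  have hx : ∀ k < r+1, s k * x (k+1) = x k * s k + 1 := by
    intro k hk
    apply LinearMap.ext; intro v; funext y
    simp only [Module.End.mul_apply, LinearMap.add_apply, Pi.add_apply, Module.End.one_apply, s, Sys.Rq, Sys.op_apply, x, Sys.dg_apply]
    have e := S.ext_dg (fun _ l => ((l.2 : ℤ) : ℝ)) (k+1) v (sg k (S.e y))
    have e' : (fun y : PX (r+1+1) lam (fun _ => True) => (((S.e y (k+1)).2 : ℤ) : ℝ)) = (fun y => ((cont lam y.1 (k+1) : ℤ) : ℝ)) := rfl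
    rw [e'] at e
    rw [e]
    have e2 : (sg k (S.e y) (k+1)).2 = cont lam y.1 k := by
      rw [sg_apply, if_neg (by omega), if_pos rfl]; rfl
    rw [e2, aq_at_one]
    have hne := S.rho_ne y k hk
    rw [hrho] at hne ⊢
    have hne' : (((cont lam y.1 (k+1) - cont lam y.1 k : ℤ)) : ℝ) ≠ 0 := by exact_mod_cast hne
    push_cast at hne' ⊢
    field_simp
    ring
  have hZ : ∀ k < r+1, s k * Z = Z * s k := by
    intro k hk
    apply LinearMap.ext; intro v; funext y
    simp only [Module.End.mul_apply, s, Sys.Rq, Sys.op_apply, Z, Sys.dg_apply]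
    by_cases hh : ∃ y', S.e y' = sg k (S.e y)
    · obtain ⟨y', hy'⟩ := hh
      rw [← hy', S.ext_e, S.ext_e]
      have e1 : y'.1 = wsw k (by omega) y.1 := by
        funext ⟨j, hj⟩
        have := congrArg Prod.fst (congrFun hy' j)
        rw [sg_apply] at this
        by_cases h1 : j = k
        · subst h1
          rw [wsw_i]
          simp only [if_true, S, psys, let', rw', hj, show j + 1 < r+1+1 by omega, dif_pos] at this
          exact Fin.ext this
        · by_cases h2 : j = k+1
          · subst h2
            rw [wsw_i1]
            rw [if_neg h1] at this
            simp only [if_true, S, psys, let', rw', hj, show k < r+1+1 by omega, dif_pos] at this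
            exact Fin.ext this
          · rw [wsw_ne k (by omega) y.1 j hj h1 h2]
            rw [if_neg h1, if_neg h2] at this
            simp only [S, psys, let', rw', hj, dif_pos] at this
            exact Fin.ext this
      have e5 : st lam y'.1 0 = st lam y.1 0 := by rw [e1, st_wsw_le _ _ _ _ _ (Nat.zero_le _)]
      simp only [Sys.dg_apply, e5]
      ring
    · push Not at hh
      rw [S.ext_of_not _ _ hh, S.ext_of_not _ _ hh]; ring
  have ht : ∀ k < r+1, ∀ a, τ (a * s k) = τ (s k * a) := by
    intro k hk a
    show LinearMap.trace ℝ _ (Z * (a * s k)) = LinearMap.trace ℝ _ (Z * (s k * a))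
    rw [← mul_assoc, LinearMap.trace_mul_comm, ← mul_assoc, hZ k hk, mul_assoc]
  have key := ring_lemma s x (r+1) hB h2 hx τ ht (by omega)
  have hone : Sys.dg (fun _ : PX (r+1+1) lam (fun _ => True) => (1:ℝ)) = 1 := by
    apply LinearMap.ext; intro v; funext y; simp [Sys.dg_apply]
  have tr : ∀ (l : List ℕ) (hs : l.Pairwise (· < ·)) (hl : ∀ i ∈ l, i < r+1) (g' : PX (r+1+1) lam (fun _ => True) → ℝ),
      τ ((l.map s).prod * Sys.dg g') = ∑ y : PX (r+1+1) lam (fun _ => True), Ψ (st lam y.1 0) * (l.map (wt (cont lam y.1))).prod * g' y := by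
    intro l hs hl g'
    show LinearMap.trace ℝ _ (Z * _) = _
    have := S.trace_lp (D := aq 1) (fq_neg 1) (fq_one 1) l hs hl (fun y => Ψ (st lam y.1 0)) g'
    rw [← mul_assoc]
    refine Eq.trans this ?_
    simp only [aq_at_one, hrho]
    rfl
  have t1 := tr (List.range r) List.pairwise_lt_range (by intro i hi; rw [List.mem_range] at hi; omega) (fun y => ((cont lam y.1 (r+1) : ℤ) : ℝ))
  have t2 := tr (List.range (r+1)) List.pairwise_lt_range (by intro i hi; rw [List.mem_range] at hi; omega) (fun y => 1)
  have t3 := tr ((List.range r).map Nat.succ) (List.pairwise_lt_range.map _ (by intro a b; simp)) (by intro i hi; simp at hi; omega) (fun y => ((cont lam y.1 0 : ℤ) : ℝ))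
  have e3 : (((List.range r).map Nat.succ).map s).prod = s 0 * cyc s (r+1) := by
    rw [cyc_list, List.range_succ_eq_map, List.map_cons, List.prod_cons, ← mul_assoc, h2 0 (by omega), one_mul]
  rw [e3] at t3
  rw [← cyc_list] at t1 t2
  rw [hone, mul_one] at t2
  rw [Nat.add_sub_cancel] at key
  have a1 := PX_True (r+2) lam (fun c ν => (∏ i ∈ range r, wt c i) * (c (r+1) : ℝ) * Ψ ν)
  have a2 := PX_True (r+2) lam (fun c ν => (∏ i ∈ range (r+1), wt c i) * Ψ ν)
  have a3 := PX_True (r+2) lam (fun c ν => (∏ i ∈ range r, wt c (i+1)) * (c 0 : ℝ) * Ψ ν)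
  unfold G
  rw [← a1, ← a3, ← a2]
  have k' : τ (cyc s r * Sys.dg (fun y => ((cont lam y.1 (r+1) : ℤ) : ℝ))) = τ (s 0 * cyc s (r+1) * Sys.dg (fun y => ((cont lam y.1 0 : ℤ) : ℝ))) + ((r+1 : ℕ):ℝ) * τ (cyc s (r+1)) := key
  rw [t1, t2, t3] at k'
  simp only [List.map_map, list_prod_range, mul_one, Function.comp_def, Nat.succ_eq_add_one] at k'
  push_cast at k'
  simp only [mul_comm, mul_left_comm] at k' ⊢
  exact k'

theorem MN (r : ℕ) (lam : Fin d → ℤ) (hl : StrictAnti lam) (Ψ : (Fin d → ℤ) → ℝ) (hΨ : Anti Ψ) :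
    G r lam Ψ = ∑ i, Ψ (sub1 lam (r+1) i) := by
  induction r generalizing lam Ψ with
  | zero =>
    have := PS_one lam hl (fun _ => 1) Ψ hΨ
    simp only [one_mul] at this
    simp only [G, Finset.prod_range_zero, one_mul]
    simpa using this
  | succ r ih =>
    have rc := G_rec r lam Ψ
    have hα : ∀ Φ : (Fin d → ℤ) → ℝ, Anti Φ → Anti (fun γ => ∑ i, Φ (sub1 γ (r+1) i)) := by
      intro Φ hΦ
      have := hΦ.wsum (fun _ => 1) (r+1)
      simpa only [one_mul] using this
    have hb : Anti (fun γ : Fin d → ℤ => ∑ i, ((γ i - 1 : ℤ) : ℝ) * Ψ (sub1 γ 1 i)) :=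
      hΨ.wsum (fun z => ((z - 1 : ℤ):ℝ)) 1
    have L : PS (r+2) lam (fun c ν => (∏ i ∈ range r, wt c i) * (c (r+1) : ℝ) * Ψ ν) =
        ∑ i, ((lam i - 1 : ℤ) : ℝ) * ∑ j, Ψ (sub1 (sub1 lam 1 i) (r+1) j) := by
      rw [PS_split (r+1) 1, ← PS_one lam hl (fun z => (z:ℝ)) _ (hα Ψ hΨ)]
      refine PS_congr _ _ _ fun c2 μ hμ => ?_
      rw [← ih μ hμ Ψ hΨ]
      unfold G PS
      rw [Finset.mul_sum]
      refine Finset.sum_congr rfl fun u _ => ?_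
      rw [mul_ite, mul_zero]
      congr 1
      have e1 : glue (r+1) (cont μ u) c2 (r+1) = c2 0 := by simp [glue]
      have e2 : ∏ i ∈ range r, wt (glue (r+1) (cont μ u) c2) i = ∏ i ∈ range r, wt (cont μ u) i := by
        refine Finset.prod_congr rfl fun i hi => ?_
        rw [Finset.mem_range] at hi
        simp only [wt, glue]
        rw [if_pos (by omega), if_pos (by omega)]
      beta_reduce
      rw [e1, e2]; ring
    have R : PS (r+2) lam (fun c ν => (∏ i ∈ range r, wt c (i+1)) * (c 0 : ℝ) * Ψ ν) =
        ∑ j, ∑ i, ((sub1 lam (r+1) j i - 1 : ℤ) : ℝ) * Ψ (sub1 (sub1 lam (r+1) j) 1 i) := by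
      rw [← ih lam hl _ hb, show r + 2 = 1 + (r+1) by ring, PS_split 1 (r+1)]
      unfold G
      refine PS_congr _ _ _ fun c2 μ hμ => ?_
      beta_reduce
      rw [← PS_one μ hμ (fun z => (z:ℝ)) Ψ hΨ]
      unfold PS
      rw [Finset.mul_sum]
      refine Finset.sum_congr rfl fun u _ => ?_
      rw [mul_ite, mul_zero]
      congr 1
      have e1 : glue 1 (cont μ u) c2 0 = cont μ u 0 := by simp [glue]
      have e2 : ∏ i ∈ range r, wt (glue 1 (cont μ u) c2) (i+1) = ∏ i ∈ range r, wt c2 i := by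
        refine Finset.prod_congr rfl fun i hi => ?_
        simp [wt, glue]
      beta_reduce
      rw [e1, e2]; ring
    rw [L, R, Finset.sum_comm (γ := Fin d)] at rc
    have comm : ∀ i j, sub1 (sub1 lam (r+1) j) 1 i = sub1 (sub1 lam 1 i) (r+1) j := by
      intro i j; funext k; simp only [sub1]; ring
    have dg' : ∀ i, sub1 (sub1 lam 1 i) (r+1) i = sub1 lam ((r+1:ℕ)+1) i := by
      intro i; funext k; simp only [sub1]; split_ifs <;> push_cast <;> ring
    simp only [comm] at rc
    have e : ∀ i j, ((sub1 lam (r+1) j i - 1 : ℤ) : ℝ) * Ψ (sub1 (sub1 lam 1 i) (r+1) j) =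
        ((lam i - 1 : ℤ):ℝ) * Ψ (sub1 (sub1 lam 1 i) (r+1) j) - if j = i then (r+1) * Ψ (sub1 lam ((r+1:ℕ)+1) i) else 0 := by
      intro i j
      have es : sub1 lam (r+1) j i = lam i - if j = i then (r+1:ℤ) else 0 := rfl
      rw [es]
      by_cases h : j = i
      · subst h
        rw [← dg', if_pos rfl, if_pos rfl]
        generalize Ψ _ = P
        push_cast; ring
      · rw [if_neg h, if_neg h]; ring
    simp only [e, Finset.sum_sub_distrib, Finset.sum_ite_eq', Finset.mem_univ, if_true, ← Finset.mul_sum] at rc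
    have hp : ((r:ℝ)+1) ≠ 0 := by positivity
    apply mul_left_cancel₀ hp
    linarith

end
end RP

namespace RP
open Finset

section
variable {d : ℕ}

noncomputable def Tt (δ : Fin d → ℤ) (r : ℕ) : ℕ → (Fin d → ℤ) → ℝ
  | 0, γ => Matrix.det (Matrix.of fun i j : Fin d => if γ i = δ j then (1:ℝ) else 0)
  | ℓ+1, γ => ∑ i, Tt δ r ℓ (sub1 γ r i)

theorem Tt_anti (δ : Fin d → ℤ) (r ℓ : ℕ) : Anti (Tt δ r ℓ) := by
  induction ℓ with
  | zero =>
    intro γ i j hij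
    simp only [Tt]
    have := Matrix.det_permute (Equiv.swap i j) (Matrix.of fun i j : Fin d => if γ i = δ j then (1:ℝ) else 0)
    rw [Equiv.Perm.sign_swap hij] at this
    simp only [Units.val_neg, Units.val_one, Int.cast_neg, Int.cast_one, neg_mul, one_mul] at this
    rw [← this]
    rfl
  | succ ℓ ih =>
    have := ih.wsum (fun _ => 1) r
    simp only [one_mul] at this
    exact this

theorem Tt_zero_perm (δ γ : Fin d → ℤ) (hδ : Function.Injective δ) (r : ℕ) (σ : Equiv.Perm (Fin d)) (h : γ = δ ∘ σ) :
    Tt δ r 0 γ = 1 ∨ Tt δ r 0 γ = -1 := by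
  simp only [Tt]
  have e : (Matrix.of fun i j : Fin d => if γ i = δ j then (1:ℝ) else 0) = (1 : Matrix (Fin d) (Fin d) ℝ).submatrix σ id := by
    ext i j
    simp only [Matrix.of_apply, Matrix.submatrix_apply, id, Matrix.one_apply, h, Function.comp, hδ.eq_iff]
  rw [e, Matrix.det_permute, Matrix.det_one, mul_one]
  rcases Int.units_eq_one_or (Equiv.Perm.sign σ) with h | h <;> rw [h] <;> simp

theorem Tt_zero_not (δ γ : Fin d → ℤ) (r : ℕ) (h : ¬ ∃ σ : Equiv.Perm (Fin d), γ = δ ∘ σ) :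
    Tt δ r 0 γ = 0 := by
  simp only [Tt]
  rw [Matrix.det_apply]
  refine Finset.sum_eq_zero fun σ _ => ?_
  have : ∃ i, γ (σ i) ≠ δ i := by
    by_contra hc
    push Not at hc
    apply h
    refine ⟨σ⁻¹, ?_⟩
    funext i
    have := hc (σ⁻¹ i)
    simpa using this
  obtain ⟨i, hi⟩ := this
  rw [Finset.prod_eq_zero (Finset.mem_univ i), smul_zero]
  simp [hi]

theorem strict_perm {δ γ : Fin d → ℤ} (hδ : StrictAnti δ) (hγ : StrictAnti γ) (σ : Equiv.Perm (Fin d)) (h : γ = δ ∘ σ) : γ = δ := by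
  refine (StrictAnti.range_inj hγ hδ).1 ?_
  rw [h, Function.Surjective.range_comp σ.surjective]

theorem Tt_zero_strict {δ γ : Fin d → ℤ} (hδ : StrictAnti δ) (hγ : StrictAnti γ) (r : ℕ) :
    Tt δ r 0 γ = if γ = δ then 1 else 0 := by
  split_ifs with h
  · subst h
    simp only [Tt]
    have e : (Matrix.of fun i j : Fin d => if γ i = γ j then (1:ℝ) else 0) = 1 := by
      ext i j
      simp only [Matrix.of_apply, Matrix.one_apply, hγ.injective.eq_iff]
    rw [e, Matrix.det_one]
  · apply Tt_zero_not
    rintro ⟨σ, hσ⟩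
    exact h (strict_perm hδ hγ σ hσ)

theorem PS_T (δ : Fin d → ℤ) (r : ℕ) (hr : 1 ≤ r) (ℓ : ℕ) (lam : Fin d → ℤ) (hl : StrictAnti lam) :
    PS (ℓ * r) lam (fun c ν => (∏ i ∈ (range (ℓ * r)).filter (fun i => (i+1)%r ≠ 0), wt c i) * Tt δ r 0 ν) = Tt δ r ℓ lam := by
  induction ℓ generalizing lam with
  | zero =>
    rw [show 0 * r = 0 by ring]
    classical
    unfold PS
    rw [Fintype.sum_unique, if_pos]
    · rw [st_ge _ _ _ le_rfl]; simp
    · intro k hk; rw [st_ge _ _ _ (by omega)]; exact hl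
  | succ ℓ ih =>
    rw [show (ℓ+1)*r = ℓ * r + r by ring, PS_split]
    obtain ⟨s, rfl⟩ : ∃ s, r = s + 1 := ⟨r - 1, by omega⟩
    have := MN s lam hl (Tt δ (s+1) ℓ) (Tt_anti _ _ _)
    simp only [Tt]
    push_cast
    rw [← this]
    unfold G
    refine PS_congr _ _ _ fun c2 μ hμ => ?_
    rw [← ih μ hμ]
    unfold PS
    rw [Finset.mul_sum]
    refine Finset.sum_congr rfl fun u _ => ?_
    rw [mul_ite, mul_zero]
    congr 1
    beta_reduce
    rw [← mul_assoc]
    congr 1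
    rw [Finset.prod_filter, Finset.prod_range_add, mul_comm]
    congr 1
    · rw [Finset.prod_range_succ, if_neg (by
        rw [show ℓ * (s+1) + s + 1 = (ℓ+1)*(s+1) by ring]; simp), mul_one]
      refine Finset.prod_congr rfl fun i hi => ?_
      rw [Finset.mem_range] at hi
      rw [if_pos]
      · simp only [wt, glue]
        rw [if_neg (by omega), if_neg (by omega)]
        congr 3
        · congr 1; omega
        · congr 1; omega
      · rw [show ℓ * (s+1) + i + 1 = (i+1) + ℓ*(s+1) by ring, Nat.add_mul_mod_self_right, Nat.mod_eq_of_lt (by omega)]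
        omega
    · rw [Finset.prod_filter]
      refine Finset.prod_congr rfl fun i hi => ?_
      rw [Finset.mem_range] at hi
      by_cases h : (i+1) % (s+1) ≠ 0
      · rw [if_pos h, if_pos h]
        have : i + 1 ≠ ℓ * (s+1) := by intro h'; rw [h'] at h; simp at h
        simp only [wt, glue]
        rw [if_pos (by omega), if_pos (by omega)]
      · rw [if_neg h, if_neg h]

/-- count of legal paths on the abacus -/
noncomputable def Dn (δ : Fin d → ℤ) (r : ℕ) : ℕ → (Fin d → ℤ) → ℕ
  | 0, γ => by classical exact if ∃ σ : Equiv.Perm (Fin d), γ = δ ∘ σ then 1 else 0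
  | ℓ+1, γ => by classical exact ∑ i, if Function.Injective (sub1 γ r i) then Dn δ r ℓ (sub1 γ r i) else 0

def key (r : ℕ) (a : ℤ) : ℤ ×ₗ ℤ := toLex (a % r, a)

def Rel (r : ℕ) (γ γ' : Fin d → ℤ) : Prop := ∀ i j, key r (γ i) < key r (γ j) ↔ key r (γ' i) < key r (γ' j)

theorem key_inj (r : ℕ) : Function.Injective (key r) := by
  intro a b h
  have := toLex_inj.1 h
  exact (Prod.mk.inj this).2

theorem key_lt (r : ℕ) (a b : ℤ) : key r a < key r b ↔ a % r < b % r ∨ (a % r = b % r ∧ a < b) := by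
  unfold key; rw [Prod.Lex.toLex_lt_toLex]

theorem Rel_unique (r : ℕ) (γ γ' : Fin d → ℤ) (hγ : Function.Injective γ) (h : Rel r γ γ') (hr : Set.range γ = Set.range γ') : γ = γ' := by
  let f := fun i => key r (γ i)
  let f' := fun i => key r (γ' i)
  have m1 : StrictMono (f ∘ Tuple.sort f) :=
    (Tuple.monotone_sort f).strictMono_of_injective (((key_inj r).comp hγ).comp (Tuple.sort f).injective)
  have m2 : StrictMono (f' ∘ Tuple.sort f) := fun a b hab => (h _ _).1 (m1 hab)
  have e : f ∘ Tuple.sort f = f' ∘ Tuple.sort f := by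
    refine (StrictMono.range_inj m1 m2).1 ?_
    rw [Function.Surjective.range_comp (Tuple.sort f).surjective, Function.Surjective.range_comp (Tuple.sort f).surjective]
    show Set.range (key r ∘ γ) = Set.range (key r ∘ γ')
    rw [Set.range_comp, Set.range_comp, hr]
  funext i
  have := congrFun e ((Tuple.sort f).symm i)
  simp only [Function.comp, Equiv.apply_symm_apply] at this
  exact key_inj r this

theorem Rel_move (r : ℕ) (γ : Fin d → ℤ) (i : Fin d) (hγ : Function.Injective γ) (h : Function.Injective (sub1 γ r i)) :
    Rel r γ (sub1 γ r i) := by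
  have hm : ∀ k, sub1 γ r i k % (r:ℤ) = γ k % r := by
    intro k; unfold sub1; split_ifs
    · exact Int.sub_emod_right _ _
    · simp
  have hdiv : ∀ k l, γ k % (r:ℤ) = γ l % r → k ≠ l → γ k ≠ γ l → (γ k + r ≤ γ l ∨ γ l + r ≤ γ k) := by
    intro k l h1 h2 h3
    obtain ⟨c, hc⟩ := Int.ModEq.dvd (show γ k ≡ γ l [ZMOD r] from h1)
    rcases lt_trichotomy c 0 with h4 | h4 | h4
    · right; nlinarith [Int.natCast_nonneg r]
    · subst h4; exfalso; apply h3; linarith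
    · left; nlinarith [Int.natCast_nonneg r]
  intro k l
  rw [key_lt, key_lt, hm, hm]
  refine or_congr_right (and_congr_right fun h1 => ?_)
  by_cases hkl : k = l
  · subst hkl; simp
  · have g1 : γ k ≠ γ l := fun e => hkl (hγ e)
    have g2 : sub1 γ r i k ≠ sub1 γ r i l := fun e => hkl (h e)
    have g3 := hdiv k l h1 hkl g1
    simp only [sub1] at *
    split_ifs at * with a b <;> omega

theorem T_D (δ : Fin d → ℤ) (hδ : Function.Injective δ) (r ℓ : ℕ) (γ : Fin d → ℤ) (hγ : Function.Injective γ) (ε : ℝ)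
    (hε : ∀ γ0, Rel r γ γ0 → (∃ σ : Equiv.Perm (Fin d), γ0 = δ ∘ σ) → Tt δ r 0 γ0 = ε) :
    Tt δ r ℓ γ = ε * Dn δ r ℓ γ := by
  classical
  induction ℓ generalizing γ with
  | zero =>
    simp only [Dn]
    split_ifs with h
    · rw [hε γ (fun _ _ => Iff.rfl) h]; simp
    · rw [Tt_zero_not _ _ _ h]; simp
  | succ ℓ ih =>
    simp only [Tt, Dn]
    push_cast
    rw [Finset.mul_sum]
    refine Finset.sum_congr rfl fun i _ => ?_
    split_ifs with h
    · refine ih _ h fun γ0 h0 => hε γ0 ?_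
      intro k l
      rw [← h0 k l]; exact Rel_move r γ i hγ h k l
    · rw [Function.Injective] at h
      push Not at h
      obtain ⟨p, q, h1, h2⟩ := h
      rw [(Tt_anti δ r ℓ).zero _ p q h2 h1]; simp

theorem T_abs (δ : Fin d → ℤ) (hδ : Function.Injective δ) (r ℓ : ℕ) (γ : Fin d → ℤ) (hγ : Function.Injective γ) :
    |Tt δ r ℓ γ| = Dn δ r ℓ γ := by
  by_cases h : ∃ γ0, Rel r γ γ0 ∧ (∃ σ : Equiv.Perm (Fin d), γ0 = δ ∘ σ)
  · obtain ⟨γ0, h1, σ, h2⟩ := h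
    have := T_D δ hδ r ℓ γ hγ (Tt δ r 0 γ0) (by
      rintro γ1 h3 ⟨σ', h4⟩
      have : γ0 = γ1 := by
        refine Rel_unique r γ0 γ1 (by rw [h2]; exact hδ.comp σ.injective) (fun k l => (h1 k l).symm.trans (h3 k l)) ?_
        rw [h2, h4, Function.Surjective.range_comp σ.surjective, Function.Surjective.range_comp σ'.surjective]
      rw [this])
    rw [this, abs_mul]
    rcases Tt_zero_perm δ γ0 hδ r σ h2 with h5 | h5 <;> rw [h5] <;> simp
  · have := T_D δ hδ r ℓ γ hγ 1 (fun γ0 h1 h2 => absurd ⟨γ0, h1, h2⟩ h)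
    rw [this]; simp

theorem Dn_perm (δ : Fin d → ℤ) (r ℓ : ℕ) (γ : Fin d → ℤ) (σ : Equiv.Perm (Fin d)) : Dn δ r ℓ (γ ∘ σ) = Dn δ r ℓ γ := by
  classical
  induction ℓ generalizing γ with
  | zero =>
    simp only [Dn]
    congr 1
    apply propext
    constructor
    · rintro ⟨τ, h⟩
      refine ⟨τ * σ⁻¹, ?_⟩
      funext i
      have := congrFun h (σ⁻¹ i)
      simpa using this
    · rintro ⟨τ, h⟩
      exact ⟨τ * σ, by rw [h]; rfl⟩
  | succ ℓ ih =>
    simp only [Dn]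
    rw [← Equiv.sum_comp σ (fun i => if Function.Injective (sub1 γ r i) then Dn δ r ℓ (sub1 γ r i) else 0)]
    refine Finset.sum_congr rfl fun i _ => ?_
    have e : sub1 (γ ∘ σ) r i = sub1 γ r (σ i) ∘ σ := by funext k; simp [sub1]
    rw [e, ih]
    congr 1
    apply propext
    exact ⟨fun h => by
      have := h.comp σ.symm.injective
      rwa [Function.comp_assoc, Equiv.self_comp_symm, Function.comp_id] at this, fun h => h.comp σ.injective⟩

theorem Dn_range (δ : Fin d → ℤ) (r ℓ : ℕ) (γ γ' : Fin d → ℤ) (h1 : Function.Injective γ) (h2 : Function.Injective γ')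
    (h : Set.range γ = Set.range γ') : Dn δ r ℓ γ = Dn δ r ℓ γ' := by
  let σ : Equiv.Perm (Fin d) := ((Equiv.ofInjective γ h1).trans (Equiv.setCongr h)).trans (Equiv.ofInjective γ' h2).symm
  have : γ = γ' ∘ σ := by
    funext i
    have := Equiv.apply_ofInjective_symm h2 ((Equiv.setCongr h) ((Equiv.ofInjective γ h1) i))
    exact this.symm
  rw [this, Dn_perm]

theorem Dn_neg (δ : Fin d → ℤ) (r ℓ : ℕ) (γ : Fin d → ℤ) (hδ : ∀ i, 0 ≤ δ i) (i : Fin d) (h : γ i < 0) : Dn δ r ℓ γ = 0 := by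
  classical
  induction ℓ generalizing γ with
  | zero =>
    simp only [Dn]
    rw [if_neg]
    rintro ⟨σ, hσ⟩
    have := hδ (σ i)
    rw [hσ] at h; simp only [Function.comp] at h; omega
  | succ ℓ ih =>
    simp only [Dn]
    refine Finset.sum_eq_zero fun k _ => ?_
    split_ifs
    · apply ih
      simp only [sub1]; split_ifs <;> omega
    · rfl

end
end RP

namespace RP
open Finset

section
variable {d w : ℕ}

structure RR (r : ℕ) (lam nu : PartitionIn d w) (s t : ℕ) : Prop where
  st : s ≤ t
  td : t < d
  out : ∀ i, i < s ∨ t < i → nu.part i = lam.part i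
  mid : ∀ i, s ≤ i → i < t → nu.part i + 1 = lam.part (i+1)
  last : nu.part t < lam.part t
  sz : nu.part t + r + s = lam.part s + t

theorem RR.sub {r : ℕ} {lam nu : PartitionIn d w} {s t : ℕ} (h : RR r lam nu s t) : SubPartition nu lam := by
  intro i
  by_cases h1 : i < s ∨ t < i
  · rw [h.out i h1]
  · push Not at h1
    rcases h1.2.lt_or_eq with h2 | h2
    · have := h.mid i h1.1 h2
      have := lam.antitone (Nat.le_succ i)
      simp only [Nat.succ_eq_add_one] at this
      omega
    · subst h2; exact h.last.le

theorem RR.lt {r : ℕ} {lam nu : PartitionIn d w} {s t : ℕ} (h : RR r lam nu s t) (i : ℕ) (h1 : s ≤ i) (h2 : i ≤ t) :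
    nu.part i < lam.part i := by
  rcases h2.lt_or_eq with h2 | h2
  · have := h.mid i h1 h2
    have := lam.antitone (Nat.le_succ i)
    simp only [Nat.succ_eq_add_one] at this
    omega
  · subst h2; exact h.last

theorem skew_card (lam nu : PartitionIn d w) : Set.ncard {p : ℕ × ℕ | InShape lam nu p.1 p.2} = ∑ i ∈ range d, (lam.part i - nu.part i) := by
  have : {p : ℕ × ℕ | InShape lam nu p.1 p.2} = ↑((((range d).sigma fun i => Ico (nu.part i) (lam.part i))).map (Equiv.sigmaEquivProd ℕ ℕ).toEmbedding) := by
    ext ⟨i, j⟩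
    simp only [InShape, Set.mem_setOf_eq, Finset.coe_map, Set.mem_image, Finset.mem_coe, Finset.mem_sigma, Finset.mem_range, Finset.mem_Ico]
    constructor
    · rintro ⟨h1, h2, h3⟩
      exact ⟨⟨i, j⟩, ⟨h1, h2, h3⟩, rfl⟩
    · rintro ⟨⟨i', j'⟩, ⟨h1, h2, h3⟩, h4⟩
      simp only [Equiv.coe_toEmbedding, Equiv.sigmaEquivProd_apply, Prod.mk.injEq] at h4
      obtain ⟨rfl, rfl⟩ := h4
      exact ⟨h1, h2, h3⟩
  rw [this, Set.ncard_coe_finset, Finset.card_map, Finset.card_sigma]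
  simp

theorem tele {lam nu : PartitionIn d w} (s t : ℕ) (hst : s ≤ t) (htd : t < d)
    (out : ∀ i, i < s ∨ t < i → nu.part i = lam.part i)
    (mid : ∀ i, s ≤ i → i < t → nu.part i + 1 = lam.part (i+1)) (hl : nu.part t ≤ lam.part t) :
    nu.part t + ∑ i ∈ range d, (lam.part i - nu.part i) + s = lam.part s + t := by
  have e : ∑ i ∈ range d, (lam.part i - nu.part i) = ∑ i ∈ Ico s (t+1), (lam.part i - nu.part i) := by
    symm
    apply Finset.sum_subset
    · intro i hi; simp at hi ⊢; omega
    · intro i _ hi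
      rw [out i (by simp at hi; omega)]; simp
  rw [e]
  clear e
  have : ∀ u, s ≤ u → u ≤ t → (∑ i ∈ Ico s u, (lam.part i - nu.part i)) + lam.part u + s = lam.part s + u := by
    intro u hu
    induction u, hu using Nat.le_induction with
    | base => intro _; simp
    | succ u hu ih =>
      intro hut
      rw [Finset.sum_Ico_succ_top hu]
      have h1 := ih (by omega)
      have h2 := mid u hu (by omega)
      have := lam.antitone (Nat.le_succ u)
      simp only [Nat.succ_eq_add_one] at this
      omega
  rw [Finset.sum_Ico_succ_top hst]
  have := this t hst le_rfl
  omega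

theorem RR.ribbon {r : ℕ} {lam nu : PartitionIn d w} {s t : ℕ} (h : RR r lam nu s t) : RibbonStep r lam nu := by
  refine ⟨h.sub, ?_, ?_, ?_⟩
  · rw [skew_card]
    have := tele s t h.st h.td h.out h.mid h.last.le
    have := h.sz
    omega
  · have inS : ∀ i j, InShape lam nu i j ↔ (s ≤ i ∧ i ≤ t ∧ nu.part i ≤ j ∧ j < lam.part i) := by
      intro i j
      constructor
      · rintro ⟨h1, h2, h3⟩
        have : ¬ (i < s ∨ t < i) := fun h4 => by have := h.out i h4; omega
        omega
      · rintro ⟨h1, h2, h3, h4⟩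
        exact ⟨by have := h.td; omega, h3, h4⟩
    let S := {p : ℕ × ℕ | InShape lam nu p.1 p.2}
    let R : ℕ × ℕ → ℕ × ℕ → Prop := fun u v => u ∈ S ∧ v ∈ S ∧ BoxAdj u v
    have Rs : ∀ u v, R u v → R v u := by
      rintro u v ⟨h1, h2, h3⟩
      refine ⟨h2, h1, ?_⟩
      unfold BoxAdj at *
      omega
    have symm : ∀ u v, Relation.ReflTransGen R u v → Relation.ReflTransGen R v u := by
      intro u v huv
      induction huv with
      | refl => exact .refl
      | tail _ h2 ih => exact .head (Rs _ _ h2) ih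
    have row : ∀ i j j', InShape lam nu i j → InShape lam nu i j' → j ≤ j' → Relation.ReflTransGen R (i,j) (i,j') := by
      intro i j j' h1 h2 hj
      induction j', hj using Nat.le_induction with
      | base => exact .refl
      | succ k hk ih =>
        have h3 : InShape lam nu i k := ⟨h1.1, h1.2.1.trans hk, by have := h2.2.2; omega⟩
        refine .tail (ih h3) ⟨h3, h2, ?_⟩
        left; exact ⟨rfl, Or.inl rfl⟩
    have conn : ∀ i, s ≤ i → i ≤ t → ∀ j, InShape lam nu i j → Relation.ReflTransGen R (s, lam.part s - 1) (i, j) := by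
      intro i hi
      induction i, hi using Nat.le_induction with
      | base =>
        intro hst j hj
        have := hj.2
        exact symm _ _ (row _ _ _ hj ((inS _ _).2 ⟨le_rfl, hst, by omega, by omega⟩) (by omega))
      | succ i hi ih =>
        intro hit j hj
        have hm := h.mid i hi (by omega)
        have hl := h.lt i hi (by omega)
        have hl' := h.lt (i+1) (by omega) hit
        have a1 : InShape lam nu i (nu.part i) := (inS _ _).2 ⟨hi, by omega, le_rfl, hl⟩
        have a2 : InShape lam nu (i+1) (nu.part i) := (inS _ _).2 ⟨by omega, hit, by omega, by omega⟩
        have hR : R (i, nu.part i) (i+1, nu.part i) := ⟨a1, a2, Or.inr ⟨rfl, Or.inl rfl⟩⟩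
        refine (ih (by omega) _ a1).trans (.head hR ?_)
        exact symm _ _ (row _ _ _ hj a2 (by have := hj.2.2; omega))
    intro p hp q hq
    have hp' := (inS _ _).1 hp
    have hq' := (inS _ _).1 hq
    exact (symm _ _ (conn p.1 hp'.1 hp'.2.1 p.2 hp)).trans (conn q.1 hq'.1 hq'.2.1 q.2 hq)
  · rintro ⟨i, j, h1, h2, h3, h4⟩
    simp only [Set.mem_setOf_eq, InShape] at *
    have : ¬ (i < s ∨ t < i) := fun h5 => by have := h.out i h5; omega
    have : ¬ (i+1 < s ∨ t < i+1) := fun h5 => by have := h.out (i+1) h5; omega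
    have := h.mid i (by omega) (by omega)
    omega

theorem exists_RR {r : ℕ} (hr : 1 ≤ r) {lam nu : PartitionIn d w} (h : RibbonStep r lam nu) : ∃ s t, RR r lam nu s t := by
  classical
  obtain ⟨hsub, hc, hconn, h22⟩ := h
  rw [skew_card] at hc
  have hex : ∃ i, nu.part i < lam.part i := by
    by_contra hcon
    push Not at hcon
    rw [Finset.sum_eq_zero (fun i _ => by have := hcon i; omega)] at hc
    omega
  have hlt : ∀ i, nu.part i < lam.part i → i < d := by
    intro i hi
    by_contra hcon
    have := lam.eq_zero i (by omega)
    omega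
  let s := Nat.find hex
  have hs : nu.part s < lam.part s := Nat.find_spec hex
  let t := Nat.findGreatest (fun i => nu.part i < lam.part i) d
  have ht : nu.part t < lam.part t := Nat.findGreatest_spec (P := fun i => nu.part i < lam.part i) (hlt s hs).le hs
  have hst : s ≤ t := Nat.find_min' hex ht
  have out : ∀ i, i < s ∨ t < i → nu.part i = lam.part i := by
    intro i hi
    have h1 := hsub i
    by_contra hne
    have h2 : nu.part i < lam.part i := by omega
    rcases hi with hi | hi
    · exact Nat.find_min hex hi h2
    · exact Nat.findGreatest_is_greatest (P := fun i => nu.part i < lam.part i) hi (hlt i h2).le h2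
  have mid : ∀ i, s ≤ i → i < t → nu.part i + 1 = lam.part (i+1) := by
    intro i hi hit
    have cross : ∀ p q, Relation.ReflTransGen (fun u v => u ∈ {p : ℕ × ℕ | InShape lam nu p.1 p.2} ∧ v ∈ {p : ℕ × ℕ | InShape lam nu p.1 p.2} ∧ BoxAdj u v) p q →
        p.1 ≤ i → i < q.1 → ∃ j, InShape lam nu i j ∧ InShape lam nu (i+1) j := by
      intro p q hpq hp
      induction hpq with
      | refl => intro h; omega
      | @tail b c hb hbc ih =>
        intro hc
        by_cases hb' : i < b.1
        · exact ih hb'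
        · obtain ⟨h1, h2, h3⟩ := hbc
          have e1 : b.1 = i := by unfold BoxAdj at h3; omega
          have e2 : c.1 = i + 1 := by unfold BoxAdj at h3; omega
          have e3 : b.2 = c.2 := by unfold BoxAdj at h3; omega
          refine ⟨b.2, ?_, ?_⟩
          · rw [← e1]; exact h1
          · rw [← e2, e3]; exact h2
    obtain ⟨j, h1, h2⟩ := cross (s, nu.part s) (t, nu.part t)
      (hconn _ ⟨hlt s hs, le_rfl, hs⟩ _ ⟨hlt t ht, le_rfl, ht⟩) hi hit
    have h3 : nu.part i + 1 ≤ lam.part (i+1) := by have := h1.2.1; have := h2.2.2; omega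
    rcases h3.lt_or_eq with h4 | h4
    · exfalso
      apply h22
      have a1 := lam.antitone (Nat.le_succ i)
      have a2 := nu.antitone (Nat.le_succ i)
      simp only [Nat.succ_eq_add_one] at a1 a2
      have a3 := h2.1
      refine ⟨i, nu.part i, ?_, ?_, ?_, ?_⟩ <;> simp only [Set.mem_setOf_eq, InShape] <;> omega
    · exact h4
  exact ⟨s, t, hst, hlt t ht, out, mid, ht, by
    have := tele s t hst (hlt t ht) out mid ht.le
    omega⟩

/-- beta numbers -/
def beta (lam : PartitionIn d w) (i : Fin d) : ℤ := lam.part i + d - 1 - i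

theorem beta_anti (lam : PartitionIn d w) : StrictAnti (beta lam) := by
  intro i j hij
  have := lam.antitone (show (i:ℕ) ≤ j from hij.le)
  have : (i:ℕ) < j := hij
  unfold beta; omega

theorem RR.unique {r : ℕ} {lam nu nu' : PartitionIn d w} {s t t' : ℕ} (h : RR r lam nu s t) (h' : RR r lam nu' s t') : nu = nu' := by
  have aux : ∀ {nu nu' : PartitionIn d w} {t t' : ℕ}, RR r lam nu s t → RR r lam nu' s t' → ¬ t < t' := by
    intro nu nu' t t' h h' htt
    have h1 := h.sz
    have h2 := h'.sz
    have h3 := h'.last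
    have h4 := h.out (t+1) (by omega)
    have h5 := nu.antitone (Nat.le_succ t)
    have h6 := lam.antitone (show t+1 ≤ t' by omega)
    simp only [Nat.succ_eq_add_one] at h5
    omega
  have ht : t = t' := by
    have := aux h h'
    have := aux h' h
    omega
  subst ht
  have : nu.part = nu'.part := by
    funext i
    by_cases h1 : i < s ∨ t < i
    · rw [h.out i h1, h'.out i h1]
    · rcases Nat.lt_or_ge i t with h2 | h2
      · have := h.mid i (by omega) h2
        have := h'.mid i (by omega) h2
        omega
      · obtain rfl : i = t := by omega
        have := h.sz
        have := h'.sz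
        omega
  cases nu; cases nu'; simp only at this; subst this; rfl

theorem RR.nonneg {r : ℕ} {lam nu : PartitionIn d w} {s t : ℕ} (h : RR r lam nu s t) (hs : s < d) : 0 ≤ beta lam ⟨s, hs⟩ - r := by
  have := h.sz; have := h.td; unfold beta; simp only; omega

theorem RR.range {r : ℕ} {lam nu : PartitionIn d w} {s t : ℕ} (h : RR r lam nu s t) (hs : s < d) :
    Set.range (sub1 (beta lam) r ⟨s, hs⟩) = Set.range (beta nu) := by
  have hsz := h.sz
  have htd := h.td
  have hst := h.st
  ext z
  simp only [Set.mem_range]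
  constructor
  · rintro ⟨i, rfl⟩
    by_cases h1 : (⟨s, hs⟩ : Fin d) = i
    · refine ⟨⟨t, htd⟩, ?_⟩
      simp only [sub1, if_pos h1, beta]
      subst h1
      simp only; omega
    · have h1' : (i:ℕ) ≠ s := fun e => h1 (Fin.ext e.symm)
      simp only [sub1, if_neg h1]
      by_cases h2 : (i:ℕ) < s ∨ t < i
      · refine ⟨i, ?_⟩
        have := h.out i h2
        simp only [beta]; omega
      · refine ⟨⟨i-1, by omega⟩, ?_⟩
        have := h.mid (i-1) (by omega) (by omega)
        rw [show (i:ℕ) - 1 + 1 = i by omega] at this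
        simp only [beta]; omega
  · rintro ⟨i, rfl⟩
    by_cases h2 : (i:ℕ) < s ∨ t < i
    · refine ⟨i, ?_⟩
      have := h.out i h2
      have h1 : (⟨s, hs⟩ : Fin d) ≠ i := fun e => by rw [← e] at h2; simp only at h2; omega
      simp only [sub1, if_neg h1, beta]; omega
    · by_cases h3 : (i:ℕ) = t
      · refine ⟨⟨s, hs⟩, ?_⟩
        have : nu.part i = nu.part t := by rw [h3]
        simp only [sub1, if_true, beta]; omega
      · have := h.mid i (by omega) (by omega)
        refine ⟨⟨i+1, by omega⟩, ?_⟩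
        have h1 : (⟨s, hs⟩ : Fin d) ≠ ⟨i+1, by omega⟩ := fun e => by have := congrArg Fin.val e; simp only at this; omega
        simp only [sub1, if_neg h1, beta]; push_cast; omega

theorem RR.inj {r : ℕ} {lam nu : PartitionIn d w} {s t : ℕ} (h : RR r lam nu s t) (hs : s < d) :
    Function.Injective (sub1 (beta lam) r ⟨s, hs⟩) := by
  have hr := h.range hs
  have hn := (beta_anti nu).injective
  have c1 : (Finset.univ.image (sub1 (beta lam) r ⟨s, hs⟩)).card = d := by
    have : Finset.univ.image (sub1 (beta lam) r ⟨s, hs⟩) = Finset.univ.image (beta nu) := by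
      apply Finset.coe_injective
      simp [hr]
    rw [this, Finset.card_image_of_injective _ hn]; simp
  have := Finset.card_image_iff.1 (c1.trans (by simp))
  intro a b hab
  exact this (by simp) (by simp) hab

theorem RR.exists {r : ℕ} (hr : 1 ≤ r) {lam : PartitionIn d w} (s : ℕ) (hs : s < d) (h0 : 0 ≤ beta lam ⟨s, hs⟩ - r)
    (hi : Function.Injective (sub1 (beta lam) r ⟨s, hs⟩)) : ∃ nu t, RR r lam nu s t := by
  classical
  let P : ℕ → Prop := fun i => i < d ∧ lam.part s + i < lam.part i + s + r
  let t := Nat.findGreatest P d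
  have hPs : P s := ⟨hs, by omega⟩
  have hP : P t := Nat.findGreatest_spec (P := P) hs.le hPs
  have hst : s ≤ t := Nat.le_findGreatest hs.le hPs
  obtain ⟨htd, hPt⟩ := hP
  have hgt : ∀ i, t < i → i < d → lam.part i + s + r < lam.part s + i := by
    intro i h1 h2
    have h3 : ¬ P i := Nat.findGreatest_is_greatest (P := P) h1 h2.le
    have h4 : lam.part i + s + r ≤ lam.part s + i := by
      by_contra h5; exact h3 ⟨h2, by omega⟩
    rcases h4.lt_or_eq with h5 | h5
    · exact h5
    · exfalso
      have hne : (⟨s, hs⟩ : Fin d) ≠ ⟨i, h2⟩ := fun e => by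
        have := congrArg Fin.val e; simp only at this; omega
      apply hne
      apply hi
      simp only [sub1, if_true, if_neg hne, beta]; omega
  have h0' : r + s + 1 ≤ lam.part s + d := by unfold beta at h0; simp only at h0; omega
  have hA : s + r ≤ lam.part s + t ∧ lam.part (t+1) + s + r ≤ lam.part s + t := by
    by_cases h1 : t + 1 < d
    · have := hgt (t+1) (by omega) h1
      omega
    · have := lam.eq_zero (t+1) (by omega)
      omega
  clear_value t
  clear P hPs hi h0
  have anti1 : ∀ i, lam.part (i+1) ≤ lam.part i := fun i => lam.antitone (Nat.le_succ i)
  let f : ℕ → ℕ := fun i => if i < s then lam.part i else if i < t then lam.part (i+1) - 1 else if i = t then lam.part s + t - s - r else lam.part i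
  have f1 : ∀ i, i < s ∨ t < i → f i = lam.part i := by
    intro i h1
    simp only [f]
    split_ifs with a b c
    · rfl
    · omega
    · omega
    · rfl
  have f2 : ∀ i, s ≤ i → i < t → f i = lam.part (i+1) - 1 := by
    intro i h1 h2
    simp only [f]
    rw [if_neg (by omega), if_pos h2]
  have f3 : f t = lam.part s + t - s - r := by
    simp only [f]
    rw [if_neg (by omega), if_neg (by omega)]; simp
  have pos : ∀ i, i ≤ t → 1 ≤ lam.part i := by
    intro i h
    have := lam.antitone h
    omega
  clear_value f
  have fle : ∀ i, f i ≤ lam.part i := by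
    intro i
    by_cases h1 : i < s ∨ t < i
    · rw [f1 i h1]
    · rcases Nat.lt_or_ge i t with h2 | h2
      · rw [f2 i (by omega) h2]; have := anti1 i; omega
      · obtain rfl : i = t := by omega
        rw [f3]; omega
  have fanti : Antitone f := by
    apply antitone_nat_of_succ_le
    intro i
    by_cases h1 : i < s ∨ t < i
    · rw [f1 i h1]; exact (fle _).trans (anti1 i)
    · rcases Nat.lt_or_ge i t with h2 | h2
      · rw [f2 i (by omega) h2]
        rcases Nat.lt_or_ge (i+1) t with h3 | h3
        · rw [f2 (i+1) (by omega) h3]; have := anti1 (i+1); omega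
        · obtain rfl : t = i + 1 := by omega
          rw [f3]; omega
      · obtain rfl : i = t := by omega
        rw [f3, f1 _ (by omega)]; omega
  refine ⟨⟨f, fun i j h => fanti h, fun i => (fle i).trans (lam.le_w i), fun i h => ?_⟩, t, hst, htd, f1, ?_, ?_, ?_⟩
  · have := fle i; have := lam.eq_zero i h; omega
  · intro i h1 h2
    show f i + 1 = _
    rw [f2 i h1 h2]; have := pos (i+1) (by omega); omega
  · show f t < _
    rw [f3]; omega
  · show f t + r + s = _
    rw [f3]; omega

end
end RP

namespace RP
open Finset

section
variable {d w : ℕ}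

theorem inz (lam : PartitionIn d w) (i j : ℕ) : InShape lam (zeroPart d w) i j ↔ j < lam.part i := by
  constructor
  · exact fun h => h.2.2
  · intro h
    refine ⟨?_, Nat.zero_le _, h⟩
    by_contra hc
    rw [lam.eq_zero i (by omega)] at h
    omega

theorem ins (lam nu : PartitionIn d w) (i j : ℕ) : InShape lam nu i j ↔ nu.part i ≤ j ∧ j < lam.part i := by
  constructor
  · exact fun h => h.2
  · intro h
    exact ⟨((inz lam i j).2 h.2).1, h.1, h.2⟩

/-- extend a ribbon tableau by one more ribbon -/
def extE (ℓ : ℕ) (lam nu : PartitionIn d w) (E : ℕ → ℕ → ℕ) : ℕ → ℕ → ℕ :=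
  fun i j => if j < nu.part i then E i j else if j < lam.part i then ℓ + 1 else 0

theorem extE_srt {r ℓ : ℕ} {lam nu : PartitionIn d w} {E : ℕ → ℕ → ℕ} (h : RibbonStep r lam nu)
    (hE : IsSRT r ℓ nu (zeroPart d w) E) : IsSRT r (ℓ+1) lam (zeroPart d w) (extE ℓ lam nu E) := by
  obtain ⟨hsub, hrib⟩ := h
  obtain ⟨h1, h2, h3, h4, h5⟩ := hE
  unfold IsSRT
  simp only [inz] at *
  simp only [ins] at hrib
  have key : ∀ i j, j < lam.part i → (j < nu.part i ∧ extE ℓ lam nu E i j = E i j) ∨ (nu.part i ≤ j ∧ extE ℓ lam nu E i j = ℓ + 1) := by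
    intro i j hj
    unfold extE
    by_cases h : j < nu.part i
    · left; simp [h]
    · right; simp [h, hj]; omega
  refine ⟨?_, ?_, ?_, ?_, ?_⟩
  · intro i j hj
    unfold extE
    rw [if_neg (fun h => hj (h.trans_le (hsub i))), if_neg hj]
  · intro i j hj
    rcases key i j hj with ⟨a, b⟩ | ⟨a, b⟩
    · have := h2 i j a; omega
    · omega
  · intro i j j' hj hj' hjj
    rcases key i j hj with ⟨a, b⟩ | ⟨a, b⟩ <;> rcases key i j' hj' with ⟨a', b'⟩ | ⟨a', b'⟩
    · have := h3 i j j' a a' hjj; omega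
    · have := h2 i j a; omega
    · omega
    · omega
  · intro i i' j hj hj' hjj
    have := nu.antitone hjj
    rcases key i j hj with ⟨a, b⟩ | ⟨a, b⟩ <;> rcases key i' j hj' with ⟨a', b'⟩ | ⟨a', b'⟩
    · have := h4 i i' j a a' hjj; omega
    · have := h2 i j a; omega
    · omega
    · omega
  · intro k hk hk'
    rcases hk'.lt_or_eq with hk' | hk'
    · convert h5 k hk (by omega) using 3
      rename_i p
      constructor
      · rintro ⟨a, b⟩
        rcases key _ _ a with ⟨a', b'⟩ | ⟨a', b'⟩
        · exact ⟨a', by omega⟩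
        · omega
      · rintro ⟨a, b⟩
        have a2 := a.trans_le (hsub _)
        rcases key _ _ a2 with ⟨a', b'⟩ | ⟨a', b'⟩
        · exact ⟨a2, by omega⟩
        · omega
    · convert hrib using 3
      rename_i p
      constructor
      · rintro ⟨a, b⟩
        rcases key _ _ a with ⟨a', b'⟩ | ⟨a', b'⟩
        · have := h2 _ _ a'; omega
        · exact ⟨a', a⟩
      · rintro ⟨a, a2⟩
        rcases key _ _ a2 with ⟨a', b'⟩ | ⟨a', b'⟩
        · omega
        · exact ⟨a2, by omega⟩

theorem extE_surj {r ℓ : ℕ} {lam : PartitionIn d w} {E : ℕ → ℕ → ℕ}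
    (hE : IsSRT r (ℓ+1) lam (zeroPart d w) E) : ∃ nu, RibbonStep r lam nu ∧ ∃ E', IsSRT r ℓ nu (zeroPart d w) E' ∧ extE ℓ lam nu E' = E := by
  classical
  obtain ⟨h1, h2, h3, h4, h5⟩ := hE
  simp only [inz] at *
  have hex : ∀ i, ∃ j, ¬ (j < lam.part i ∧ E i j ≤ ℓ) := fun i => ⟨lam.part i, fun h => absurd h.1 (lt_irrefl _)⟩
  let f : ℕ → ℕ := fun i => Nat.find (hex i)
  have hf : ∀ i j, j < f i ↔ (j < lam.part i ∧ E i j ≤ ℓ) := by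
    intro i j
    constructor
    · intro h
      have := Nat.find_min (hex i) h
      exact not_not.1 this
    · rintro ⟨a, b⟩
      by_contra hc
      have hs := Nat.find_spec (hex i)
      apply hs
      have hc' : Nat.find (hex i) ≤ j := not_lt.1 hc
      exact ⟨by omega, (h3 i _ j (by omega) a hc').trans b⟩
  clear_value f
  let nu : PartitionIn d w := ⟨f, by
      intro i j hij
      apply le_of_forall_lt
      intro c hc
      rw [hf] at hc ⊢
      have a := hc.1.trans_le (lam.antitone hij)
      exact ⟨a, (h4 i j c a hc.1 hij).trans hc.2⟩, by
      intro i
      apply le_of_forall_lt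
      intro c hc
      exact ((hf _ _).1 hc).1.trans_le (lam.le_w i), by
      intro i hi
      by_contra hc
      have := ((hf i 0).1 (by omega)).1
      rw [lam.eq_zero i hi] at this
      omega⟩
  have hnu : ∀ i, nu.part i = f i := fun i => rfl
  refine ⟨nu, ⟨?_, ?_⟩, fun i j => if j < f i then E i j else 0, ?_, ?_⟩
  · intro i
    apply le_of_forall_lt
    intro c hc
    exact ((hf _ _).1 hc).1
  · convert h5 (ℓ+1) (by omega) le_rfl using 3
    rename_i p
    rw [ins, hnu]
    constructor
    · rintro ⟨a, b⟩
      refine ⟨b, ?_⟩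
      have := h2 _ _ b
      by_contra hc
      have := (hf p.1 p.2).2 ⟨b, by omega⟩
      omega
    · rintro ⟨a, b⟩
      refine ⟨?_, a⟩
      by_contra hc
      have := (hf p.1 p.2).1 (by omega)
      omega
  · refine ⟨?_, ?_, ?_, ?_, ?_⟩
    · intro i j h
      rw [inz, hnu] at h
      simp [h]
    · intro i j h
      rw [inz, hnu] at h
      simp only [if_pos h]
      have := (hf i j).1 h
      exact ⟨(h2 i j this.1).1, this.2⟩
    · intro i j j' h h' hj
      rw [inz, hnu] at h h'
      simp only [if_pos h, if_pos h']
      exact h3 _ _ _ ((hf _ _).1 h).1 ((hf _ _).1 h').1 hj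
    · intro i j j' h h' hj
      rw [inz, hnu] at h h'
      simp only [if_pos h, if_pos h']
      exact h4 _ _ _ ((hf _ _).1 h).1 ((hf _ _).1 h').1 hj
    · intro k hk hk'
      convert h5 k hk (by omega) using 3
      rename_i p
      rw [inz, hnu]
      beta_reduce
      constructor
      · rintro ⟨a, b⟩
        rw [if_pos a] at b
        exact ⟨((hf _ _).1 a).1, b⟩
      · rintro ⟨a, b⟩
        have : p.2 < f p.1 := (hf _ _).2 ⟨a, by omega⟩
        rw [if_pos this]
        exact ⟨this, b⟩
  · funext i j
    simp only [extE, hnu]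
    split_ifs with a b
    · rfl
    · have := h2 i j b
      have : ¬ E i j ≤ ℓ := fun hc => a ((hf i j).2 ⟨b, hc⟩)
      omega
    · exact (h1 i j b).symm

theorem RR.s_unique {r : ℕ} {lam nu : PartitionIn d w} {s t s' t' : ℕ} (h : RR r lam nu s t) (h' : RR r lam nu s' t') : s = s' := by
  have h1 := h.lt s le_rfl h.st
  have h2 := h'.lt s' le_rfl h'.st
  by_contra hne
  rcases Nat.lt_or_gt_of_ne hne with h3 | h3
  · have := h'.out s (Or.inl h3); omega
  · have := h.out s' (Or.inl h3); omega

theorem part_ext {nu nu' : PartitionIn d w} (h : ∀ i, nu.part i = nu'.part i) : nu = nu' := by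
  have : nu.part = nu'.part := funext h
  cases nu; cases nu'; simp only at this; subst this; rfl

theorem extE_inj {r ℓ : ℕ} {lam nu nu' : PartitionIn d w} {E E' : ℕ → ℕ → ℕ} (hn : SubPartition nu lam) (hn' : SubPartition nu' lam)
    (hE : IsSRT r ℓ nu (zeroPart d w) E) (hE' : IsSRT r ℓ nu' (zeroPart d w) E')
    (h : extE ℓ lam nu E = extE ℓ lam nu' E') : nu = nu' ∧ E = E' := by
  have key : ∀ {nu nu' : PartitionIn d w} {E E' : ℕ → ℕ → ℕ}, SubPartition nu' lam → IsSRT r ℓ nu (zeroPart d w) E →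
    extE ℓ lam nu E = extE ℓ lam nu' E' → ∀ i, nu.part i ≤ nu'.part i := by
    intro nu nu' E E' hn' hE h i
    by_contra hc
    have h1 := congrFun (congrFun h i) (nu'.part i)
    simp only [extE] at h1
    have h2 := (hE.2.1 i (nu'.part i) ((inz _ _ _).2 (by omega))).2
    have h3 := (hE.2.1 i (nu'.part i) ((inz _ _ _).2 (by omega))).1
    rw [if_pos (by omega), if_neg (by omega)] at h1
    split_ifs at h1 <;> omega
  have e : nu = nu' := part_ext fun i => le_antisymm (key hn' hE h i) (key hn hE' h.symm i)
  subst e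
  refine ⟨rfl, ?_⟩
  funext i j
  by_cases hj : j < nu.part i
  · have h1 := congrFun (congrFun h i) j
    simpa only [extE, if_pos hj] using h1
  · rw [hE.1 i j (by rwa [inz]), hE'.1 i j (by rwa [inz])]

theorem srt_count {r : ℕ} (hr : 1 ≤ r) (ℓ : ℕ) : ∀ lam : PartitionIn d w,
    Finite {E : ℕ → ℕ → ℕ // IsSRT r ℓ lam (zeroPart d w) E} ∧
    Nat.card {E : ℕ → ℕ → ℕ // IsSRT r ℓ lam (zeroPart d w) E} = Dn (beta (zeroPart d w)) r ℓ (beta lam) := by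
  classical
  induction ℓ with
  | zero =>
    intro lam
    have sub : Subsingleton {E : ℕ → ℕ → ℕ // IsSRT r 0 lam (zeroPart d w) E} := by
      constructor
      rintro ⟨E, hE⟩ ⟨E', hE'⟩
      simp only [Subtype.mk.injEq]
      have : ∀ {E : ℕ → ℕ → ℕ}, IsSRT r 0 lam (zeroPart d w) E → ∀ i j, E i j = 0 := by
        intro E hE i j
        by_cases h : InShape lam (zeroPart d w) i j
        · have := hE.2.1 i j h; omega
        · exact hE.1 i j h
      funext i j
      rw [this hE, this hE']
    refine ⟨inferInstance, ?_⟩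
    have hD : Dn (beta (zeroPart d w)) r 0 (beta lam) = if lam = zeroPart d w then 1 else 0 := by
      simp only [Dn]
      congr 1
      apply propext
      constructor
      · rintro ⟨σ, hσ⟩
        have : beta lam = beta (zeroPart d w) := by
          apply (StrictAnti.range_inj (beta_anti _) (beta_anti _)).1
          rw [hσ]; exact σ.surjective.range_comp _
        apply part_ext
        intro i
        by_cases hi : i < d
        · have := congrFun this ⟨i, hi⟩
          simp only [beta] at this
          omega
        · rw [lam.eq_zero i (by omega), (zeroPart d w).eq_zero i (by omega)]
      · rintro rfl; exact ⟨1, rfl⟩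
    rw [hD]
    split_ifs with h
    · subst h
      have : Nonempty {E : ℕ → ℕ → ℕ // IsSRT r 0 (zeroPart d w) (zeroPart d w) E} := by
        refine ⟨⟨fun _ _ => 0, fun _ _ _ => rfl, ?_, fun _ _ _ _ _ _ => le_rfl, fun _ _ _ _ _ _ => le_rfl, fun k h1 h2 => by omega⟩⟩
        intro i j h
        rw [inz] at h
        exact absurd h (Nat.not_lt_zero _)
      exact Nat.card_unique
    · have : IsEmpty {E : ℕ → ℕ → ℕ // IsSRT r 0 lam (zeroPart d w) E} := by
        constructor
        rintro ⟨E, hE⟩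
        apply h
        apply part_ext
        intro i
        by_contra hc
        have := hE.2.1 i 0 ((inz _ _ _).2 (by simp only [zeroPart] at hc; omega))
        omega
      exact Nat.card_of_isEmpty
  | succ ℓ ih =>
    intro lam
    let good : Fin d → Prop := fun s => 0 ≤ beta lam s - r ∧ Function.Injective (sub1 (beta lam) r s)
    have hx : ∀ s : {s // good s}, ∃ nu t, RR r lam nu s.1 t := fun s => RR.exists hr s.1.1 s.1.2 s.2.1 s.2.2
    choose nu t hRR using hx
    let F : (Σ s : {s // good s}, {E : ℕ → ℕ → ℕ // IsSRT r ℓ (nu s) (zeroPart d w) E}) → {E : ℕ → ℕ → ℕ // IsSRT r (ℓ+1) lam (zeroPart d w) E} :=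
      fun p => ⟨extE ℓ lam (nu p.1) p.2.1, extE_srt (hRR p.1).ribbon p.2.2⟩
    have hF : Function.Bijective F := by
      constructor
      · rintro ⟨s, E⟩ ⟨s', E'⟩ h
        have h' := congrArg Subtype.val h
        simp only [F] at h'
        obtain ⟨h1, h2⟩ := extE_inj (hRR s).sub (hRR s').sub E.2 E'.2 h'
        have h3 := hRR s'
        rw [← h1] at h3
        have : s = s' := Subtype.ext (Fin.ext ((hRR s).s_unique h3))
        subst this
        rw [Subtype.ext h2]
      · rintro ⟨E, hE⟩
        obtain ⟨nu', h1, E', h2, h3⟩ := extE_surj hE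
        obtain ⟨s, t', h4⟩ := exists_RR hr h1
        have hs : s < d := lt_of_le_of_lt h4.st h4.td
        let s' : {s // good s} := ⟨⟨s, hs⟩, h4.nonneg hs, h4.inj hs⟩
        have e : nu s' = nu' := (hRR s').unique h4
        rw [← e] at h2 h3
        exact ⟨⟨s', E', h2⟩, Subtype.ext h3⟩
    have fin : ∀ s : {s // good s}, Finite {E : ℕ → ℕ → ℕ // IsSRT r ℓ (nu s) (zeroPart d w) E} := fun s => (ih _).1
    refine ⟨Finite.of_surjective F hF.2, ?_⟩
    rw [← Nat.card_eq_of_bijective F hF, Nat.card_sigma]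
    simp only [Dn]
    have : ∀ s : {s // good s}, Nat.card {E : ℕ → ℕ → ℕ // IsSRT r ℓ (nu s) (zeroPart d w) E} = Dn (beta (zeroPart d w)) r ℓ (sub1 (beta lam) r s.1) := by
      intro s
      rw [(ih _).2]
      exact Dn_range _ _ _ _ _ ((beta_anti _).injective) s.2.2 ((hRR s).range s.1.2).symm
    rw [Finset.sum_congr rfl (fun s _ => this s)]
    have e2 : ∑ s : {s // good s}, Dn (beta (zeroPart d w)) r ℓ (sub1 (beta lam) r s.1) = ∑ s ∈ univ.filter good, Dn (beta (zeroPart d w)) r ℓ (sub1 (beta lam) r s) := by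
      rw [Finset.sum_subtype (p := good)]
      intro x; simp
    rw [e2, Finset.sum_filter]
    apply Finset.sum_congr rfl
    intro s _
    by_cases h2 : Function.Injective (sub1 (beta lam) r s)
    · rw [if_pos h2]
      by_cases h1 : 0 ≤ beta lam s - r
      · rw [if_pos ⟨h1, h2⟩]
      · rw [if_neg (fun h => h1 h.1), Dn_neg _ _ _ _ _ s]
        · simp only [sub1, if_true]; omega
        · intro i; simp only [beta, zeroPart]; omega
    · rw [if_neg h2, if_neg (fun h => h2 h.2)]

theorem srt_ncard {r : ℕ} (hr : 1 ≤ r) (ℓ : ℕ) (lam : PartitionIn d w) :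
    Set.ncard {E : ℕ → ℕ → ℕ | IsSRT r ℓ lam (zeroPart d w) E} = Dn (beta (zeroPart d w)) r ℓ (beta lam) := by
  rw [← (srt_count hr ℓ lam).2]
  rfl

end
end RP

namespace RP
open Finset

section
variable {d w : ℕ}

theorem beta_rect (i : Fin d) : beta (rectPart d w) i = w + d - 1 - i := by
  simp [beta, rectPart]
theorem beta_zero (i : Fin d) : beta (zeroPart d w) i = d - 1 - i := by
  simp [beta, zeroPart]

/-- index set -/
abbrev RX (d w n : ℕ) : Type := PX (n+1) (beta (rectPart d w)) (fun v => v = beta (zeroPart d w))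

def rsys (d w n : ℕ) : Sys (RX d w n) (ℕ × ℤ) n := psys n (beta (rectPart d w)) (fun v => v = beta (zeroPart d w)) (d - 1)

theorem rx_first {n : ℕ} (x : RX d w n) : (x.1 ⟨0, by omega⟩ : ℕ) = 0 := by
  by_contra h
  have h0 : st (beta (rectPart d w)) x.1 0 = beta (zeroPart d w) := x.2.2
  have hs := x.2.1.all 1
  have e := st_succ (beta (rectPart d w)) x.1 0 (by omega)
  rw [h0] at e
  simp only [beta_zero, zero_add] at e
  generalize x.1 ⟨0, by omega⟩ = a at *
  have ha := a.2
  let b : Fin d := ⟨a - 1, by omega⟩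
  have e1 := e a
  have e2 := e b
  rw [if_pos rfl] at e1
  rw [if_neg (fun h => by have := congrArg Fin.val h; simp only [b] at this; omega)] at e2
  have : b < a := by rw [Fin.lt_def]; simp only [b]; omega
  have := hs this
  have hb : (b:ℕ) = a - 1 := rfl
  omega

theorem rx_last {n : ℕ} (x : RX d w n) : (x.1 ⟨n, by omega⟩ : ℕ) + 1 = d := by
  by_contra h
  have h0 := st_ge (beta (rectPart d w)) x.1 (n+1) le_rfl
  have hs := x.2.1.all n
  have e := st_succ (beta (rectPart d w)) x.1 n (by omega)
  rw [h0] at e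
  simp only [beta_rect] at e
  generalize x.1 ⟨n, by omega⟩ = a at *
  have ha := a.2
  let b : Fin d := ⟨a + 1, by omega⟩
  have e1 := e a
  have e2 := e b
  rw [if_pos rfl] at e1
  rw [if_neg (fun h => by have := congrArg Fin.val h; simp only [b] at this; omega)] at e2
  have : a < b := by rw [Fin.lt_def]; simp only [b]; omega
  have := hs this
  have hb : (b:ℕ) = a + 1 := rfl
  omega

theorem rsys_ct {n : ℕ} (x : RX d w n) (k : ℕ) : (rsys d w n).ct ((rsys d w n).e x k) = cont (beta (rectPart d w)) x.1 k - (d - 1) := rfl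

theorem rx_c0 {n : ℕ} (x : RX d w n) : (rsys d w n).ct ((rsys d w n).e x 0) = 0 := by
  rw [rsys_ct]
  simp only [cont, show 0 < n + 1 by omega, dif_pos]
  have h0 : st (beta (rectPart d w)) x.1 0 = beta (zeroPart d w) := x.2.2
  rw [h0, beta_zero, rx_first]; simp

theorem rx_cn {n : ℕ} (x : RX d w n) : (rsys d w n).ct ((rsys d w n).e x n) = w - d := by
  rw [rsys_ct]
  simp only [cont, show n < n + 1 by omega, dif_pos]
  have h0 := st_ge (beta (rectPart d w)) x.1 (n+1) le_rfl
  have e := st_succ (beta (rectPart d w)) x.1 n (by omega) (x.1 ⟨n, by omega⟩)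
  rw [h0, if_pos rfl, beta_rect] at e
  have := rx_last x
  omega

theorem cont_pot {m : ℕ} (lam : Fin d → ℤ) (x : Fin m → Fin d) (k : ℕ) (hk : k ≤ m) :
    2 * ∑ j ∈ range k, cont lam x j = ∑ i, st lam x k i * (st lam x k i - 1) - ∑ i, st lam x 0 i * (st lam x 0 i - 1) := by
  induction k with
  | zero => simp
  | succ k ih =>
    rw [Finset.sum_range_succ, mul_add, ih (by omega)]
    have : ∑ i, st lam x (k+1) i * (st lam x (k+1) i - 1) = ∑ i, st lam x k i * (st lam x k i - 1) + 2 * cont lam x k := by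
      rw [← sub_eq_iff_eq_add', ← Finset.sum_sub_distrib, Finset.sum_eq_single (x ⟨k, by omega⟩)]
      · rw [st_succ lam x k (by omega), if_pos rfl]
        simp only [cont, show k < m by omega, dif_pos]; ring
      · intro b _ hb
        rw [st_succ lam x k (by omega), if_neg (Ne.symm hb)]; ring
      · simp
    rw [this]; ring

theorem rx_sum {n : ℕ} (hn : n + 1 = d * w) (x : RX d w n) :
    2 * ∑ k ∈ range (n+1), (rsys d w n).ct ((rsys d w n).e x k) = (n+1) * ((w:ℤ) - d) := by
  have h := cont_pot (beta (rectPart d w)) x.1 (n+1) le_rfl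
  have h0 : st (beta (rectPart d w)) x.1 0 = beta (zeroPart d w) := x.2.2
  rw [h0, st_ge _ _ _ le_rfl, ← Finset.sum_sub_distrib] at h
  have e : ∀ i : Fin d, beta (rectPart d w) i * (beta (rectPart d w) i - 1) - beta (zeroPart d w) i * (beta (zeroPart d w) i - 1) =
    2 * w * ((d:ℤ) - 1) + w * (w - 1) - 2 * w * i := by
    intro i; rw [beta_rect, beta_zero]; ring
  have e3 : (∑ i : Fin d, (i:ℤ)) * 2 = d * (d - 1) := by
    rw [Fin.sum_univ_eq_sum_range (fun i => (i:ℤ)) d]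
    induction d with
    | zero => simp
    | succ k ih => 
      clear * -
      induction k with
      | zero => simp
      | succ k ih => rw [Finset.sum_range_succ, add_mul, ih]; push_cast; ring
  have e4 : (n:ℤ) + 1 = d * w := by exact_mod_cast hn
  rw [Finset.sum_congr rfl (fun i _ => e i), Finset.sum_sub_distrib, ← Finset.mul_sum] at h
  simp only [rsys_ct]
  rw [Finset.sum_sub_distrib, mul_sub, h]
  simp only [Finset.sum_const, Finset.card_univ, Fintype.card_fin, Finset.card_range, nsmul_eq_mul]
  push_cast
  rw [e4]
  linear_combination (-(w:ℤ)) * e3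

theorem blk_prod (r n : ℕ) (f : ℕ → ℝ) (h : (n+1) % r = 0) :
    ((blk r n).map f).prod = ∏ i ∈ (range (n+1)).filter (fun i => (i+1)%r ≠ 0), f i := by
  rw [Finset.range_add_one, Finset.filter_insert, if_neg (by simp [h])]
  have : (range n).filter (fun i => (i+1)%r ≠ 0) = (blk r n).toFinset := by
    ext i; simp [blk]
  rw [this, List.prod_toFinset]
  unfold blk
  exact List.Nodup.filter _ List.nodup_range

theorem trace_one {n r ℓ : ℕ} (hr : 1 ≤ r) (hl : 1 ≤ ℓ) (hN : n + 1 = r * ℓ) :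
    LinearMap.trace ℝ (RX d w n → ℝ) (cyc ((rsys d w n).Rq 1) n ^ ℓ) = Tt (beta (zeroPart d w)) r ℓ (beta (rectPart d w)) := by
  classical
  rw [(rsys d w n).trace_blk r ℓ hr hl hN]
  have h := PS_T (beta (zeroPart d w)) r hr ℓ (beta (rectPart d w)) (beta_anti _)
  rw [← h, show ℓ * r = n + 1 by rw [hN, mul_comm]]
  have e : ∀ x : RX d w n, ((blk r n).map (fun i => 1 / (((rsys d w n).rho i ((rsys d w n).e x) : ℤ) : ℝ))).prod =
      (fun y => ∏ i ∈ (range (n+1)).filter (fun i => (i+1)%r ≠ 0), wt (cont (beta (rectPart d w)) y) i) x.1 := by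
    intro x
    rw [blk_prod r n _ (by rw [hN]; simp)]
    apply Finset.prod_congr rfl
    intro i _
    simp only [wt, Sys.rho, rsys_ct]
    congr 2; ring
  rw [Finset.sum_congr rfl (fun x _ => e x)]
  refine (PX_sum (beta (rectPart d w)) (fun v => v = beta (zeroPart d w)) (fun y => ∏ i ∈ (range (n+1)).filter (fun i => (i+1)%r ≠ 0), wt (cont (beta (rectPart d w)) y) i)).trans ?_
  unfold PS
  apply Finset.sum_congr rfl
  intro y _
  by_cases h1 : Std (beta (rectPart d w)) y
  · rw [if_pos h1]
    beta_reduce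
    rw [Tt_zero_strict (beta_anti _) (h1 0 (by omega))]
    simp only [h1, true_and]
    split_ifs <;> simp
  · rw [if_neg h1, if_neg (fun h => h1 h.1)]

theorem trace_zero_abs {n r ℓ : ℕ} (hn : n + 1 = d * w) (hr : 1 ≤ r) (hl : 1 ≤ ℓ) (hN : n + 1 = r * ℓ) :
    |LinearMap.trace ℝ (RX d w n → ℝ) (cyc ((rsys d w n).Rq 0) n ^ ℓ)| =
      (Set.ncard {E : ℕ → ℕ → ℕ | IsSRT r ℓ (rectPart d w) (zeroPart d w) E} : ℕ) := by
  rw [(rsys d w n).trace_const (w - d) rx_c0 rx_cn (rx_sum hn), trace_one hr hl hN,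
    T_abs _ (beta_anti _).injective _ _ _ (beta_anti _).injective, srt_ncard hr]

end
end RP

namespace RP
open Finset

section
variable {d w n : ℕ}

/-- partition after `k` steps -/
def Lp (x : RX d w n) (k : ℕ) (i : Fin d) : ℤ := st (beta (rectPart d w)) x.1 k i - (d - 1 - i)

theorem Lp_zero (x : RX d w n) (i : Fin d) : Lp x 0 i = 0 := by
  have h0 : st (beta (rectPart d w)) x.1 0 = beta (zeroPart d w) := x.2.2
  unfold Lp; rw [h0, beta_zero]; ring

theorem Lp_ge (x : RX d w n) (k : ℕ) (hk : n + 1 ≤ k) (i : Fin d) : Lp x k i = w := by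
  unfold Lp; rw [st_ge _ _ _ hk, beta_rect]; ring

theorem Lp_succ (x : RX d w n) (k : ℕ) (hk : k < n + 1) (i : Fin d) :
    Lp x (k+1) i = Lp x k i + if x.1 ⟨k, hk⟩ = i then 1 else 0 := by
  unfold Lp; rw [st_succ _ _ _ hk]; ring

theorem Lp_mono (x : RX d w n) (i : Fin d) : Monotone (fun k => Lp x k i) := by
  apply monotone_nat_of_le_succ
  intro k
  by_cases hk : k < n + 1
  · rw [Lp_succ x k hk]; split_ifs <;> omega
  · rw [Lp_ge x k (by omega), Lp_ge x (k+1) (by omega)]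

theorem Lp_anti1 (x : RX d w n) (k : ℕ) (i : ℕ) (hi : i + 1 < d) : Lp x k ⟨i+1, hi⟩ ≤ Lp x k ⟨i, by omega⟩ := by
  have := x.2.1.all k (show (⟨i, by omega⟩ : Fin d) < ⟨i+1, hi⟩ by rw [Fin.lt_def]; simp)
  unfold Lp; push_cast; omega

theorem Th_ex (x : RX d w n) (i : Fin d) (j : ℕ) (hj : j < w) : ∃ k, (j:ℤ) < Lp x k i :=
  ⟨n+1, by rw [Lp_ge x _ le_rfl]; omega⟩

open Classical in
/-- tableau of a path -/
noncomputable def Th (x : RX d w n) (i j : ℕ) : ℕ :=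
  if h : i < d ∧ j < w then Nat.find (Th_ex x ⟨i, h.1⟩ j h.2) else 0

theorem Th_le (x : RX d w n) (i j : ℕ) (hi : i < d) (hj : j < w) (k : ℕ) : Th x i j ≤ k ↔ (j:ℤ) < Lp x k ⟨i, hi⟩ := by
  classical
  unfold Th
  rw [dif_pos ⟨hi, hj⟩, Nat.find_le_iff]
  constructor
  · rintro ⟨m, h1, h2⟩
    exact h2.trans_le (Lp_mono x _ h1)
  · intro h; exact ⟨k, le_rfl, h⟩

/-- row and column of the `k`-th box -/
def bx (x : RX d w n) (k : ℕ) (hk : k < n + 1) : ℕ × ℕ := ((x.1 ⟨k, hk⟩ : ℕ), (Lp x k (x.1 ⟨k, hk⟩)).toNat)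

theorem Lp_nonneg (x : RX d w n) (k : ℕ) (i : Fin d) : 0 ≤ Lp x k i := by
  rw [← Lp_zero x i]; exact Lp_mono x i (Nat.zero_le k)

theorem bx_col (x : RX d w n) (k : ℕ) (hk : k < n + 1) : ((bx x k hk).2 : ℤ) = Lp x k (x.1 ⟨k, hk⟩) :=
  Int.toNat_of_nonneg (Lp_nonneg x k _)

theorem bx_col_lt (x : RX d w n) (k : ℕ) (hk : k < n + 1) : (bx x k hk).2 < w := by
  have h1 := bx_col x k hk
  have h2 := Lp_succ x k hk (x.1 ⟨k, hk⟩)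
  have h3 := Lp_mono x (x.1 ⟨k, hk⟩) (show k + 1 ≤ n + 1 by omega)
  simp only at h3
  rw [Lp_ge x (n+1) le_rfl] at h3
  rw [if_pos rfl] at h2
  omega

theorem bx_row_lt (x : RX d w n) (k : ℕ) (hk : k < n + 1) : (bx x k hk).1 < d := (x.1 ⟨k, hk⟩).2

theorem Th_bx (x : RX d w n) (k : ℕ) (hk : k < n + 1) : Th x (bx x k hk).1 (bx x k hk).2 = k + 1 := by
  have h1 := bx_col x k hk
  have h2 := Lp_succ x k hk (x.1 ⟨k, hk⟩)
  rw [if_pos rfl] at h2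
  have a := Th_le x (bx x k hk).1 (bx x k hk).2 (bx_row_lt x k hk) (bx_col_lt x k hk)
  have e : (⟨(bx x k hk).1, bx_row_lt x k hk⟩ : Fin d) = x.1 ⟨k, hk⟩ := rfl
  simp only [e] at a
  apply le_antisymm
  · rw [a]; omega
  · by_contra hc
    have := (a k).1 (by omega)
    omega

theorem Th_syt (hn : n + 1 = d * w) (x : RX d w n) : IsSYT d w (Th x) := by
  have pos : ∀ i j, i < d → j < w → 1 ≤ Th x i j := by
    intro i j hi hj
    by_contra hc
    have := (Th_le x i j hi hj 0).1 (by omega)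
    rw [Lp_zero] at this
    omega
  refine ⟨?_, ?_, ?_, ?_, ?_⟩
  · intro i j h
    unfold Th
    rw [dif_neg (by omega)]
  · intro i j hi hj
    refine ⟨pos i j hi hj, ?_⟩
    rw [← hn, Th_le x i j hi hj, Lp_ge x _ le_rfl]; omega
  · intro i j hi hj
    have h1 := pos i (j+1) hi hj
    obtain ⟨k, hk⟩ : ∃ k, Th x i (j+1) = k + 1 := ⟨Th x i (j+1) - 1, by omega⟩
    have hkn : k < n + 1 := by
      have : Th x i (j+1) ≤ n + 1 := by rw [Th_le x _ _ hi hj, Lp_ge x _ le_rfl]; push_cast; omega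
      omega
    rw [hk, Nat.lt_succ_iff, Th_le x i j hi (by omega)]
    have h2 := (Th_le x i (j+1) hi hj (k+1)).1 hk.le
    rw [Lp_succ x k hkn] at h2
    split_ifs at h2 <;> push_cast at h2 <;> omega
  · intro i j hi hj
    have h1 := pos (i+1) j hi hj
    obtain ⟨k, hk⟩ : ∃ k, Th x (i+1) j = k + 1 := ⟨Th x (i+1) j - 1, by omega⟩
    have hkn : k < n + 1 := by
      have : Th x (i+1) j ≤ n + 1 := by rw [Th_le x _ _ hi hj, Lp_ge x _ le_rfl]; push_cast; omega
      omega
    rw [hk, Nat.lt_succ_iff, Th_le x i j (by omega) hj]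
    have h2 := (Th_le x (i+1) j hi hj (k+1)).1 hk.le
    have h3 : ¬ (j:ℤ) < Lp x k ⟨i+1, hi⟩ := by
      rw [← Th_le x _ _ hi hj]; omega
    have h4 := Lp_succ x k hkn ⟨i+1, hi⟩
    have h5 : x.1 ⟨k, hkn⟩ = ⟨i+1, hi⟩ := by
      by_contra hc
      rw [if_neg hc] at h4; omega
    have h6 := Lp_succ x k hkn ⟨i, by omega⟩
    rw [if_neg (by rw [h5]; simp)] at h6
    have h7 := Lp_anti1 x (k+1) i hi
    omega
  · intro m h1 h2
    refine ⟨_, _, bx_row_lt x (m-1) (by omega), bx_col_lt x (m-1) (by omega), ?_⟩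
    rw [Th_bx]; omega

theorem syt_inj {E : ℕ → ℕ → ℕ} (hE : IsSYT d w E) {i j i' j' : ℕ} (hi : i < d) (hj : j < w) (hi' : i' < d) (hj' : j' < w)
    (h : E i j = E i' j') : i = i' ∧ j = j' := by
  let f : Fin d × Fin w → Fin (d * w) := fun p => ⟨E p.1 p.2 - 1, by
    have := hE.2.1 p.1 p.2 p.1.2 p.2.2
    omega⟩
  have hs : Function.Surjective f := by
    intro m
    obtain ⟨a, b, ha, hb, hab⟩ := hE.2.2.2.2 (m+1) (by omega) (by have := m.2; omega)
    refine ⟨(⟨a, ha⟩, ⟨b, hb⟩), Fin.ext ?_⟩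
    simp only [f, hab]; omega
  have hb : Function.Bijective f := (Fintype.bijective_iff_surjective_and_card f).2 ⟨hs, by simp⟩
  have := @hb.1 (⟨i, hi⟩, ⟨j, hj⟩) (⟨i', hi'⟩, ⟨j', hj'⟩) (Fin.ext (by simp only [f, h]))
  simp only [Prod.mk.injEq, Fin.mk.injEq] at this
  exact this

theorem Th_injective (hn : n + 1 = d * w) : Function.Injective (Th : RX d w n → _) := by
  intro x y h
  apply Subtype.ext
  funext ⟨k, hk⟩
  have h1 := Th_bx x k hk
  have h2 := Th_bx y k hk
  rw [← h, ← h1] at h2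
  have := syt_inj (Th_syt hn x) (bx_row_lt y k hk) (bx_col_lt y k hk) (bx_row_lt x k hk) (bx_col_lt x k hk) h2
  exact Fin.ext this.1.symm

theorem syt_row_mono {E : ℕ → ℕ → ℕ} (hE : IsSYT d w E) {i j j' : ℕ} (hi : i < d) (hj : j ≤ j') (hj' : j' < w) : E i j ≤ E i j' := by
  induction j', hj using Nat.le_induction with
  | base => exact le_rfl
  | succ k hk ih => exact (ih (by omega)).trans (hE.2.2.1 i k hi hj').le

theorem Th_surj (hn : n + 1 = d * w) {E : ℕ → ℕ → ℕ} (hE : IsSYT d w E) : ∃ x : RX d w n, Th x = E := by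
  classical
  have hex : ∀ k i, ∃ j, ¬ (j < w ∧ E i j ≤ k) := fun k i => ⟨w, fun h => absurd h.1 (lt_irrefl _)⟩
  let f : ℕ → ℕ → ℕ := fun k i => Nat.find (hex k i)
  have hf : ∀ k i j, i < d → (j < f k i ↔ (j < w ∧ E i j ≤ k)) := by
    intro k i j hi
    constructor
    · intro h
      exact not_not.1 (Nat.find_min (hex k i) h)
    · rintro ⟨a, b⟩
      by_contra hc
      have hs := Nat.find_spec (hex k i)
      apply hs
      have hc' : Nat.find (hex k i) ≤ j := not_lt.1 hc
      exact ⟨by omega, (syt_row_mono hE hi hc' a).trans b⟩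
  clear_value f
  have hch : ∀ k : Fin (n+1), ∃ p : Fin d × Fin w, E p.1 p.2 = k + 1 := by
    intro k
    obtain ⟨i, j, hi, hj, h⟩ := hE.2.2.2.2 (k+1) (by omega) (by have := k.2; omega)
    exact ⟨(⟨i, hi⟩, ⟨j, hj⟩), h⟩
  choose p hp using hch
  have fs : ∀ (k : ℕ) (hk : k < n + 1) (i : Fin d), f (k+1) i = f k i + if (p ⟨k, hk⟩).1 = i then 1 else 0 := by
    intro k hk i
    have hpk := hp ⟨k, hk⟩
    simp only at hpk
    by_cases h : (p ⟨k, hk⟩).1 = i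
    · rw [if_pos h]
      rw [h] at hpk
      generalize (p ⟨k, hk⟩).2 = c at *
      have hc := c.2
      have e1 : f k i = c := by
        apply le_antisymm
        · by_contra hcon
          have := (hf k i c i.2).1 (by omega); omega
        · apply le_of_forall_lt
          intro a ha
          rw [hf k i a i.2]
          refine ⟨by omega, ?_⟩
          have := syt_row_mono hE i.2 (show a ≤ c by omega) hc
          by_contra hcon
          have := syt_inj hE i.2 (show a < w by omega) i.2 hc (by omega)
          omega
      have e2 : f (k+1) i = c + 1 := by
        apply le_antisymm
        · by_contra hcon
          have := (hf (k+1) i (c+1) i.2).1 (by omega)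
          have := hE.2.2.1 i c i.2 this.1
          omega
        · have := (hf (k+1) i c i.2).2 ⟨hc, by omega⟩
          omega
      omega
    · rw [if_neg h, add_zero]
      have key : ∀ a, a < f (k+1) i ↔ a < f k i := by
        intro a
        rw [hf _ _ _ i.2, hf _ _ _ i.2]
        constructor
        · rintro ⟨h1, h2⟩
          refine ⟨h1, ?_⟩
          by_contra hcon
          have := syt_inj hE i.2 h1 (p ⟨k, hk⟩).1.2 (p ⟨k, hk⟩).2.2 (by omega)
          exact h (Fin.ext this.1.symm)
        · rintro ⟨h1, h2⟩; exact ⟨h1, by omega⟩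
      exact le_antisymm (le_of_forall_lt fun c hc => (key c).1 hc) (le_of_forall_lt fun c hc => (key c).2 hc)
  let W : Fin (n+1) → Fin d := fun k => (p k).1
  have f0 : ∀ i : Fin d, f 0 i = 0 := by
    intro i
    by_contra hc
    have := (hf 0 i 0 i.2).1 (by omega)
    have := hE.2.1 i 0 i.2 this.1
    omega
  have fN : ∀ i : Fin d, f (n+1) i = w := by
    intro i
    have key : ∀ a, a < f (n+1) i ↔ a < w := by
      intro a
      rw [hf _ _ _ i.2]
      exact ⟨fun h => h.1, fun h => ⟨h, by rw [hn]; exact (hE.2.1 i a i.2 h).2⟩⟩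
    exact le_antisymm (le_of_forall_lt fun c hc => (key c).1 hc) (le_of_forall_lt fun c hc => (key c).2 hc)
  have hst : ∀ t k, k + t = n + 1 → ∀ i, st (beta (rectPart d w)) W k i = f k i + (d - 1 - i) := by
    intro t
    induction t with
    | zero =>
      intro k hk i
      rw [st_ge _ _ _ (by omega), beta_rect, show k = n + 1 by omega, fN]; ring
    | succ t ih =>
      intro k hk i
      have h1 := ih (k+1) (by omega) i
      rw [st_succ _ _ _ (by omega), fs k (by omega)] at h1
      push_cast at h1
      simp only [W] at h1
      have : ((if (p ⟨k, by omega⟩).1 = i then 1 else 0 : ℕ) : ℤ) = if (p ⟨k, by omega⟩).1 = i then (1:ℤ) else 0 := by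
        split_ifs <;> rfl
      push_cast at this
      linarith
  have hStd : Std (beta (rectPart d w)) W := by
    intro k hk
    have e : st (beta (rectPart d w)) W k = fun i : Fin d => (f k i : ℤ) + (d - 1 - (i:ℕ)) := by
      funext i; exact hst (n+1-k) k (by omega) i
    rw [e]
    intro i i' hii
    have hfa : ∀ a b : ℕ, a ≤ b → b < d → f k b ≤ f k a := by
      intro a b hab
      induction b, hab using Nat.le_induction with
      | base => intro _; exact le_rfl
      | succ b hb ih =>
        intro hbd
        refine le_trans ?_ (ih (by omega))
        apply le_of_forall_lt
        intro c hc
        rw [hf _ _ _ hbd] at hc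
        rw [hf _ _ _ (by omega)]
        exact ⟨hc.1, (hE.2.2.2.1 b c hbd hc.1).le.trans hc.2⟩
    have h1 := hfa i i' (by exact hii.le) i'.2
    have h2 : (i:ℕ) < i' := hii
    simp only
    omega
  let x : RX d w n := ⟨W, hStd, by
    funext i
    rw [hst (n+1) 0 (by omega), f0, beta_zero]; simp⟩
  refine ⟨x, ?_⟩
  funext i j
  by_cases h : i < d ∧ j < w
  · have key : ∀ k, k ≤ n + 1 → (Th x i j ≤ k ↔ E i j ≤ k) := by
      intro k hk
      rw [Th_le x i j h.1 h.2]
      have : Lp x k ⟨i, h.1⟩ = f k i := by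
        unfold Lp
        have := hst (n+1-k) k (by omega) ⟨i, h.1⟩
        simp only [x]
        rw [this]; ring
      rw [this, Nat.cast_lt, hf _ _ _ h.1]
      exact ⟨fun h => h.2, fun h' => ⟨h.2, h'⟩⟩
    have h1 := (hE.2.1 i j h.1 h.2).2
    have h2 := ((Th_syt hn x).2.1 i j h.1 h.2).2
    exact le_antisymm ((key _ (by omega)).2 le_rfl) ((key _ (by omega)).1 le_rfl)
  · rw [(Th_syt hn x).1 i j (by omega), hE.1 i j (by omega)]

end
end RP

namespace RP
open Finset

section
variable {d w : ℕ}

def nb (p c : ℕ × ℕ) : Prop := c = (p.1 + 1, p.2) ∨ c = (p.1, p.2 + 1)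

def inR (d w : ℕ) (p : ℕ × ℕ) : Prop := p.1 < d ∧ p.2 < w

theorem slide_cases (m : ℕ) (E : ℕ → ℕ → ℕ) (p : ℕ × ℕ) :
    slideStep d w m E p = p ∨ (nb p (slideStep d w m E p) ∧ (inR d w p → inR d w (slideStep d w m E p)) ∧
      E (slideStep d w m E p).1 (slideStep d w m E p).2 ≤ m) := by
  obtain ⟨p1, p2⟩ := p
  unfold slideStep nb inR
  simp only
  split_ifs with h1 h2 h3 h4
  · right; simp; omega
  · right; simp; omega
  · right; simp; omega
  · right; simp; omega
  · left; rfl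

theorem slide_next {E : ℕ → ℕ → ℕ} (hE : IsSYT d w E) (m : ℕ) (p c : ℕ × ℕ) (hp : inR d w p) (hc : inR d w c) (hEc : E c.1 c.2 = m + 1) :
    (slideStep d w m E p = p → nb p c → slideStep d w (m+1) E p = c) ∧
    (¬ (slideStep d w m E p = p ∧ nb p c) → slideStep d w (m+1) E p = slideStep d w m E p) := by
  obtain ⟨p1, p2⟩ := p
  obtain ⟨c1, c2⟩ := c
  unfold inR at hp hc
  simp only at hp hc hEc
  have hD : p1 + 1 < d → E (p1+1) p2 = m + 1 → c1 = p1 + 1 ∧ c2 = p2 := fun h1 h2 => 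
    syt_inj hE hc.1 hc.2 h1 hp.2 (by omega)
  have hR : p2 + 1 < w → E p1 (p2+1) = m + 1 → c1 = p1 ∧ c2 = p2 + 1 := fun h1 h2 => 
    syt_inj hE hc.1 hc.2 hp.1 h1 (by omega)
  unfold slideStep nb
  simp only [Prod.mk.injEq]
  by_cases hnD : c1 = p1 + 1 ∧ c2 = p2
  · obtain ⟨rfl, rfl⟩ := hnD
    by_cases hb : c2 + 1 < w ∧ E p1 (c2+1) ≤ m
    · have : ¬ (m + 1 < E p1 (c2+1)) := by omega
      have h3 : E p1 (c2+1) ≤ m + 1 := by omega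
      simp [hc.1, hb.1, hb.2, hEc, h3, this]
    · have hb' : ¬ (c2 + 1 < w ∧ E p1 (c2+1) ≤ m + 1) := by
        rintro ⟨h1, h2⟩
        have := hR h1 (by omega)
        omega
      simp [hc.1, hb, hb', hEc]
  · by_cases hnR : c1 = p1 ∧ c2 = p2 + 1
    · obtain ⟨rfl, rfl⟩ := hnR
      by_cases hb : c1 + 1 < d ∧ E (c1+1) p2 ≤ m
      · have : E (c1+1) p2 < m + 1 := by omega
        have h3 : E (c1+1) p2 ≤ m + 1 := by omega
        simp [hc.2, hb.1, hb.2, hEc, h3, this]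
      · have hb' : ¬ (c1 + 1 < d ∧ E (c1+1) p2 ≤ m + 1) := by
          rintro ⟨h1, h2⟩
          have := hD h1 (by omega)
          omega
        simp [hc.2, hb, hb', hEc]
    · have a1 : (p1 + 1 < d ∧ E (p1+1) p2 ≤ m + 1) ↔ (p1 + 1 < d ∧ E (p1+1) p2 ≤ m) := by
        constructor
        · rintro ⟨h1, h2⟩
          refine ⟨h1, ?_⟩
          by_contra h3
          exact hnD (hD h1 (by omega))
        · rintro ⟨h1, h2⟩; exact ⟨h1, by omega⟩
      have a2 : (p2 + 1 < w ∧ E p1 (p2+1) ≤ m + 1) ↔ (p2 + 1 < w ∧ E p1 (p2+1) ≤ m) := by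
        constructor
        · rintro ⟨h1, h2⟩
          refine ⟨h1, ?_⟩
          by_contra h3
          exact hnR (hR h1 (by omega))
        · rintro ⟨h1, h2⟩; exact ⟨h1, by omega⟩
      simp only [a1, a2]
      refine ⟨fun _ h => ?_, fun _ => by trivial⟩
      rcases h with h | h
      · exact absurd h hnD
      · exact absurd h hnR

theorem slide_stay {E : ℕ → ℕ → ℕ} (hE : IsSYT d w E) (m : ℕ) (c : ℕ × ℕ) (hc : inR d w c) (hEc : m ≤ E c.1 c.2) :
    slideStep d w m E c = c := by
  obtain ⟨c1, c2⟩ := c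
  unfold inR at hc
  simp only at hc hEc
  have h1 : ¬ (c1 + 1 < d ∧ E (c1+1) c2 ≤ m) := by
    rintro ⟨h1, h2⟩
    have := hE.2.2.2.1 c1 c2 h1 hc.2
    omega
  have h2 : ¬ (c2 + 1 < w ∧ E c1 (c2+1) ≤ m) := by
    rintro ⟨h1, h2⟩
    have := hE.2.2.1 c1 c2 hc.1 h1
    omega
  simp [slideStep, h1, h2]

theorem nb_lt {E : ℕ → ℕ → ℕ} (hE : IsSYT d w E) (p c : ℕ × ℕ) (hp : inR d w p) (hc : inR d w c) (h : nb p c) : E p.1 p.2 < E c.1 c.2 := by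
  unfold inR at *
  rcases h with rfl | rfl
  · exact hE.2.2.2.1 _ _ hc.1 hp.2
  · exact hE.2.2.1 _ _ hp.1 hc.2

theorem nb_sum {p c : ℕ × ℕ} (h : nb p c) : c.1 + c.2 = p.1 + p.2 + 1 := by
  rcases h with rfl | rfl <;> simp only <;> omega

theorem syt_corner {E : ℕ → ℕ → ℕ} (hE : IsSYT d w E) (hN : 1 ≤ d * w) : 0 < d ∧ 0 < w ∧ E 0 0 = 1 := by
  obtain ⟨i, j, hi, hj, h⟩ := hE.2.2.2.2 1 le_rfl hN
  refine ⟨by omega, by omega, ?_⟩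
  have h1 := (hE.2.1 0 0 (by omega) (by omega)).1
  have h2 := syt_row_mono hE (show 0 < d by omega) (Nat.zero_le j) hj
  have h3 : ∀ a, a < d → E 0 j ≤ E a j := by
    intro a
    induction a with
    | zero => intro _; exact le_rfl
    | succ a ih => intro ha; exact (ih (by omega)).trans (hE.2.2.2.1 a j ha hj).le
  have := h3 i hi
  omega

theorem path_struct {E : ℕ → ℕ → ℕ} (hE : IsSYT d w E) (m : ℕ) (hm : 1 ≤ m) (hN : m ≤ d * w) :
    ∃ (T : ℕ) (b : ℕ × ℕ), T + 1 ≤ m ∧ inR d w b ∧ E b.1 b.2 ≤ m ∧ b.1 + b.2 = T ∧ slideStep d w m E b = b ∧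
      (∀ t, T ≤ t → slidePath d w m E t = b) ∧
      (∀ t, t ≤ T → (slidePath d w m E t).1 + (slidePath d w m E t).2 = t ∧ inR d w (slidePath d w m E t) ∧
        E (slidePath d w m E t).1 (slidePath d w m E t).2 ≤ m) := by
  classical
  obtain ⟨hd, hw, h00⟩ := syt_corner hE (by omega)
  let p := slidePath d w m E
  have ps : ∀ t, p (t+1) = slideStep d w m E (p t) := fun t => rfl
  have p0 : p 0 = (0, 0) := rfl
  change ∃ (T : ℕ) (b : ℕ × ℕ), T + 1 ≤ m ∧ inR d w b ∧ E b.1 b.2 ≤ m ∧ b.1 + b.2 = T ∧ slideStep d w m E b = b ∧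
      (∀ t, T ≤ t → p t = b) ∧
      (∀ t, t ≤ T → (p t).1 + (p t).2 = t ∧ inR d w (p t) ∧ E (p t).1 (p t).2 ≤ m)
  clear_value p
  have main : ∀ t, (∀ s, s < t → slideStep d w m E (p s) ≠ p s) → (p t).1 + (p t).2 = t ∧ inR d w (p t) ∧ E (p t).1 (p t).2 ≤ m ∧ t + 1 ≤ E (p t).1 (p t).2 := by
    intro t
    induction t with
    | zero => intro _; rw [p0]; exact ⟨rfl, ⟨hd, hw⟩, by show E 0 0 ≤ m; omega, by show 0 + 1 ≤ E 0 0; omega⟩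
    | succ t ih =>
      intro h
      obtain ⟨h1, h2, h3, h4⟩ := ih (fun s hs => h s (by omega))
      rcases slide_cases (d := d) (w := w) m E (p t) with h5 | ⟨h5, h6, h7⟩
      · exact absurd h5 (h t (by omega))
      · rw [← ps] at h5 h6 h7
        have h8 := nb_lt hE _ _ h2 (h6 h2) h5
        have h9 := nb_sum h5
        exact ⟨by omega, h6 h2, h7, by omega⟩
  have hex : ∃ t, slideStep d w m E (p t) = p t := by
    by_contra hc
    push Not at hc
    obtain ⟨_, _, h3, h4⟩ := main m (fun s _ => hc s)
    omega
  have hT := Nat.find_spec hex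
  have hm' := fun s (hs : s < Nat.find hex) => Nat.find_min hex hs
  generalize Nat.find hex = T at hT hm'
  have hTT := main T hm'
  refine ⟨T, p T, by omega, hTT.2.1, hTT.2.2.1, hTT.1, hT, ?_, ?_⟩
  · intro t ht
    induction t, ht using Nat.le_induction with
    | base => rfl
    | succ t _ ih => rw [ps, ih, hT]
  · intro t ht
    have := main t (fun s hs => hm' s (by omega))
    exact ⟨this.1, this.2.1, this.2.2.1⟩

theorem promo_step {E : ℕ → ℕ → ℕ} (hE : IsSYT d w E) (m : ℕ) (hm : 1 ≤ m) (hN : m + 1 ≤ d * w) :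
    ∃ b c : ℕ × ℕ, inR d w b ∧ inR d w c ∧ b ≠ c ∧ partialPromo d w m E b.1 b.2 = m ∧ partialPromo d w m E c.1 c.2 = m + 1 ∧
      (nb b c → partialPromo d w (m+1) E = partialPromo d w m E) ∧
      (¬ nb b c → partialPromo d w (m+1) E b.1 b.2 = m + 1 ∧ partialPromo d w (m+1) E c.1 c.2 = m ∧
        ∀ i j, (i, j) ≠ b → (i, j) ≠ c → partialPromo d w (m+1) E i j = partialPromo d w m E i j) := by
  obtain ⟨c1, c2, hc1, hc2, hEc⟩ := hE.2.2.2.2 (m+1) (by omega) hN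
  obtain ⟨T, ⟨b1, b2⟩, hTm, hbR, hEb, hbT, hbs, hge, hle⟩ := path_struct hE m hm (by omega)
  have hcR : inR d w (c1, c2) := ⟨hc1, hc2⟩
  let p := slidePath d w m E
  let q := slidePath d w (m+1) E
  have ps : ∀ t, p (t+1) = slideStep d w m E (p t) := fun t => rfl
  have qs : ∀ t, q (t+1) = slideStep d w (m+1) E (q t) := fun t => rfl
  have pq0 : q 0 = p 0 := rfl
  have hF : ∀ i j, partialPromo d w m E i j = if d ≤ i ∨ w ≤ j then 0
    else if (i, j) = p m then m
    else if p (i + j) = (i, j) then E (p (i + j + 1)).1 (p (i + j + 1)).2 - 1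
    else if E i j ≤ m then E i j - 1 else E i j := fun i j => rfl
  have hF' : ∀ i j, partialPromo d w (m+1) E i j = if d ≤ i ∨ w ≤ j then 0
    else if (i, j) = q (m+1) then m+1
    else if q (i + j) = (i, j) then E (q (i + j + 1)).1 (q (i + j + 1)).2 - 1
    else if E i j ≤ m+1 then E i j - 1 else E i j := fun i j => rfl
  change ∀ t, T ≤ t → p t = (b1, b2) at hge
  change ∀ t, t ≤ T → (p t).1 + (p t).2 = t ∧ inR d w (p t) ∧ E (p t).1 (p t).2 ≤ m at hle
  clear_value p q
  simp only at hEb hbT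
  have pm : p m = (b1, b2) := hge m (by omega)
  have pE : ∀ t, inR d w (p t) ∧ E (p t).1 (p t).2 ≤ m := by
    intro t
    rcases Nat.lt_or_ge t T with h | h
    · exact (hle t h.le).2
    · rw [hge t h]; exact ⟨hbR, hEb⟩
  have pc : ∀ t, p t ≠ (c1, c2) := by
    intro t h
    have := (pE t).2
    rw [h] at this
    simp only at this; omega
  have hbc : (b1, b2) ≠ (c1, c2) := by rw [← pm]; exact pc m
  have nR : ¬ (d ≤ c1 ∨ w ≤ c2) := by omega
  have nRb : ¬ (d ≤ b1 ∨ w ≤ b2) := by unfold inR at hbR; simp only at hbR; omega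
  have Fb : partialPromo d w m E b1 b2 = m := by
    rw [hF, if_neg nRb, if_pos pm.symm]
  have Fc : partialPromo d w m E c1 c2 = m + 1 := by
    rw [hF, if_neg nR, if_neg (pc m).symm, if_neg (pc _), if_neg (by omega), hEc]
  refine ⟨(b1, b2), (c1, c2), hbR, hcR, hbc, Fb, Fc, ?_, ?_⟩
  · intro hnb
    have hTc := nb_sum hnb
    simp only at hTc
    have q1 : ∀ t, t ≤ T → q t = p t := by
      intro t
      induction t with
      | zero => intro _; exact pq0
      | succ t ih =>
        intro ht
        rw [qs, ih (by omega), ps]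
        apply (slide_next hE m (p t) (c1, c2) (pE t).1 hcR hEc).2
        rintro ⟨h, -⟩
        have h1 := (hle t (by omega)).1
        have h2 := (hle (t+1) ht).1
        rw [ps, h] at h2
        omega
    have q2 : ∀ t, T + 1 ≤ t → q t = (c1, c2) := by
      intro t ht
      induction t, ht using Nat.le_induction with
      | base =>
        rw [qs, q1 T le_rfl, hge T le_rfl]
        exact (slide_next hE m (b1, b2) (c1, c2) hbR hcR hEc).1 hbs hnb
      | succ t _ ih => rw [qs, ih]; exact slide_stay hE (m+1) _ hcR (by simp only; omega)
    funext i j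
    by_cases h0 : d ≤ i ∨ w ≤ j
    · rw [hF, hF', if_pos h0, if_pos h0]
    by_cases hc : (i, j) = (c1, c2)
    · obtain ⟨rfl, rfl⟩ := Prod.mk.inj hc
      rw [Fc, hF', if_neg h0, if_pos (q2 (m+1) (by omega)).symm]
    by_cases hb : (i, j) = (b1, b2)
    · obtain ⟨rfl, rfl⟩ := Prod.mk.inj hb
      rw [Fb, hF', if_neg h0, q2 (m+1) (by omega), if_neg hbc, if_pos (by rw [q1 _ (by omega), hge _ (by omega)]),
        q2 _ (by omega)]
      simp only; omega
    rw [hF, hF', if_neg h0, if_neg h0, pm, if_neg hb, q2 (m+1) (by omega), if_neg hc]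
    have hEij : E i j ≤ m + 1 ↔ E i j ≤ m := by
      constructor
      · intro h
        by_contra h'
        have := syt_inj hE (show i < d by omega) (show j < w by omega) hc1 hc2 (by omega)
        exact hc (by rw [this.1, this.2])
      · omega
    simp only [hEij]
    rcases lt_trichotomy (i+j) T with h | h | h
    · rw [q1 _ h.le, q1 _ (by omega)]
    · have n1 : ¬ (b1, b2) = (i, j) := fun h' => hb h'.symm
      rw [q1 _ h.le, hge _ h.ge, if_neg n1, if_neg n1]
    · have n1 : ¬ (b1, b2) = (i, j) := fun h' => hb h'.symm
      have n2 : ¬ (c1, c2) = (i, j) := fun h' => hc h'.symm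
      rw [q2 _ (by omega), hge _ h.le, if_neg n1, if_neg n2]
  · intro hnb
    have q1 : ∀ t, q t = p t := by
      intro t
      induction t with
      | zero => exact pq0
      | succ t ih =>
        rw [qs, ih, ps]
        apply (slide_next hE m (p t) (c1, c2) (pE t).1 hcR hEc).2
        rintro ⟨h, h'⟩
        rcases Nat.lt_or_ge t T with h3 | h3
        · have h1 := (hle t (by omega)).1
          have h2 := (hle (t+1) h3).1
          rw [ps, h] at h2
          omega
        · rw [hge t h3] at h'; exact hnb h'
    obtain rfl : q = p := funext q1
    have pm' : q (m+1) = (b1, b2) := hge _ (by omega)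
    refine ⟨?_, ?_, ?_⟩
    · rw [hF', if_neg nRb, if_pos pm'.symm]
    · show partialPromo d w (m+1) E c1 c2 = m
      rw [hF', if_neg nR, if_neg (pc _).symm, if_neg (pc _), if_pos (by omega), hEc]; rfl
    · intro i j hb hc
      rw [hF, hF', pm, pm', if_neg hb, if_neg hb]
      by_cases h0 : d ≤ i ∨ w ≤ j
      · rw [if_pos h0, if_pos h0]
      have hEij : E i j ≤ m + 1 ↔ E i j ≤ m := by
        constructor
        · intro h
          by_contra h'
          have := syt_inj hE (show i < d by omega) (show j < w by omega) hc1 hc2 (by omega)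
          exact hc (by rw [this.1, this.2])
        · omega
      simp only [hEij]

theorem promo_one {E : ℕ → ℕ → ℕ} (hE : IsSYT d w E) (hN : 1 ≤ d * w) : partialPromo d w 1 E = E := by
  obtain ⟨hd, hw, h00⟩ := syt_corner hE hN
  have hp : ∀ t, slidePath d w 1 E t = (0, 0) := by
    intro t
    induction t with
    | zero => rfl
    | succ t ih =>
      show slideStep d w 1 E (slidePath d w 1 E t) = _
      rw [ih]; exact slide_stay hE 1 _ ⟨hd, hw⟩ (by simp only; omega)
  funext i j
  unfold partialPromo
  simp only [hp]
  by_cases h0 : d ≤ i ∨ w ≤ j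
  · rw [if_pos h0, hE.1 i j h0]
  rw [if_neg h0]
  by_cases h1 : (i, j) = (0, 0)
  · obtain ⟨rfl, rfl⟩ := Prod.mk.inj h1
    rw [if_pos rfl, h00]
  · rw [if_neg h1, if_neg (fun h => h1 h.symm), if_neg]
    intro h
    have h2 := hE.2.1 i j (by omega) (by omega)
    have := syt_inj hE (show i < d by omega) (show j < w by omega) hd hw (by omega)
    exact h1 (by rw [this.1, this.2])

end
end RP

namespace RP
open Finset

section
variable {d w n : ℕ}

theorem cont_bx (x : RX d w n) (k : ℕ) (hk : k < n + 1) :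
    cont (beta (rectPart d w)) x.1 k = ((bx x k hk).2 : ℤ) - (bx x k hk).1 + (d - 1) := by
  rw [bx_col]
  simp only [cont, hk, dif_pos, Lp, bx]
  ring

theorem e_bx (x : RX d w n) (k : ℕ) (hk : k < n + 1) :
    (rsys d w n).e x k = ((bx x k hk).1, ((bx x k hk).2 : ℤ) - (bx x k hk).1 + (d - 1)) := by
  rw [← cont_bx]
  show (rw' x.1 k, _) = _
  simp only [rw', hk, dif_pos, bx]

theorem bx_of_e (x y : RX d w n) (k j : ℕ) (hk : k < n + 1) (hj : j < n + 1)
    (h : (rsys d w n).e x k = (rsys d w n).e y j) : bx x k hk = bx y j hj := by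
  rw [e_bx x k hk, e_bx y j hj] at h
  obtain ⟨h1, h2⟩ := Prod.mk.inj h
  apply Prod.ext h1
  omega

theorem rho_bx (x : RX d w n) (k : ℕ) (hk : k + 1 < n + 1) :
    (rsys d w n).rho k ((rsys d w n).e x) =
      (((bx x (k+1) hk).2 : ℤ) - (bx x (k+1) hk).1) - (((bx x k (by omega)).2 : ℤ) - (bx x k (by omega)).1) := by
  unfold Sys.rho
  rw [rsys_ct, rsys_ct, cont_bx x k (by omega), cont_bx x (k+1) hk]
  ring

theorem rho_one_bx (x : RX d w n) (k : ℕ) (hk : k + 1 < n + 1) (h : (rsys d w n).rho k ((rsys d w n).e x) = 1) :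
    bx x (k+1) hk = ((bx x k (by omega)).1, (bx x k (by omega)).2 + 1) := by
  have h1 : x.1 ⟨k, by omega⟩ = x.1 ⟨k+1, hk⟩ := by
    rw [← loc_one x.2.1 k hk]
    unfold Sys.rho at h
    rw [rsys_ct, rsys_ct] at h
    omega
  have h2 : (bx x (k+1) hk).1 = (bx x k (by omega)).1 := by simp only [bx]; rw [h1]
  rw [rho_bx x k hk] at h
  apply Prod.ext
  · exact h2
  · simp only; omega

theorem rho_neg_bx (x : RX d w n) (k : ℕ) (hk : k + 1 < n + 1) (h : (rsys d w n).rho k ((rsys d w n).e x) = -1) :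
    bx x (k+1) hk = ((bx x k (by omega)).1 + 1, (bx x k (by omega)).2) := by
  have hr := h
  unfold Sys.rho at h
  rw [rsys_ct, rsys_ct] at h
  have h1 : x.1 ⟨k, by omega⟩ ≠ x.1 ⟨k+1, hk⟩ := by
    intro h1
    have := (loc_one x.2.1 k hk).2 h1
    omega
  have h3 := loc_ne (beta (rectPart d w)) x.1 k hk h1
  have h4 : cont (beta (rectPart d w)) x.1 k = st (beta (rectPart d w)) x.1 k (x.1 ⟨k, by omega⟩) := by
    simp [cont, show k < n + 1 by omega]
  have hs := x.2.1.all k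
  have h2 : (bx x (k+1) hk).1 = (bx x k (by omega)).1 + 1 := by
    simp only [bx]
    generalize x.1 ⟨k, by omega⟩ = a at *
    generalize x.1 ⟨k+1, hk⟩ = b at *
    have hab : a < b := by
      rw [← hs.lt_iff_gt]; omega
    by_contra hne
    have hab' : (a : ℕ) + 1 < b := by
      have : (a : ℕ) < b := hab
      omega
    have l1 : st (beta (rectPart d w)) x.1 k ⟨a+1, by omega⟩ < st (beta (rectPart d w)) x.1 k a := hs (by
      show (a : ℕ) < a + 1; omega)
    have l2 : st (beta (rectPart d w)) x.1 k b < st (beta (rectPart d w)) x.1 k ⟨a+1, by omega⟩ := hs (by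
      show (a : ℕ) + 1 < b; omega)
    omega
  rw [rho_bx x k hk] at hr
  apply Prod.ext
  · exact h2
  · simp only; omega

theorem nb_rho (x : RX d w n) (k : ℕ) (hk : k + 1 < n + 1) :
    nb (bx x k (by omega)) (bx x (k+1) hk) ↔ ((rsys d w n).rho k ((rsys d w n).e x) = 1 ∨ (rsys d w n).rho k ((rsys d w n).e x) = -1) := by
  constructor
  · intro h
    rw [rho_bx x k hk]
    rcases h with h | h <;> rw [h]
    · right; simp only; push_cast; ring
    · left; simp only; push_cast; ring
  · rintro (h | h)
    · right; exact rho_one_bx x k hk h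
    · left; exact rho_neg_bx x k hk h

open Classical in
noncomputable def tq (k : ℕ) (x : RX d w n) : RX d w n :=
  if h : k < n ∧ (rsys d w n).rho k ((rsys d w n).e x) ≠ 1 ∧ (rsys d w n).rho k ((rsys d w n).e x) ≠ -1 then
    ((rsys d w n).cl x k h.1 h.2.1 h.2.2).choose else x

theorem tq_pos {k : ℕ} {x : RX d w n} (hk : k < n) (h1 : (rsys d w n).rho k ((rsys d w n).e x) ≠ 1)
    (h2 : (rsys d w n).rho k ((rsys d w n).e x) ≠ -1) : (rsys d w n).e (tq k x) = sg k ((rsys d w n).e x) := by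
  unfold tq
  rw [dif_pos ⟨hk, h1, h2⟩]
  exact ((rsys d w n).cl x k hk h1 h2).choose_spec

theorem tq_one {k : ℕ} {x : RX d w n} (h1 : (rsys d w n).rho k ((rsys d w n).e x) = 1) : tq k x = x := by
  unfold tq
  rw [dif_neg]; tauto

theorem tq_neg {k : ℕ} {x : RX d w n} (h1 : (rsys d w n).rho k ((rsys d w n).e x) = -1) : tq k x = x := by
  unfold tq
  rw [dif_neg]; tauto

noncomputable def Tq (k : ℕ) : Module.End ℝ (RX d w n → ℝ) := LinearMap.funLeft ℝ ℝ (tq k)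

theorem Tq_apply (k : ℕ) (v : RX d w n → ℝ) (x : RX d w n) : Tq k v x = v (tq k x) := rfl

noncomputable def Jq (d w n k : ℕ) : Module.End ℝ (RX d w n → ℝ) :=
  Sys.dg (fun x => (-1 : ℝ) ^ ((rsys d w n).e x k).1)

theorem RJ (k : ℕ) (hk : k < n) : (rsys d w n).Rq 0 k * Jq d w n (k+1) = Jq d w n k * Tq k := by
  apply LinearMap.ext; intro v; funext x
  have hk' : k + 1 < n + 1 := by omega
  simp only [Module.End.mul_apply, Sys.Rq, Sys.op_apply, Jq, Sys.dg_apply, Tq_apply]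
  rw [(rsys d w n).ext_dg (fun _ l => (-1 : ℝ) ^ l.1) (k+1)]
  by_cases h1 : (rsys d w n).rho k ((rsys d w n).e x) = 1
  · rw [h1, aq_one, fq_one, tq_one h1, e_bx x k (by omega), e_bx x (k+1) hk', rho_one_bx x k hk' h1]
    simp
  by_cases h2 : (rsys d w n).rho k ((rsys d w n).e x) = -1
  · rw [h2, aq_neg, fq_neg, aq_one, fq_one, tq_neg h2, e_bx x k (by omega), e_bx x (k+1) hk', rho_neg_bx x k hk' h2]
    simp only
    rw [pow_succ]; ring
  · rw [aq_zero _ h1 h2, fq_zero _ h1 h2, ← tq_pos hk h1 h2, Sys.ext_e, tq_pos hk h1 h2, sg_apply]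
    simp

noncomputable def Pq (x : RX d w n) : ℕ → RX d w n
  | 0 => x
  | k + 1 => tq k (Pq x k)

theorem cycT (k : ℕ) (v : RX d w n → ℝ) (x : RX d w n) : cyc (Tq (d := d) (w := w) (n := n)) k v x = v (Pq x k) := by
  induction k generalizing v with
  | zero => simp [Pq]
  | succ k ih => rw [cyc_succ, Module.End.mul_apply, ih, Tq_apply, Pq]

theorem cycRJ (k : ℕ) (hk : k ≤ n) :
    cyc ((rsys d w n).Rq 0) k * Jq d w n k = Jq d w n 0 * cyc Tq k := by
  induction k with
  | zero => simp
  | succ k ih => rw [cyc_succ, mul_assoc, RJ k (by omega), ← mul_assoc, ih (by omega), mul_assoc, cyc_succ]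

theorem trace_abs (ℓ : ℕ) :
    |LinearMap.trace ℝ (RX d w n → ℝ) (cyc ((rsys d w n).Rq 0) n ^ ℓ)| =
      (Set.ncard {x : RX d w n | (fun x => Pq x n)^[ℓ] x = x} : ℕ) := by
  classical
  have J0 : Jq d w n 0 = 1 := by
    apply LinearMap.ext; intro v; funext x
    have : (bx x 0 (by omega)).1 = 0 := rx_first x
    simp [Jq, Sys.dg_apply, e_bx x 0 (by omega), this]
  have Jn : Jq d w n n = ((-1 : ℝ) ^ (d - 1)) • 1 := by
    apply LinearMap.ext; intro v; funext x
    have : (bx x n (by omega)).1 + 1 = d := rx_last x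
    have h2 : (bx x n (by omega)).1 = d - 1 := by omega
    simp [Jq, Sys.dg_apply, e_bx x n (by omega), h2]
  have h := cycRJ (d := d) (w := w) n le_rfl
  rw [J0, Jn, one_mul, mul_smul_comm, mul_one] at h
  have hs : ((-1 : ℝ) ^ (d-1)) * (-1 : ℝ) ^ (d-1) = 1 := by rw [← mul_pow]; simp
  have h' : cyc ((rsys d w n).Rq 0) n = ((-1 : ℝ) ^ (d - 1)) • cyc Tq n := by
    rw [← h, smul_smul, hs, one_smul]
  have hp : ∀ ℓ (v : RX d w n → ℝ) x, (cyc (Tq (d := d) (w := w) (n := n)) n ^ ℓ) v x = v ((fun x => Pq x n)^[ℓ] x) := by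
    intro ℓ
    induction ℓ with
    | zero => intro v x; simp
    | succ ℓ ih =>
      intro v x
      rw [pow_succ, Module.End.mul_apply, ih, cycT, Function.iterate_succ_apply']
  rw [h', _root_.smul_pow, map_smul, smul_eq_mul, abs_mul, ← pow_mul, abs_pow, abs_neg, abs_one, one_pow, one_mul,
    Sys.trace_eq]
  simp only [hp, Pi.single_apply]
  rw [Finset.sum_boole, abs_of_nonneg (by positivity), Set.ncard_eq_toFinset_card']
  simp

theorem Th_Pq (hn : n + 1 = d * w) (x : RX d w n) (k : ℕ) (hk : k ≤ n) :
    Th (Pq x k) = partialPromo d w (k+1) (Th x) := by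
  induction k with
  | zero => rw [zero_add, promo_one (Th_syt hn x) (by omega)]; rfl
  | succ k ih =>
    specialize ih (by omega)
    have hk0 : k < n + 1 := by omega
    have hk1 : k + 1 < n + 1 := by omega
    obtain ⟨b, c, hb, hc, hbc, Fb, Fc, h1, h2⟩ := promo_step (Th_syt hn x) (k+1) (by omega) (by omega)
    rw [← ih] at Fb Fc h1 h2
    show Th (tq k (Pq x k)) = _
    generalize Pq x k = y at *
    have sy := Th_syt hn y
    have eb : bx y k hk0 = b := by
      have := syt_inj sy (bx_row_lt y k hk0) (bx_col_lt y k hk0) hb.1 hb.2 (by rw [Th_bx, Fb])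
      exact Prod.ext this.1 this.2
    have ec : bx y (k+1) hk1 = c := by
      have := syt_inj sy (bx_row_lt y (k+1) hk1) (bx_col_lt y (k+1) hk1) hc.1 hc.2 (by rw [Th_bx, Fc])
      exact Prod.ext this.1 this.2
    have hnb := nb_rho y k hk1
    rw [eb, ec] at hnb
    by_cases hh : nb b c
    · rw [h1 hh]
      rcases hnb.1 hh with h | h
      · rw [tq_one h]
      · rw [tq_neg h]
    · have n1 := fun h => hh (hnb.2 (Or.inl h))
      have n2 := fun h => hh (hnb.2 (Or.inr h))
      have he := tq_pos (show k < n by omega) n1 n2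
      obtain ⟨g1, g2, g3⟩ := h2 hh
      have sy' := Th_syt hn (tq k y)
      funext i j
      by_cases h0 : d ≤ i ∨ w ≤ j
      · rw [sy'.1 i j h0]; unfold partialPromo; rw [if_pos h0]
      have hi : i < d := by omega
      have hj : j < w := by omega
      have hm := sy.2.1 i j hi hj
      obtain ⟨m, hm'⟩ : ∃ m, Th y i j = m + 1 := ⟨Th y i j - 1, by omega⟩
      have hmn : m < n + 1 := by omega
      have em : bx y m hmn = (i, j) := by
        have := syt_inj sy (bx_row_lt y m hmn) (bx_col_lt y m hmn) hi hj (by rw [Th_bx, hm'])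
        exact Prod.ext this.1 this.2
      have hsw : ∀ p (hp : p < n + 1), sg k ((rsys d w n).e y) p = (rsys d w n).e y m → Th (tq k y) i j = p + 1 := by
        intro p hp h
        have := bx_of_e (tq k y) y p m hp hmn (by rw [he, h])
        rw [em] at this
        have h3 := Th_bx (tq k y) p hp
        rw [this] at h3
        exact h3
      by_cases c1 : m = k
      · subst c1
        rw [hsw (m+1) hk1 (by simp [sg_apply])]
        have : (i, j) = b := em.symm.trans eb
        subst this
        exact g1.symm
      by_cases c2 : m = k + 1
      · subst c2
        rw [hsw k hk0 (by simp [sg_apply])]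
        have : (i, j) = c := em.symm.trans ec
        subst this
        exact g2.symm
      · rw [hsw m hmn (by rw [sg_apply, if_neg c1, if_neg c2]), g3, hm']
        · rintro rfl; exact c1 (by simp only at Fb; omega)
        · rintro rfl; exact c2 (by simp only at Fc; omega)

theorem main_count (hn : n + 1 = d * w) {r ℓ : ℕ} (hr : 1 ≤ r) (hl : 1 ≤ ℓ) (hN : n + 1 = r * ℓ) :
    Set.ncard {E : ℕ → ℕ → ℕ | IsSYT d w E ∧ (promo d w)^[ℓ] E = E} =
      Set.ncard {E : ℕ → ℕ → ℕ | IsSRT r ℓ (rectPart d w) (zeroPart d w) E} := by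
  have h := trace_zero_abs (d := d) (w := w) hn hr hl hN
  rw [trace_abs] at h
  rw [← Nat.cast_injective (R := ℝ) h]
  have hP : ∀ x : RX d w n, promo d w (Th x) = Th (Pq x n) := by
    intro x
    rw [Th_Pq hn x n le_rfl, hn]; rfl
  have hPl : ∀ ℓ (x : RX d w n), (promo d w)^[ℓ] (Th x) = Th ((fun x => Pq x n)^[ℓ] x) := by
    intro ℓ
    induction ℓ with
    | zero => intro x; rfl
    | succ ℓ ih => intro x; rw [Function.iterate_succ_apply, hP, ih, Function.iterate_succ_apply]
  rw [← Set.ncard_image_of_injective _ (Th_injective (n := n) hn)]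
  congr 1
  ext E
  simp only [Set.mem_setOf_eq, Set.mem_image]
  constructor
  · rintro ⟨h1, h2⟩
    obtain ⟨x, rfl⟩ := Th_surj hn h1
    refine ⟨x, ?_, rfl⟩
    rw [hPl] at h2
    exact Th_injective hn h2
  · rintro ⟨x, h1, rfl⟩
    exact ⟨Th_syt hn x, by rw [hPl, h1]⟩

end
end RP


/-- Suppose `r ∣ N = d(n-d)` (`N = rℓ`). The number of standard
Young tableaux of rectangular shape `(n-d)^d` fixed by `𝑗^{N/r}` equals the
number of standard `r`-ribbon tableaux of shape `(n-d)^d`. -/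
theorem statement2 (d n r ℓ : ℕ) (hd : 0 < d) (hdn : d < n) (hr : 1 ≤ r)
    (hrl : r * ℓ = d * (n - d)) :
    Set.ncard {E : ℕ → ℕ → ℕ |
        IsSYT d (n - d) E ∧ (promo d (n - d))^[ℓ] E = E} =
      Set.ncard {E : ℕ → ℕ → ℕ |
        IsSRT r ℓ (rectPart d (n - d)) (zeroPart d (n - d)) E} := by
  have hw : 0 < n - d := by omega
  have hpos : 0 < d * (n - d) := Nat.mul_pos hd hw
  have hl : 1 ≤ ℓ := by
    rcases Nat.eq_zero_or_pos ℓ with h | h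
    · rw [h, Nat.mul_zero] at hrl; omega
    · exact h
  exact RP.main_count (n := d * (n - d) - 1) (by omega) hr hl (by omega)
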